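/- Every homogeneous B_N quasi-invariant arises as a leading term of a trigonometric BC_N quasi-invariant: for every nonzero homogeneous q ∈ Q_{m̃} there exists p ∈ Q_m^{tr}(BC_N) whose highest-degree homogeneous part equals q. (Equivalently, gr(Q_m^{tr}(BC_N)) = Q_{m̃}.) -/

import Mathlib

open MvPolynomial

noncomputable section

/-- Substitution `x ↦ x + v` on polynomials. -/
def shiftPoly {n : ℕ} (v : Fin n → ℂ) (p : MvPolynomial (Fin n) ℂ) :
    MvPolynomial (Fin n) ℂ :=
  MvPolynomial.aeval (fun i => MvPolynomial.X i + MvPolynomial.C (v i)) p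

/-- `σ_j`: negation of the `j`-th coordinate. -/
def sigmaP {n : ℕ} (j : Fin n) (p : MvPolynomial (Fin n) ℂ) : MvPolynomial (Fin n) ℂ :=
  MvPolynomial.aeval
    (fun k => if k = j then -(MvPolynomial.X j) else (MvPolynomial.X k : MvPolynomial (Fin n) ℂ)) p

/-- `τ_{ij}`: transposition of the `i`-th and `j`-th coordinates. -/
def swapP {n : ℕ} (i j : Fin n) (p : MvPolynomial (Fin n) ℂ) : MvPolynomial (Fin n) ℂ :=
  MvPolynomial.aeval
    (fun k => if k = i then MvPolynomial.X j
      else if k = j then MvPolynomial.X i else (MvPolynomial.X k : MvPolynomial (Fin n) ℂ)) p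

/-- `ρ_{ij}`: swap of the `i`-th and `j`-th coordinates combined with negating both. -/
def rhoP {n : ℕ} (i j : Fin n) (p : MvPolynomial (Fin n) ℂ) : MvPolynomial (Fin n) ℂ :=
  MvPolynomial.aeval
    (fun k => if k = i then -(MvPolynomial.X j)
      else if k = j then -(MvPolynomial.X i) else (MvPolynomial.X k : MvPolynomial (Fin n) ℂ)) p

/-- The trigonometric quasi-invariants of type `BC_N`. -/
def QtrBC (N : ℕ) (m1 m2 m3 : ℕ) : Set (MvPolynomial (Fin N) ℂ) :=
  {p | (∀ j : Fin N, ∀ s : ℕ, 1 ≤ s → s ≤ m1 →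
          MvPolynomial.X j ∣
            shiftPoly (Pi.single j ((s : ℂ))) p - shiftPoly (Pi.single j (-(s : ℂ))) p) ∧
       (∀ j : Fin N, ∀ s : ℕ, 1 ≤ s → s ≤ m2 →
          MvPolynomial.X j ∣
            shiftPoly (Pi.single j ((s : ℂ) - 1/2)) p
              - shiftPoly (Pi.single j (-((s : ℂ) - 1/2))) p) ∧
       (∀ i j : Fin N, i ≠ j → ∀ s : ℕ, 1 ≤ s → s ≤ m3 →
          ((MvPolynomial.X i - MvPolynomial.X j) ∣
            shiftPoly (Pi.single i ((s : ℂ))) p - shiftPoly (Pi.single j ((s : ℂ))) p) ∧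
          ((MvPolynomial.X i + MvPolynomial.X j) ∣
            shiftPoly (Pi.single i (-(s : ℂ))) p - shiftPoly (Pi.single j ((s : ℂ))) p))}

/-- The `B_N` quasi-invariants `Q_{m̃}` with multiplicity `m̃(e_i) = m_1 + m_2`,
`m̃(e_i ± e_j) = m_3`. -/
def QtildeBC (N : ℕ) (m1 m2 m3 : ℕ) : Set (MvPolynomial (Fin N) ℂ) :=
  {q | (∀ j : Fin N, MvPolynomial.X j ^ (2 * (m1 + m2)) ∣ q - sigmaP j q) ∧
       (∀ i j : Fin N, i ≠ j →
          ((MvPolynomial.X i - MvPolynomial.X j) ^ (2 * m3) ∣ q - swapP i j q) ∧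
          ((MvPolynomial.X i + MvPolynomial.X j) ^ (2 * m3) ∣ q - rhoP i j q))}

/-! Outline. A difference operator `diffOp` preserves the trigonometric quasi-invariants, and its
leading term is the rational Calogero-Moser operator `calLin`, so `calLin` preserves the space `Gr`
of leading terms, which also contains all multiples of `rootProd`. Since the Gaussian pairing
`gaussPairing` of the rational quasi-invariants with `Gr` is nondegenerate on the left in each
degree, `Gr` exhausts the rational quasi-invariants. -/

namespace QuasiInv

open Filter Topology

variable {N : ℕ}

/-- `ℓ` is affine in the direction `η`, with nonzero slope `κ`. -/
def AffineAlong (ℓ : MvPolynomial (Fin N) ℂ) (η : Fin N → ℂ) (κ : ℂ) : Prop :=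
  κ ≠ 0 ∧ ∀ x t, eval (x + t • η) ℓ = eval x ℓ + t * κ

/-- Pullback of `f` along the projection onto `ℓ = 0` in the direction `η`. -/
def projPoly (ℓ : MvPolynomial (Fin N) ℂ) (η : Fin N → ℂ) (κ : ℂ)
    (f : MvPolynomial (Fin N) ℂ) : MvPolynomial (Fin N) ℂ :=
  aeval (fun j => X j - C (η j / κ) * ℓ) f

lemma eval_projPoly (ℓ : MvPolynomial (Fin N) ℂ) (η : Fin N → ℂ) (κ : ℂ)
    (f : MvPolynomial (Fin N) ℂ) (x : Fin N → ℂ) :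
    eval x (projPoly ℓ η κ f) = eval (x + (-(eval x ℓ) / κ) • η) f := by
  rw [projPoly, aeval_def, eval_eval₂]
  have : (eval x).comp (algebraMap ℂ (MvPolynomial (Fin N) ℂ)) = RingHom.id ℂ := by
    ext; simp
  rw [this, eval₂_eq_eval_map, MvPolynomial.map_id]
  congr 2
  ext j
  simp
  ring

lemma dvd_sub_projPoly (ℓ : MvPolynomial (Fin N) ℂ) (η : Fin N → ℂ) (κ : ℂ)
    (f : MvPolynomial (Fin N) ℂ) : ℓ ∣ f - projPoly ℓ η κ f := by
  induction f using MvPolynomial.induction_on with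
  | C a => simp [projPoly]
  | add p q hp hq =>
    have : p + q - projPoly ℓ η κ (p + q)
        = (p - projPoly ℓ η κ p) + (q - projPoly ℓ η κ q) := by
      simp [projPoly]; ring
    rw [this]
    exact dvd_add hp hq
  | mul_X p i hp =>
    have : p * X i - projPoly ℓ η κ (p * X i)
        = (p - projPoly ℓ η κ p) * X i + ℓ * (C (η i / κ) * projPoly ℓ η κ p) := by
      simp [projPoly]; ring
    rw [this]
    exact dvd_add (Dvd.dvd.mul_right hp _) (Dvd.intro _ rfl)

namespace AffineAlong

variable {ℓ : MvPolynomial (Fin N) ℂ} {η : Fin N → ℂ} {κ : ℂ}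

lemma eval_proj (h : AffineAlong ℓ η κ) (x : Fin N → ℂ) :
    eval (x + (-(eval x ℓ) / κ) • η) ℓ = 0 := by
  rw [h.2, div_mul_cancel₀ _ h.1]; ring

lemma dvd_of_vanish (h : AffineAlong ℓ η κ) {f : MvPolynomial (Fin N) ℂ}
    (hf : ∀ x, eval x ℓ = 0 → eval x f = 0) : ℓ ∣ f := by
  have h0 : projPoly ℓ η κ f = 0 := by
    apply MvPolynomial.funext
    intro x
    rw [eval_projPoly, hf _ (h.eval_proj x), map_zero]
  simpa [h0] using dvd_sub_projPoly ℓ η κ f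

lemma dvd_or_dvd (h : AffineAlong ℓ η κ) {f g : MvPolynomial (Fin N) ℂ}
    (hfg : ∀ x, eval x ℓ = 0 → eval x f * eval x g = 0) : ℓ ∣ f ∨ ℓ ∣ g := by
  have h0 : projPoly ℓ η κ f * projPoly ℓ η κ g = 0 := by
    apply MvPolynomial.funext
    intro x
    rw [map_mul, eval_projPoly, eval_projPoly, hfg _ (h.eval_proj x), map_zero]
  rcases mul_eq_zero.1 h0 with h0 | h0
  · left; simpa [h0] using dvd_sub_projPoly ℓ η κ f
  · right; simpa [h0] using dvd_sub_projPoly ℓ η κ g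

lemma ne_zero (h : AffineAlong ℓ η κ) : ℓ ≠ 0 := by
  rintro rfl
  have := h.2 0 1
  simp at this
  exact h.1 this.symm

lemma not_isUnit (h : AffineAlong ℓ η κ) : ¬ IsUnit ℓ := by
  intro hu
  have := hu.map (eval ((0 : Fin N → ℂ) + (-(eval 0 ℓ) / κ) • η))
  rw [h.eval_proj] at this
  exact not_isUnit_zero this

lemma prime (h : AffineAlong ℓ η κ) : Prime ℓ := by
  refine ⟨h.ne_zero, h.not_isUnit, ?_⟩
  rintro a b ⟨c, hc⟩
  apply h.dvd_or_dvd
  intro x hx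
  rw [← map_mul, hc, map_mul, hx, zero_mul]

/-- It is enough to check vanishing on `ℓ = 0` at points avoiding the zeros of finitely many
polynomials, none of which vanishes at a fixed point `z` of `ℓ = 0`. -/
lemma dvd_of_generic (h : AffineAlong ℓ η κ) {ι : Type*} [Fintype ι]
    (form : ι → MvPolynomial (Fin N) ℂ) {z : Fin N → ℂ} (hz : eval z ℓ = 0)
    {f : MvPolynomial (Fin N) ℂ}
    (hf : ∀ x, eval x ℓ = 0 → (∀ k, eval x (form k) = 0 → eval z (form k) = 0) →
      eval x f = 0) : ℓ ∣ f := by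
  classical
  let g : MvPolynomial (Fin N) ℂ := ∏ k ∈ Finset.univ.filter (fun k => eval z (form k) ≠ 0), form k
  have hg : ∀ x, eval x ℓ = 0 → eval x f * eval x g = 0 := by
    intro x hx
    by_cases hgx : eval x g = 0
    · rw [hgx, mul_zero]
    · rw [hf x hx, zero_mul]
      intro k hk
      by_contra hkz
      apply hgx
      rw [map_prod]
      exact Finset.prod_eq_zero (Finset.mem_filter.2 ⟨Finset.mem_univ k, hkz⟩) hk
  rcases h.dvd_or_dvd hg with h1 | ⟨c, hc⟩
  · exact h1
  · exfalso
    have : eval z g = 0 := by rw [hc, map_mul, hz, zero_mul]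
    rw [map_prod, Finset.prod_eq_zero_iff] at this
    obtain ⟨k, hk, hk0⟩ := this
    exact (Finset.mem_filter.1 hk).2 hk0

lemma pow_dvd_of_generic (h : AffineAlong ℓ η κ) {ι : Type*} [Fintype ι]
    (form : ι → MvPolynomial (Fin N) ℂ) {z : Fin N → ℂ} (hz : eval z ℓ = 0)
    {f : MvPolynomial (Fin N) ℂ} (n : ℕ)
    (hf : ∀ x, eval x ℓ = 0 → (∀ k, eval x (form k) = 0 → eval z (form k) = 0) →
      ∀ j < n, Tendsto (fun t : ℂ => eval (x + t • η) f / t ^ j) (𝓝[≠] 0) (𝓝 0)) :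
    ℓ ^ n ∣ f := by
  suffices H : ∀ j ≤ n, ℓ ^ j ∣ f from H n le_rfl
  intro j
  induction j with
  | zero => simp
  | succ j ih =>
    intro hj
    obtain ⟨f', rfl⟩ := ih (by omega)
    rw [pow_succ]
    apply mul_dvd_mul_left
    apply h.dvd_of_generic form hz
    intro x hx hk
    have h1 := hf x hx hk j (by omega)
    have h2 : Tendsto (fun t : ℂ => κ ^ j * eval (x + t • η) f') (𝓝[≠] 0) (𝓝 0) := by
      refine h1.congr' ?_
      filter_upwards [self_mem_nhdsWithin] with t ht
      have ht : t ≠ 0 := ht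
      rw [map_mul, map_pow, h.2, hx, zero_add, mul_pow]
      field_simp
    have h3 : Tendsto (fun t : ℂ => κ ^ j * eval (x + t • η) f') (𝓝[≠] 0)
        (𝓝 (κ ^ j * eval (x + (0 : ℂ) • η) f')) := by
      refine Tendsto.mono_left ?_ nhdsWithin_le_nhds
      have hc : Continuous (fun t : ℂ => κ ^ j * eval (x + t • η) f') :=
        continuous_const.mul ((MvPolynomial.continuous_eval f').comp (by fun_prop))
      exact hc.tendsto 0
    have h4 := tendsto_nhds_unique h2 h3
    simpa [h.1] using h4.symm

end AffineAlong

lemma continuous_eval_line (f : MvPolynomial (Fin N) ℂ) (x η : Fin N → ℂ) :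
    Continuous (fun t : ℂ => eval (x + t • η) f) :=
  (MvPolynomial.continuous_eval f).comp (by fun_prop)

lemma tendsto_eval_line (f : MvPolynomial (Fin N) ℂ) (x η : Fin N → ℂ) :
    Tendsto (fun t : ℂ => eval (x + t • η) f) (𝓝[≠] 0) (𝓝 (eval x f)) := by
  have := (continuous_eval_line f x η).tendsto 0
  simp only [zero_smul, add_zero] at this
  exact this.mono_left nhdsWithin_le_nhds

lemma eq_of_eval_eq_off {den p q : MvPolynomial (Fin N) ℂ} (hden : den ≠ 0)
    (h : ∀ x, eval x den ≠ 0 → eval x p = eval x q) : p = q := by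
  have : (p - q) * den = 0 := by
    apply MvPolynomial.funext
    intro x
    by_cases hx : eval x den = 0
    · simp [hx]
    · simp [h x hx]
  exact sub_eq_zero.1 ((mul_eq_zero.1 this).resolve_right hden)

/-- `f` is a rational function whose denominator is a power of `den`. -/
def IsRat (den : MvPolynomial (Fin N) ℂ) (f : (Fin N → ℂ) → ℂ) : Prop :=
  ∃ (P : MvPolynomial (Fin N) ℂ) (n : ℕ), ∀ x, eval x den ≠ 0 → eval x P = eval x den ^ n * f x

namespace IsRat

variable {den : MvPolynomial (Fin N) ℂ} {f g : (Fin N → ℂ) → ℂ}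

lemma of_poly (p : MvPolynomial (Fin N) ℂ) : IsRat den (fun x => eval x p) :=
  ⟨p, 0, fun x _ => by simp⟩

lemma const (c : ℂ) : IsRat den (fun _ => c) := ⟨C c, 0, fun x _ => by simp⟩

lemma add (hf : IsRat den f) (hg : IsRat den g) : IsRat den (fun x => f x + g x) := by
  obtain ⟨P, n, hP⟩ := hf
  obtain ⟨Q, m, hQ⟩ := hg
  refine ⟨P * den ^ m + Q * den ^ n, n + m, fun x hx => ?_⟩
  simp only [map_add, map_mul, map_pow, hP x hx, hQ x hx]
  ring

lemma mul (hf : IsRat den f) (hg : IsRat den g) : IsRat den (fun x => f x * g x) := by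
  obtain ⟨P, n, hP⟩ := hf
  obtain ⟨Q, m, hQ⟩ := hg
  refine ⟨P * Q, n + m, fun x hx => ?_⟩
  simp only [map_mul, hP x hx, hQ x hx]
  ring

lemma sub (hf : IsRat den f) (hg : IsRat den g) : IsRat den (fun x => f x - g x) := by
  have := hf.add ((const (den := den) (-1)).mul hg)
  simpa [sub_eq_add_neg] using this

lemma sum {ι : Type*} (s : Finset ι) {F : ι → (Fin N → ℂ) → ℂ}
    (h : ∀ i ∈ s, IsRat den (F i)) : IsRat den (fun x => ∑ i ∈ s, F i x) := by
  classical
  induction s using Finset.induction_on with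
  | empty => simpa using const 0
  | insert a s ha ih =>
    simp only [Finset.sum_insert ha]
    exact (h a (Finset.mem_insert_self _ _)).add
      (ih fun i hi => h i (Finset.mem_insert_of_mem hi))

lemma prod {ι : Type*} (s : Finset ι) {F : ι → (Fin N → ℂ) → ℂ}
    (h : ∀ i ∈ s, IsRat den (F i)) : IsRat den (fun x => ∏ i ∈ s, F i x) := by
  classical
  induction s using Finset.induction_on with
  | empty => simpa using const 1
  | insert a s ha ih =>
    simp only [Finset.prod_insert ha]
    exact (h a (Finset.mem_insert_self _ _)).mul
      (ih fun i hi => h i (Finset.mem_insert_of_mem hi))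

lemma inv_of_dvd {p : MvPolynomial (Fin N) ℂ} (hp : p ∣ den) :
    IsRat den (fun x => (eval x p)⁻¹) := by
  obtain ⟨c, hc⟩ := hp
  refine ⟨c, 1, fun x hx => ?_⟩
  have : eval x p ≠ 0 := by
    intro h
    apply hx
    rw [hc, map_mul, h, zero_mul]
  rw [hc, map_mul]
  field_simp

lemma div_of_dvd {p : MvPolynomial (Fin N) ℂ} (hp : p ∣ den) (c : ℂ) :
    IsRat den (fun x => c / eval x p) := by
  simpa [div_eq_mul_inv] using (const (den := den) c).mul (inv_of_dvd hp)

/-- A rational function with denominator a product of affine forms, having no pole at the generic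
points of each of the corresponding hyperplanes, is a polynomial. -/
lemma exists_poly {ι : Type*} [Fintype ι] {form : ι → MvPolynomial (Fin N) ℂ}
    {η : ι → Fin N → ℂ} {κ : ι → ℂ} (hform : ∀ k, AffineAlong (form k) (η k) (κ k))
    (hf : IsRat (∏ k, form k) f)
    (hpole : ∀ k, ∃ z, eval z (form k) = 0 ∧ ∀ x, eval x (form k) = 0 →
      (∀ k', eval x (form k') = 0 → eval z (form k') = 0) →
      Tendsto (fun t : ℂ => t * f (x + t • η k)) (𝓝[≠] 0) (𝓝 0) ∧
      ∀ᶠ t : ℂ in 𝓝[≠] 0, eval (x + t • η k) (∏ k, form k) ≠ 0) :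
    ∃ r : MvPolynomial (Fin N) ℂ, ∀ x, eval x (∏ k, form k) ≠ 0 → eval x r = f x := by
  set D := ∏ k, form k with hD
  have hD0 : D ≠ 0 := Finset.prod_ne_zero_iff.2 fun k _ => (hform k).ne_zero
  obtain ⟨P, n, hP⟩ := hf
  obtain ⟨d', P', c, hrel, hd, hP'⟩ :=
    UniqueFactorizationMonoid.exists_reduced_factors (D ^ n) (pow_ne_zero n hD0) P
  have hev : ∀ x, eval x D ≠ 0 → eval x P' = eval x d' * f x := by
    intro x hx
    have h1 := hP x hx
    have h2 : eval x c ≠ 0 := by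
      intro h
      have : eval x (D ^ n) = 0 := by rw [← hd, map_mul, h, zero_mul]
      rw [map_pow] at this
      exact hx (eq_zero_of_pow_eq_zero this)
    rw [← hP', ← map_pow, ← hd, map_mul, map_mul, mul_assoc] at h1
    exact mul_left_cancel₀ h2 h1
  have hunit : IsUnit d' := by
    by_contra hnu
    have hd'0 : d' ≠ 0 := by
      rintro rfl
      rw [mul_zero] at hd
      exact pow_ne_zero n hD0 hd.symm
    obtain ⟨l, hl, hld⟩ := WfDvdMonoid.exists_irreducible_factor hnu hd'0
    have hlp : Prime l := hl.prime
    have hlD : l ∣ D := hlp.dvd_of_dvd_pow ((hld.trans (Dvd.intro_left c hd)))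
    obtain ⟨k, -, hk⟩ := (Prime.dvd_finsetProd_iff hlp _).1 hlD
    have hassoc : Associated l (form k) := hlp.associated_of_dvd (hform k).prime hk
    have hkd : form k ∣ d' := hassoc.dvd_iff_dvd_left.1 hld
    obtain ⟨e, he⟩ := hkd
    obtain ⟨z, hz, hpz⟩ := hpole k
    have hkP : form k ∣ P' := by
      apply (hform k).dvd_of_generic form hz
      intro x hx hxk
      obtain ⟨h1, h2⟩ := hpz x hx hxk
      have h3 := tendsto_eval_line P' x (η k)
      have h4 : Tendsto (fun t : ℂ => eval (x + t • η k) P') (𝓝[≠] 0) (𝓝 0) := by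
        have h5 := ((tendsto_eval_line e x (η k)).mul h1).const_mul (κ k)
        simp only [mul_zero] at h5
        refine h5.congr' ?_
        filter_upwards [h2] with t ht
        rw [hev _ ht, he, map_mul, (hform k).2, hx]
        ring
      exact tendsto_nhds_unique h3 h4
    exact (hform k).not_isUnit (hrel (Dvd.intro _ he.symm) hkP)
  obtain ⟨u, hu⟩ := hunit.exists_right_inv
  refine ⟨u * P', fun x hx => ?_⟩
  rw [map_mul, hev x hx, ← mul_assoc, ← map_mul, mul_comm u, hu]
  simp

end IsRat

section Scaling

lemma eval_smul_of_isHomogeneous {p : MvPolynomial (Fin N) ℂ} {k : ℕ} (hp : p.IsHomogeneous k)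
    (c : ℂ) (x : Fin N → ℂ) : eval (c • x) p = c ^ k * eval x p := by
  rw [eval_eq', eval_eq', Finset.mul_sum]
  refine Finset.sum_congr rfl fun d hd => ?_
  have hdeg : ∑ i, d i = k := by
    rw [← Finsupp.degree_eq_sum]
    by_contra hne
    exact mem_support_iff.1 hd (hp.coeff_eq_zero hne)
  simp only [Pi.smul_apply, smul_eq_mul, mul_pow, Finset.prod_mul_distrib,
    Finset.prod_pow_eq_pow_sum, hdeg]
  ring

lemma pow_mul_eval_inv_smul {p : MvPolynomial (Fin N) ℂ} {n : ℕ} (hp : p.totalDegree ≤ n)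
    (x : Fin N → ℂ) {h : ℂ} (hh : h ≠ 0) :
    h ^ n * eval (h⁻¹ • x) p
      = ∑ k ∈ Finset.range (n + 1), h ^ (n - k) * eval x (homogeneousComponent k p) := by
  have hsum : p = ∑ k ∈ Finset.range (n + 1), homogeneousComponent k p := by
    conv_lhs => rw [← sum_homogeneousComponent p]
    apply Finset.sum_subset (Finset.range_mono (by omega))
    intro k _ hk
    apply homogeneousComponent_eq_zero
    simpa using hk
  conv_lhs => rw [hsum, map_sum, Finset.mul_sum]
  refine Finset.sum_congr rfl fun k hk => ?_
  have hk' : k ≤ n := by simpa [Nat.lt_succ_iff] using hk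
  have : eval (h⁻¹ • x) (homogeneousComponent k p)
      = h⁻¹ ^ k * eval x (homogeneousComponent k p) :=
    eval_smul_of_isHomogeneous (homogeneousComponent_isHomogeneous k p) _ _
  rw [this, ← mul_assoc, inv_pow]
  congr 1
  rw [pow_sub₀ _ hh hk']

/-- The top coefficient of `p` on the ray through `x` is `c`. -/
def ScaleLim (n : ℕ) (p : MvPolynomial (Fin N) ℂ) (x : Fin N → ℂ) (c : ℂ) : Prop :=
  Tendsto (fun h : ℂ => h ^ n * eval (h⁻¹ • x) p) (𝓝[≠] 0) (𝓝 c)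

lemma scaleLim_homogeneousComponent {p : MvPolynomial (Fin N) ℂ} {n : ℕ} (hp : p.totalDegree ≤ n)
    (x : Fin N → ℂ) : ScaleLim n p x (eval x (homogeneousComponent n p)) := by
  have h1 : Tendsto (fun h : ℂ => ∑ k ∈ Finset.range (n + 1),
      h ^ (n - k) * eval x (homogeneousComponent k p)) (𝓝[≠] 0)
      (𝓝 (∑ k ∈ Finset.range (n + 1), (0 : ℂ) ^ (n - k) * eval x (homogeneousComponent k p))) := by
    refine Tendsto.mono_left ?_ nhdsWithin_le_nhds
    have : Continuous (fun h : ℂ => ∑ k ∈ Finset.range (n + 1),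
      h ^ (n - k) * eval x (homogeneousComponent k p)) := by fun_prop
    exact this.tendsto 0
  rw [Finset.sum_range_succ, Finset.sum_eq_zero] at h1
  · simp only [zero_add, Nat.sub_self, pow_zero, one_mul] at h1
    refine h1.congr' ?_
    filter_upwards [self_mem_nhdsWithin] with h hh
    exact (pow_mul_eval_inv_smul hp x hh).symm
  · intro k hk
    have : n - k ≠ 0 := by have := Finset.mem_range.1 hk; omega
    simp [this]

lemma totalDegree_le_of_scaleLim {p g : MvPolynomial (Fin N) ℂ} (hg : g ≠ 0) {n : ℕ}
    (h : ∀ x, eval x g ≠ 0 → ∃ c, ScaleLim n p x c) : p.totalDegree ≤ n := by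
  by_contra hlt
  push Not at hlt
  set D := p.totalDegree with hD
  have hp0 : p ≠ 0 := by rintro rfl; simp at hD; omega
  have htop : homogeneousComponent D p ≠ 0 := by
    obtain ⟨d, hd, hdeg⟩ := Finset.exists_mem_eq_sup p.support
      (by simpa [Finset.nonempty_iff_ne_empty] using hp0) (fun s => s.sum fun _ e => e)
    have hdD : d.degree = D := by
      rw [hD, MvPolynomial.totalDegree, hdeg, Finsupp.degree_eq_sum, Finsupp.sum_fintype]
      simp
    intro h0
    have := congrArg (coeff d) h0
    rw [coeff_homogeneousComponent, if_pos hdD, coeff_zero] at this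
    exact mem_support_iff.1 hd this
  have : homogeneousComponent D p * g ≠ 0 := mul_ne_zero htop hg
  obtain ⟨x, hx⟩ : ∃ x, eval x (homogeneousComponent D p * g) ≠ 0 := by
    by_contra hcon
    push Not at hcon
    exact this (MvPolynomial.funext (by simpa using hcon))
  rw [map_mul] at hx
  obtain ⟨c, hc⟩ := h x (right_ne_zero_of_mul hx)
  have h1 := scaleLim_homogeneousComponent (n := D) hD.ge x
  have h2 : Tendsto (fun h : ℂ => h ^ (D - n) * (h ^ n * eval (h⁻¹ • x) p)) (𝓝[≠] 0)
      (𝓝 (0 ^ (D - n) * c)) := by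
    refine Tendsto.mul ?_ hc
    exact ((continuous_pow (D - n)).tendsto 0).mono_left nhdsWithin_le_nhds
  have h3 : ∀ h : ℂ, h ^ (D - n) * (h ^ n * eval (h⁻¹ • x) p) = h ^ D * eval (h⁻¹ • x) p := by
    intro h
    rw [← mul_assoc, ← pow_add, Nat.sub_add_cancel hlt.le]
  simp only [h3] at h2
  have h4 := tendsto_nhds_unique h1 h2
  rw [zero_pow (by omega), zero_mul] at h4
  exact left_ne_zero_of_mul hx h4

lemma ScaleLim.eq_eval {p g : MvPolynomial (Fin N) ℂ} (hg : g ≠ 0) {n : ℕ}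
    {F : (Fin N → ℂ) → ℂ} (h : ∀ x, eval x g ≠ 0 → ScaleLim n p x (F x)) :
    p.totalDegree ≤ n ∧ ∀ x, eval x g ≠ 0 → eval x (homogeneousComponent n p) = F x := by
  have hd := totalDegree_le_of_scaleLim hg (fun x hx => ⟨_, h x hx⟩)
  exact ⟨hd, fun x hx => tendsto_nhds_unique (scaleLim_homogeneousComponent hd x) (h x hx)⟩

lemma eq_zero_of_scaleLim_zero {p g : MvPolynomial (Fin N) ℂ} (hg : g ≠ 0)
    (h : ∀ x, eval x g ≠ 0 → ScaleLim 0 p x 0) : p = 0 := by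
  obtain ⟨hd, he⟩ := ScaleLim.eq_eval (F := fun _ => 0) hg h
  have h0 : homogeneousComponent 0 p = p := by
    rw [homogeneousComponent_zero]
    exact (totalDegree_eq_zero_iff_eq_C.1 (by omega)).symm
  refine eq_of_eval_eq_off hg fun x hx => ?_
  rw [← h0, he x hx, map_zero]

/-- If `h ^ n r(x / h) / h ^ 2` converges and `n < 2`, then `r = 0`. -/
lemma eq_zero_of_scale_sq {r g : MvPolynomial (Fin N) ℂ} (hg : g ≠ 0) {n : ℕ} (hn : n < 2)
    {F : (Fin N → ℂ) → ℂ} (h : ∀ x, eval x g ≠ 0 →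
      Tendsto (fun h : ℂ => h ^ n * eval (h⁻¹ • x) r / h ^ 2) (𝓝[≠] 0) (𝓝 (F x))) : r = 0 := by
  apply eq_zero_of_scaleLim_zero hg
  intro x hx
  have h1 : Tendsto (fun h : ℂ => h ^ (2 - n) * (h ^ n * eval (h⁻¹ • x) r / h ^ 2)) (𝓝[≠] 0)
      (𝓝 (0 ^ (2 - n) * F x)) :=
    Tendsto.mul (((continuous_pow (2 - n)).tendsto 0).mono_left nhdsWithin_le_nhds) (h x hx)
  rw [zero_pow (by omega), zero_mul] at h1
  refine h1.congr' ?_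
  filter_upwards [self_mem_nhdsWithin] with h hh
  have hh : h ≠ 0 := hh
  have : h ^ (2 - n) * h ^ n = h ^ 2 := by rw [← pow_add]; congr 1; omega
  rw [← mul_div_assoc, ← mul_assoc, this, pow_zero, one_mul]
  field_simp

lemma scaleLim_of_scale_sq {r : MvPolynomial (Fin N) ℂ} {n : ℕ}
    {x : Fin N → ℂ} {c : ℂ}
    (h : Tendsto (fun h : ℂ => h ^ (n + 2) * eval (h⁻¹ • x) r / h ^ 2) (𝓝[≠] 0) (𝓝 c)) :
    ScaleLim n r x c := by
  refine h.congr' ?_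
  filter_upwards [self_mem_nhdsWithin] with h hh
  have hh : h ≠ 0 := hh
  field_simp
  ring

end Scaling

/-- Signed indices: `(i, true)` stands for `e_i` and `(i, false)` for `-e_i`. -/
abbrev SIdx (N : ℕ) := Fin N × Bool

/-- The sign attached to a Boolean. -/
def sgn (b : Bool) : ℂ := if b then 1 else -1

@[simp] lemma sgn_true : sgn true = 1 := rfl
@[simp] lemma sgn_false : sgn false = -1 := rfl
@[simp] lemma sgn_not (b : Bool) : sgn (!b) = -sgn b := by cases b <;> simp
@[simp] lemma sgn_mul_self (b : Bool) : sgn b * sgn b = 1 := by cases b <;> simp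

/-- The opposite signed index. -/
def opp (u : SIdx N) : SIdx N := (u.1, !u.2)

/-- The linear form attached to a signed index. -/
def coord (u : SIdx N) (x : Fin N → ℂ) : ℂ := sgn u.2 * x u.1

/-- The signed basis vector attached to a signed index. -/
def vec (u : SIdx N) : Fin N → ℂ := Pi.single u.1 (sgn u.2)

/-- The linear form `coord u` as a polynomial. -/
def Y (u : SIdx N) : MvPolynomial (Fin N) ℂ := C (sgn u.2) * X u.1

@[simp] lemma eval_Y (u : SIdx N) (x : Fin N → ℂ) : eval x (Y u) = coord u x := by
  simp [Y, coord]

@[simp] lemma opp_opp (u : SIdx N) : opp (opp u) = u := by simp [opp]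
@[simp] lemma opp_fst (u : SIdx N) : (opp u).1 = u.1 := rfl
lemma opp_ne (u : SIdx N) : opp u ≠ u := by
  intro h
  have := congrArg Prod.snd h
  simp [opp] at this

lemma fst_eq_iff (u w : SIdx N) : u.1 = w.1 ↔ u = w ∨ u = opp w := by
  obtain ⟨i, a⟩ := u
  obtain ⟨j, b⟩ := w
  cases a <;> cases b <;> simp [opp]

@[simp] lemma coord_opp (u : SIdx N) (x : Fin N → ℂ) : coord (opp u) x = -coord u x := by
  simp [coord, opp]

lemma vec_opp (u : SIdx N) : vec (opp u) = -vec u := by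
  simp [vec, opp, Pi.single_neg]

@[simp] lemma coord_add (u : SIdx N) (x y : Fin N → ℂ) :
    coord u (x + y) = coord u x + coord u y := by simp [coord]; ring
@[simp] lemma coord_sub (u : SIdx N) (x y : Fin N → ℂ) :
    coord u (x - y) = coord u x - coord u y := by simp [coord]; ring
@[simp] lemma coord_neg (u : SIdx N) (x : Fin N → ℂ) :
    coord u (-x) = -coord u x := by simp [coord]
@[simp] lemma coord_smul (u : SIdx N) (t : ℂ) (x : Fin N → ℂ) :
    coord u (t • x) = t * coord u x := by simp [coord]; ring
lemma continuous_coord (u : SIdx N) : Continuous (coord u) := by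
  unfold coord; fun_prop

lemma coord_vec (u w : SIdx N) :
    coord u (vec w) = if u.1 = w.1 then sgn u.2 * sgn w.2 else 0 := by
  by_cases h : u.1 = w.1
  · simp [coord, vec, h]
  · simp [coord, vec, h]

lemma coord_vec_comm (u w : SIdx N) : coord u (vec w) = coord w (vec u) := by
  rw [coord_vec, coord_vec]
  by_cases h : u.1 = w.1
  · rw [if_pos h, if_pos h.symm, mul_comm]
  · rw [if_neg h, if_neg (Ne.symm h)]

@[simp] lemma coord_vec_self (u : SIdx N) : coord u (vec u) = 1 := by simp [coord_vec]
lemma coord_vec_of_ne {u w : SIdx N} (h : u.1 ≠ w.1) : coord u (vec w) = 0 := by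
  simp [coord_vec, h]

lemma ext_coord {x y : Fin N → ℂ} (h : ∀ u, coord u x = coord u y) : x = y := by
  ext i
  simpa [coord] using h (i, true)

lemma sum_sidx {M : Type*} [AddCommMonoid M] (f : SIdx N → M) :
    ∑ u, f u = ∑ i, (f (i, true) + f (i, false)) := by
  rw [Fintype.sum_prod_type]
  simp

/-- Roots: `±e_i` and `±e_i ± e_j`. -/
abbrev Root (N : ℕ) := SIdx N ⊕ {p : SIdx N × SIdx N // p.1.1 ≠ p.2.1}

namespace Root

/-- The linear form of a root. -/
def lin : Root N → MvPolynomial (Fin N) ℂ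
  | .inl v => Y v
  | .inr p => Y p.1.1 - Y p.1.2

/-- The vector of a root. -/
def dir : Root N → Fin N → ℂ
  | .inl v => vec v
  | .inr p => vec p.1.1 - vec p.1.2

/-- Squared length. -/
def nrm : Root N → ℂ
  | .inl _ => 1
  | .inr _ => 2

/-- The reflection, as a permutation of the signed indices. -/
def perm (ρ : Root N) (u : SIdx N) : SIdx N :=
  match ρ with
  | .inl v => if u.1 = v.1 then opp u else u
  | .inr p => if u = p.1.1 then p.1.2 else if u = p.1.2 then p.1.1 else
      if u = opp p.1.1 then opp p.1.2 else if u = opp p.1.2 then opp p.1.1 else u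

/-- The reflection acting on vectors. -/
def act (ρ : Root N) (x : Fin N → ℂ) : Fin N → ℂ := fun i => coord (ρ.perm (i, true)) x

lemma nrm_ne_zero (ρ : Root N) : ρ.nrm ≠ 0 := by
  rcases ρ with v | p <;> simp [nrm]

lemma eval_lin_add (ρ : Root N) (x y : Fin N → ℂ) :
    eval (x + y) ρ.lin = eval x ρ.lin + eval y ρ.lin := by
  rcases ρ with v | p <;> simp [lin]; ring

lemma eval_lin_smul (ρ : Root N) (t : ℂ) (x : Fin N → ℂ) :
    eval (t • x) ρ.lin = t * eval x ρ.lin := by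
  rcases ρ with v | p <;> simp [lin]; ring

lemma eval_lin_vec (ρ : Root N) (u : SIdx N) : eval (vec u) ρ.lin = coord u ρ.dir := by
  rcases ρ with v | p <;> simp [lin, dir, coord_vec_comm u]

lemma eval_lin_dir (ρ : Root N) : eval ρ.dir ρ.lin = ρ.nrm := by
  rcases ρ with v | ⟨⟨v, w⟩, h⟩
  · simp [lin, dir, nrm]
  · simp [lin, dir, nrm, coord_vec_of_ne h, coord_vec_of_ne (Ne.symm h)]; norm_num

lemma eval_lin_line (ρ : Root N) (x : Fin N → ℂ) (t : ℂ) :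
    eval (x + t • ρ.dir) ρ.lin = eval x ρ.lin + t * ρ.nrm := by
  rw [eval_lin_add, eval_lin_smul, eval_lin_dir]

lemma affineAlong (ρ : Root N) : AffineAlong ρ.lin ρ.dir ρ.nrm :=
  ⟨ρ.nrm_ne_zero, ρ.eval_lin_line⟩

lemma coord_perm (ρ : Root N) (u : SIdx N) (x : Fin N → ℂ) :
    coord (ρ.perm u) x = coord u x - 2 * eval x ρ.lin / ρ.nrm * coord u ρ.dir := by
  rcases ρ with v | ⟨⟨v, w⟩, h⟩
  · by_cases h1 : u.1 = v.1
    · rcases (fst_eq_iff u v).1 h1 with rfl | rfl <;> simp [perm, lin, nrm, dir] <;> ring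
    · simp [perm, lin, nrm, dir, h1, coord_vec_of_ne h1]
  · have e1 := coord_vec_of_ne h
    have e2 := coord_vec_of_ne (Ne.symm h)
    simp only at h e1 e2
    have n1 : v ≠ w := fun e => h (by rw [e])
    have n2 : v ≠ opp w := fun e => h (by rw [e, opp_fst])
    have n3 : w ≠ opp v := fun e => h (by rw [e, opp_fst])
    by_cases h1 : u.1 = v.1
    · rcases (fst_eq_iff u v).1 h1 with rfl | rfl
      · simp [perm, lin, nrm, dir, e1]
      · have : opp v ≠ w := fun e => n3 e.symm
        simp [perm, lin, nrm, dir, e1, opp_ne, this]; ring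
    · by_cases h2 : u.1 = w.1
      · rcases (fst_eq_iff u w).1 h2 with rfl | rfl
        · simp [perm, lin, nrm, dir, e2, n1.symm]
        · have : opp w ≠ v := fun e => n2 e.symm
          have h3 : opp w ≠ opp v := fun e => n1 (by rw [← opp_opp v, ← e, opp_opp])
          simp [perm, lin, nrm, dir, e2, opp_ne, this, h3]; ring
      · have a1 : u ≠ v := fun e => h1 (by rw [e])
        have a2 : u ≠ w := fun e => h2 (by rw [e])
        have a3 : u ≠ opp v := fun e => h1 (by rw [e, opp_fst])
        have a4 : u ≠ opp w := fun e => h2 (by rw [e, opp_fst])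
        simp [perm, lin, nrm, dir, a1, a2, a3, a4, coord_vec_of_ne h1, coord_vec_of_ne h2]

lemma coord_injective {u w : SIdx N} (h : ∀ x, coord u x = coord w x) : u = w := by
  have h1 := h (vec w)
  rw [coord_vec_self, coord_vec] at h1
  by_cases h2 : u.1 = w.1
  · rcases (fst_eq_iff u w).1 h2 with rfl | rfl
    · rfl
    · exfalso
      rw [if_pos h2, opp, sgn_not, neg_mul, sgn_mul_self] at h1
      norm_num at h1
  · simp [h2] at h1

lemma perm_opp (ρ : Root N) (u : SIdx N) : ρ.perm (opp u) = opp (ρ.perm u) := by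
  apply coord_injective
  intro x
  simp only [coord_perm, coord_opp]
  ring

lemma coord_act (ρ : Root N) (u : SIdx N) (x : Fin N → ℂ) :
    coord u (ρ.act x) = coord (ρ.perm u) x := by
  obtain ⟨i, b⟩ := u
  cases b
  · have : ((i, false) : SIdx N) = opp (i, true) := rfl
    rw [this, perm_opp, coord_opp, coord_opp]
    simp [coord, act]
  · simp [coord, act]

lemma act_eq (ρ : Root N) (x : Fin N → ℂ) :
    ρ.act x = x - (2 * eval x ρ.lin / ρ.nrm) • ρ.dir := by
  apply ext_coord
  intro u
  rw [coord_act, coord_perm, coord_sub, coord_smul]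

lemma eval_lin_act (ρ : Root N) (x : Fin N → ℂ) : eval (ρ.act x) ρ.lin = -eval x ρ.lin := by
  have := ρ.nrm_ne_zero
  rw [act_eq, sub_eq_add_neg, ← neg_smul, eval_lin_line]
  field_simp
  ring

lemma act_act (ρ : Root N) (x : Fin N → ℂ) : ρ.act (ρ.act x) = x := by
  rw [act_eq ρ (ρ.act x), eval_lin_act, act_eq]
  ext i
  simp
  ring

lemma perm_perm (ρ : Root N) (u : SIdx N) : ρ.perm (ρ.perm u) = u := by
  apply coord_injective
  intro x
  rw [← coord_act, ← coord_act, act_act]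

lemma act_add_smul (ρ : Root N) (x y : Fin N → ℂ) (t : ℂ) :
    ρ.act (x + t • y) = ρ.act x + t • ρ.act y := by
  apply ext_coord
  intro u
  simp [coord_act]

lemma act_vec (ρ : Root N) (u : SIdx N) : ρ.act (vec u) = vec (ρ.perm u) := by
  apply ext_coord
  intro w
  rw [coord_act, coord_perm, coord_vec_comm w (ρ.perm u), coord_perm, eval_lin_vec, eval_lin_vec,
    coord_vec_comm]
  ring

lemma act_add_vec (ρ : Root N) (x : Fin N → ℂ) (u : SIdx N) :
    ρ.act (x + vec u) = ρ.act x + vec (ρ.perm u) := by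
  simpa [act_vec] using ρ.act_add_smul x (vec u) 1

lemma act_of_lin_eq_zero (ρ : Root N) {x : Fin N → ℂ} (h : eval x ρ.lin = 0) : ρ.act x = x := by
  simp [act_eq, h]

lemma act_dir (ρ : Root N) : ρ.act ρ.dir = -ρ.dir := by
  have := ρ.nrm_ne_zero
  rw [act_eq, eval_lin_dir, mul_div_assoc, div_self this, mul_one]
  ext i
  simp
  ring

lemma act_line (ρ : Root N) {x : Fin N → ℂ} (h : eval x ρ.lin = 0) (t : ℂ) :
    ρ.act (x + t • ρ.dir) = x + (-t) • ρ.dir := by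
  rw [act_add_smul, ρ.act_of_lin_eq_zero h, act_dir, smul_neg, neg_smul]

lemma perm_injective (ρ : Root N) : Function.Injective ρ.perm :=
  fun u w h => by rw [← ρ.perm_perm u, h, perm_perm]

lemma sum_perm (ρ : Root N) {M : Type*} [AddCommMonoid M] (f : SIdx N → M) :
    ∑ u, f (ρ.perm u) = ∑ u, f u :=
  Equiv.sum_comp (Equiv.ofBijective ρ.perm ⟨ρ.perm_injective, fun u => ⟨_, ρ.perm_perm u⟩⟩) f

lemma perm_fst_eq_iff (ρ : Root N) (u w : SIdx N) :
    (ρ.perm u).1 = (ρ.perm w).1 ↔ u.1 = w.1 := by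
  rw [fst_eq_iff, fst_eq_iff, ← perm_opp, ρ.perm_injective.eq_iff, ρ.perm_injective.eq_iff]

lemma coord_perm_dir (ρ : Root N) (u : SIdx N) : coord (ρ.perm u) ρ.dir = -coord u ρ.dir := by
  rw [← coord_act, act_dir, coord_neg]

lemma perm_eq_self_iff (ρ : Root N) (u : SIdx N) : ρ.perm u = u ↔ coord u ρ.dir = 0 := by
  constructor
  · intro h
    have := ρ.coord_perm_dir u
    rw [h] at this
    linear_combination this / 2
  · intro h
    apply coord_injective
    intro x
    rw [coord_perm, h, mul_zero, sub_zero]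

lemma coord_dir_mem (ρ : Root N) (u : SIdx N) :
    coord u ρ.dir = 0 ∨ coord u ρ.dir = 1 ∨ coord u ρ.dir = -1 := by
  have key : ∀ v : SIdx N, u.1 = v.1 → coord u (vec v) = 1 ∨ coord u (vec v) = -1 := by
    intro v h
    rcases (fst_eq_iff u v).1 h with rfl | rfl <;> simp
  rcases ρ with v | ⟨⟨v, w⟩, h⟩
  · by_cases h1 : u.1 = v.1
    · exact Or.inr (key v h1)
    · exact Or.inl (coord_vec_of_ne h1)
  · simp only [dir, coord_sub]
    by_cases h1 : u.1 = v.1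
    · have : u.1 ≠ w.1 := fun e => h (by rw [← h1, e])
      rw [coord_vec_of_ne this, sub_zero]
      exact Or.inr (key v h1)
    · rw [coord_vec_of_ne h1, zero_sub]
      by_cases h2 : u.1 = w.1
      · rcases key w h2 with h3 | h3 <;> simp [h3]
      · simp [coord_vec_of_ne h2]

end Root

/-- The affine forms occurring in the denominators: the roots and `y_u + 1/2`. -/
abbrev Form (N : ℕ) := Root N ⊕ SIdx N

namespace Form

/-- The polynomial of an affine form. -/
def poly : Form N → MvPolynomial (Fin N) ℂ
  | .inl ρ => ρ.lin
  | .inr u => Y u + C (1 / 2)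

/-- A direction along which the form is not constant. -/
def dir : Form N → Fin N → ℂ
  | .inl ρ => ρ.dir
  | .inr u => vec u

/-- The slope of the form in the direction `dir`. -/
def slope : Form N → ℂ
  | .inl ρ => ρ.nrm
  | .inr _ => 1

lemma affineAlong (k : Form N) : AffineAlong k.poly k.dir k.slope := by
  rcases k with ρ | u
  · exact ρ.affineAlong
  · refine ⟨one_ne_zero, fun x t => ?_⟩
    simp [poly, dir, slope]
    ring

end Form

/-- The common denominator. -/
def den (N : ℕ) : MvPolynomial (Fin N) ℂ := ∏ k : Form N, k.poly

lemma den_ne_zero : den N ≠ 0 :=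
  Finset.prod_ne_zero_iff.2 fun k _ => k.affineAlong.ne_zero

/-- Points at which no denominator vanishes. -/
def Reg (x : Fin N → ℂ) : Prop := eval x (den N) ≠ 0

lemma reg_iff {x : Fin N → ℂ} : Reg x ↔
    (∀ u, coord u x ≠ 0) ∧ (∀ u, coord u x + 1 / 2 ≠ 0) ∧
      ∀ u w : SIdx N, u.1 ≠ w.1 → coord u x - coord w x ≠ 0 := by
  rw [Reg, den, map_prod, Finset.prod_ne_zero_iff]
  constructor
  · intro h
    refine ⟨fun u => ?_, fun u => ?_, fun u w huw => ?_⟩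
    · simpa [Form.poly, Root.lin] using h (.inl (.inl u)) (Finset.mem_univ _)
    · simpa [Form.poly] using h (.inr u) (Finset.mem_univ _)
    · simpa [Form.poly, Root.lin] using h (.inl (.inr ⟨(u, w), huw⟩)) (Finset.mem_univ _)
  · rintro ⟨h1, h2, h3⟩ ((v | p) | u) -
    · simpa [Form.poly, Root.lin] using h1 v
    · simpa [Form.poly, Root.lin] using h3 _ _ p.2
    · simpa [Form.poly] using h2 u

lemma Reg.act {x : Fin N → ℂ} (h : Reg x) (ρ : Root N) : Reg (ρ.act x) := by
  rw [reg_iff] at h ⊢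
  simp only [Root.coord_act]
  exact ⟨fun u => h.1 _, fun u => h.2.1 _,
    fun u w huw => h.2.2 _ _ (by rwa [Ne, Root.perm_fst_eq_iff])⟩

lemma dvd_den (k : Form N) : k.poly ∣ den N := Finset.dvd_prod_of_mem _ (Finset.mem_univ k)

/-- Generic points of the hyperplane `ρ = σ`: only the unavoidable forms vanish. -/
structure Gen (ρ : Root N) (σ : ℂ) (x : Fin N → ℂ) : Prop where
  lin : eval x ρ.lin = σ
  zero : ∀ u, coord u x = 0 → σ = 0 ∧ ρ.perm u = opp u
  half : ∀ u, coord u x + 1 / 2 = 0 → ∃ v, ρ = .inl v ∧ u.1 = v.1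
  diff : ∀ u w : SIdx N, u.1 ≠ w.1 → coord u x - coord w x = 0 → σ = 0 ∧ w = ρ.perm u

lemma sgn_cases (b : Bool) : sgn b = 1 ∨ sgn b = -1 := by cases b <;> simp

lemma im_base_ne {i j : Fin N} (h : i ≠ j) (a b : Bool) :
    sgn a * (Complex.I * ((i : ℕ) + 1)) - sgn b * (Complex.I * ((j : ℕ) + 1)) ≠ 0 := by
  intro h0
  have h1 := congrArg Complex.im h0
  have h2 : ((i : ℕ) : ℝ) ≠ (j : ℕ) := by
    intro e; exact h (Fin.ext (by exact_mod_cast e))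
  have hi : (0 : ℝ) ≤ (i : ℕ) := by positivity
  have hj : (0 : ℝ) ≤ (j : ℕ) := by positivity
  rcases sgn_cases a with ha | ha <;> rcases sgn_cases b with hb | hb <;>
    rw [ha, hb] at h1 <;> simp at h1
  · exact h2 (by linarith)
  · linarith
  · linarith
  · exact h2 (by linarith)

lemma im_base_ne_real (i : Fin N) (a : Bool) (σ : ℝ) :
    sgn a * (Complex.I * ((i : ℕ) + 1)) ≠ σ := by
  intro h0
  have h1 := congrArg Complex.im h0
  have hi : (0 : ℝ) ≤ (i : ℕ) := by positivity
  rcases sgn_cases a with ha | ha <;> rw [ha] at h1 <;> simp at h1 <;> linarith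

lemma exists_gen (ρ : Root N) (σ : ℝ) : ∃ z, Gen ρ σ z := by
  classical
  let b : Fin N → ℂ := fun i => Complex.I * ((i : ℕ) + 1)
  have hb : ∀ u, coord u b = sgn u.2 * (Complex.I * ((u.1 : ℕ) + 1)) := fun u => rfl
  rcases ρ with v | ⟨⟨v, w⟩, hvw⟩
  · let z : Fin N → ℂ := Function.update b v.1 (sgn v.2 * σ)
    have z1 : coord v z = σ := by simp [z, coord, ← mul_assoc]
    have z2 : ∀ u : SIdx N, u.1 ≠ v.1 → coord u z = coord u b := by
      intro u hu; simp [z, coord, hu]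
    have z3 : ∀ u : SIdx N, u.1 = v.1 → ∃ τ : ℝ, coord u z = τ := by
      intro u hu
      rcases (fst_eq_iff u v).1 hu with rfl | rfl
      · exact ⟨σ, z1⟩
      · exact ⟨-σ, by rw [coord_opp, z1]; simp⟩
    refine ⟨z, by simpa [Root.lin] using z1, fun u hu => ?_, fun u hu => ?_, fun u u' huu h0 => ?_⟩
    · by_cases h : u.1 = v.1
      · refine ⟨?_, by simp [Root.perm, h]⟩
        rcases (fst_eq_iff u v).1 h with rfl | rfl
        · rw [← z1, hu]
        · rw [← z1, ← neg_eq_zero, ← coord_opp, hu]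
      · rw [z2 u h, hb] at hu
        exact absurd (by simpa using hu) (im_base_ne_real u.1 u.2 0)
    · by_cases h : u.1 = v.1
      · exact ⟨v, rfl, h⟩
      · rw [z2 u h, hb] at hu
        refine absurd ?_ (im_base_ne_real u.1 u.2 (-1 / 2))
        push_cast
        linear_combination hu
    · exfalso
      by_cases h : u.1 = v.1
      · have h' : u'.1 ≠ v.1 := fun e => huu (by rw [h, e])
        obtain ⟨τ, hτ⟩ := z3 u h
        rw [hτ, z2 u' h', hb] at h0
        exact im_base_ne_real u'.1 u'.2 τ (by linear_combination -h0)
      · by_cases h' : u'.1 = v.1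
        · obtain ⟨τ, hτ⟩ := z3 u' h'
          rw [hτ, z2 u h, hb] at h0
          exact im_base_ne_real u.1 u.2 τ (by linear_combination h0)
        · rw [z2 u h, z2 u' h', hb, hb] at h0
          exact im_base_ne huu _ _ h0
  · simp only at hvw
    let z : Fin N → ℂ := Function.update b v.1 (sgn v.2 * (coord w b + σ))
    have z1 : coord v z = coord w b + σ := by simp [z, coord, ← mul_assoc]
    have z2 : ∀ u : SIdx N, u.1 ≠ v.1 → coord u z = coord u b := by
      intro u hu; simp [z, coord, hu]
    have n1 : v ≠ w := fun e => hvw (by rw [e])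
    have n2 : v ≠ opp w := fun e => hvw (by rw [e, opp_fst])
    have n3 : w ≠ opp v := fun e => hvw (by rw [e, opp_fst])
    have zi : ∀ u : SIdx N, ∃ (s : SIdx N) (τ : ℝ), coord u z = coord s b + τ := by
      intro u
      by_cases h : u.1 = v.1
      · rcases (fst_eq_iff u v).1 h with rfl | rfl
        · exact ⟨w, σ, z1⟩
        · exact ⟨opp w, -σ, by rw [coord_opp, z1, coord_opp]; push_cast; ring⟩
      · exact ⟨u, 0, by simp [z2 u h]⟩
    have key : ∀ u' : SIdx N, u'.1 ≠ v.1 → coord v z - coord u' z = 0 → σ = 0 ∧ u' = w := by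
      intro u' h' h0
      rw [z1, z2 u' h', hb, hb] at h0
      by_cases e : u'.1 = w.1
      · rcases (fst_eq_iff u' w).1 e with rfl | rfl
        · refine ⟨?_, rfl⟩
          have : (σ : ℂ) = 0 := by linear_combination h0
          exact_mod_cast this
        · exfalso
          refine im_base_ne_real w.1 w.2 (-σ / 2) ?_
          simp only [opp, sgn_not] at h0
          push_cast
          linear_combination h0 / 2
      · exfalso
        have := congrArg Complex.im h0
        have e' : w.1 ≠ u'.1 := Ne.symm e
        have h2 := im_base_ne e' w.2 u'.2
        apply h2
        apply Complex.ext
        · rcases sgn_cases w.2 with ha | ha <;> rcases sgn_cases u'.2 with hb | hb <;>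
            rw [ha, hb] <;> simp
        · rw [Complex.sub_im] at this ⊢
          rw [Complex.add_im, Complex.ofReal_im, add_zero] at this
          exact this
    have hperm : ∀ u : SIdx N, u.1 = v.1 → ∀ u' : SIdx N, u'.1 ≠ v.1 →
        coord u z - coord u' z = 0 →
        (σ : ℂ) = 0 ∧ u' = Root.perm (.inr ⟨(v, w), hvw⟩) u ∧
          u = Root.perm (.inr ⟨(v, w), hvw⟩) u' := by
      intro u h u' h' h0
      rcases (fst_eq_iff u v).1 h with rfl | rfl
      · obtain ⟨e1, rfl⟩ := key u' h' h0
        exact ⟨by exact_mod_cast e1, by simp [Root.perm], by simp [Root.perm, n1.symm]⟩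
      · obtain ⟨e1, e2⟩ := key (opp u') (by simpa using h') (by
          rw [coord_opp] at h0 ⊢; linear_combination -h0)
        have e3 : u' = opp w := by rw [← e2, opp_opp]
        subst e3
        refine ⟨by exact_mod_cast e1, ?_, ?_⟩
        · rw [Root.perm_opp]; simp [Root.perm]
        · rw [Root.perm_opp]; simp [Root.perm, n1.symm]
    refine ⟨z, ?_, fun u hu => ?_, fun u hu => ?_, fun u u' huu h0 => ?_⟩
    · simp [Root.lin, z1, z2 w (Ne.symm hvw)]
    · exfalso
      obtain ⟨s, τ, hs⟩ := zi u
      rw [hs, hb] at hu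
      refine im_base_ne_real s.1 s.2 (-τ) ?_
      push_cast
      linear_combination hu
    · exfalso
      obtain ⟨s, τ, hs⟩ := zi u
      rw [hs, hb] at hu
      refine im_base_ne_real s.1 s.2 (-τ - 1 / 2) ?_
      push_cast
      linear_combination hu
    · by_cases h : u.1 = v.1
      · have h' : u'.1 ≠ v.1 := fun e => huu (by rw [h, e])
        obtain ⟨e1, e2, -⟩ := hperm u h u' h' h0
        exact ⟨e1, e2⟩
      · by_cases h' : u'.1 = v.1
        · obtain ⟨e1, -, e2⟩ := hperm u' h' u h (by linear_combination -h0)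
          exact ⟨e1, e2⟩
        · rw [z2 u h, z2 u' h', hb, hb] at h0
          exact absurd h0 (im_base_ne huu _ _)

lemma Gen.of_vanish {ρ : Root N} {σ : ℂ} {x z : Fin N → ℂ} (hz : Gen ρ σ z)
    (hx : eval x ρ.lin = σ)
    (h : ∀ k : Form N, eval x k.poly = 0 → eval z k.poly = 0) : Gen ρ σ x where
  lin := hx
  zero u hu := hz.zero u (by
    simpa [Form.poly, Root.lin] using h (.inl (.inl u)) (by simpa [Form.poly, Root.lin] using hu))
  half u hu := hz.half u (by
    simpa [Form.poly] using h (.inr u) (by simpa [Form.poly] using hu))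
  diff u w huw h0 := hz.diff u w huw (by
    simpa [Form.poly, Root.lin] using h (.inl (.inr ⟨(u, w), huw⟩))
      (by simpa [Form.poly, Root.lin] using h0))

namespace Gen

variable {ρ : Root N} {σ : ℂ} {x : Fin N → ℂ}

lemma coord_dir_ne_zero_of_zero (h : Gen ρ σ x) {u : SIdx N} (hu : coord u x = 0) :
    coord u ρ.dir ≠ 0 := by
  rw [Ne, ← Root.perm_eq_self_iff, (h.zero u hu).2]
  exact opp_ne u

lemma coord_dir_ne_zero_of_diff (h : Gen ρ σ x) {u w : SIdx N} (huw : u.1 ≠ w.1)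
    (h0 : coord u x - coord w x = 0) : coord u ρ.dir ≠ 0 ∧ coord w ρ.dir = -coord u ρ.dir := by
  have := (h.diff u w huw h0).2
  refine ⟨?_, by rw [this, Root.coord_perm_dir]⟩
  rw [Ne, ← Root.perm_eq_self_iff, ← this]
  rintro rfl
  exact huw rfl

lemma eventually_reg (h : Gen ρ σ x) : ∀ᶠ t : ℂ in 𝓝[≠] 0, Reg (x + t • ρ.dir) := by
  have aff : ∀ a b : ℂ, (a = 0 → b ≠ 0) → ∀ᶠ t : ℂ in 𝓝[≠] 0, a + t * b ≠ 0 := by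
    intro a b hab
    by_cases ha : a = 0
    · filter_upwards [self_mem_nhdsWithin] with t ht
      rw [ha, zero_add]
      exact mul_ne_zero ht (hab ha)
    · have hc : Tendsto (fun t : ℂ => a + t * b) (𝓝[≠] 0) (𝓝 (a + 0 * b)) :=
        ((continuous_const.add (continuous_id.mul continuous_const)).tendsto 0).mono_left
          nhdsWithin_le_nhds
      exact hc.eventually_ne (by simpa using ha)
  simp only [reg_iff]
  refine (eventually_all.2 fun u => ?_).and ((eventually_all.2 fun u => ?_).and
    (eventually_all.2 fun u => eventually_all.2 fun w => ?_))
  · filter_upwards [aff _ _ (h.coord_dir_ne_zero_of_zero (u := u))] with t ht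
    simpa using ht
  · have := aff (coord u x + 1 / 2) (coord u ρ.dir) (by
      intro h0
      obtain ⟨v, rfl, hv⟩ := h.half u h0
      rcases (fst_eq_iff u v).1 hv with rfl | rfl <;> simp [Root.dir])
    filter_upwards [this] with t ht
    rw [coord_add, coord_smul]
    intro h0
    exact ht (by linear_combination h0)
  · by_cases huw : u.1 = w.1
    · simp [huw]
    · have := aff (coord u x - coord w x) (coord u ρ.dir - coord w ρ.dir) (by
        intro h0
        obtain ⟨h1, h2⟩ := h.coord_dir_ne_zero_of_diff huw h0
        rw [h2, sub_neg_eq_add, ← two_mul]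
        exact mul_ne_zero two_ne_zero h1)
      filter_upwards [this] with t ht _ h0
      simp only [coord_add, coord_smul] at h0
      exact ht (by linear_combination h0)

lemma half_ne (h : Gen ρ 0 x) (u : SIdx N) : coord u x + 1 / 2 ≠ 0 := by
  intro h0
  obtain ⟨v, rfl, hv⟩ := h.half u h0
  have h1 : coord v x = 0 := by simpa [Root.lin] using h.lin
  rcases (fst_eq_iff u v).1 hv with rfl | rfl
  · rw [h1] at h0; norm_num at h0
  · rw [coord_opp, h1] at h0; norm_num at h0

lemma reg (h : Gen ρ σ x) (hσ : σ ≠ 0)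
    (hs : ∀ v, ρ = .inl v → σ ≠ 1 / 2 ∧ σ ≠ -(1 / 2)) : Reg x := by
  rw [reg_iff]
  refine ⟨fun u hu => hσ (h.zero u hu).1, fun u hu => ?_, fun u w huw h0 =>
    hσ (h.diff u w huw h0).1⟩
  obtain ⟨v, rfl, hv⟩ := h.half u hu
  have h1 : coord v x = σ := by simpa [Root.lin] using h.lin
  obtain ⟨s1, s2⟩ := hs v rfl
  rcases (fst_eq_iff u v).1 hv with rfl | rfl
  · rw [h1] at hu; exact s2 (by linear_combination hu)
  · rw [coord_opp, h1] at hu; exact s1 (by linear_combination -hu)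

end Gen

lemma Root.sub_C_affineAlong (ρ : Root N) (σ : ℂ) : AffineAlong (ρ.lin - C σ) ρ.dir ρ.nrm := by
  refine ⟨ρ.nrm_ne_zero, fun x t => ?_⟩
  simp only [map_sub, eval_C, ρ.eval_lin_line]
  ring

lemma dvd_of_gen (ρ : Root N) (σ : ℝ) {f : MvPolynomial (Fin N) ℂ}
    (h : ∀ x, Gen ρ σ x → eval x f = 0) : ρ.lin - C (σ : ℂ) ∣ f := by
  obtain ⟨z, hz⟩ := exists_gen ρ σ
  refine (ρ.sub_C_affineAlong σ).dvd_of_generic (Form.poly (N := N)) (z := z)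
    (by simp [hz.lin]) fun x hx hk => h x (hz.of_vanish ?_ hk)
  simpa [sub_eq_zero] using hx

lemma pow_dvd_of_gen (ρ : Root N) (n : ℕ) {f : MvPolynomial (Fin N) ℂ}
    (h : ∀ x, Gen ρ 0 x → ∀ j < n,
      Tendsto (fun t : ℂ => eval (x + t • ρ.dir) f / t ^ j) (𝓝[≠] 0) (𝓝 0)) :
    ρ.lin ^ n ∣ f := by
  obtain ⟨z, hz⟩ := exists_gen ρ 0
  rw [Complex.ofReal_zero] at hz
  exact ρ.affineAlong.pow_dvd_of_generic (Form.poly (N := N)) (z := z) hz.lin n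
    fun x hx hk => h x (hz.of_vanish hx hk)

lemma exists_poly_of_gen {f : (Fin N → ℂ) → ℂ} (hf : IsRat (den N) f)
    (h1 : ∀ (ρ : Root N) x, Gen ρ 0 x →
      Tendsto (fun t : ℂ => t * f (x + t • ρ.dir)) (𝓝[≠] 0) (𝓝 0))
    (h2 : ∀ (v : SIdx N) x, Gen (.inl v) (-(1 / 2)) x →
      Tendsto (fun t : ℂ => t * f (x + t • vec v)) (𝓝[≠] 0) (𝓝 0)) :
    ∃ r : MvPolynomial (Fin N) ℂ, ∀ x, Reg x → eval x r = f x := by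
  refine IsRat.exists_poly (fun k : Form N => k.affineAlong) hf ?_
  rintro (ρ | v)
  · obtain ⟨z, hz⟩ := exists_gen ρ 0
    rw [Complex.ofReal_zero] at hz
    refine ⟨z, hz.lin, fun x hx hk => ?_⟩
    have hg := hz.of_vanish hx hk
    exact ⟨h1 ρ x hg, hg.eventually_reg⟩
  · obtain ⟨z, hz⟩ := exists_gen (.inl v) (-(1 / 2))
    push_cast at hz
    refine ⟨z, ?_, fun x hx hk => ?_⟩
    · have := hz.lin
      simp only [Root.lin, eval_Y] at this
      simp [Form.poly, this]
    · have hg := hz.of_vanish (x := x) (by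
        simp only [Form.poly, map_add, eval_Y, eval_C] at hx
        simp only [Root.lin, eval_Y]
        linear_combination hx) hk
      exact ⟨h2 v x hg, hg.eventually_reg⟩

lemma tendsto_affine (a b : ℂ) : Tendsto (fun t : ℂ => a + t * b) (𝓝[≠] 0) (𝓝 a) := by
  have hc : Tendsto (fun t : ℂ => a + t * b) (𝓝[≠] 0) (𝓝 (a + 0 * b)) :=
    ((continuous_const.add (continuous_id.mul continuous_const)).tendsto 0).mono_left
      nhdsWithin_le_nhds
  simpa using hc

lemma tendsto_div_affine {a : ℂ} (ha : a ≠ 0) (b κ : ℂ) :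
    Tendsto (fun t : ℂ => κ / (a + t * b)) (𝓝[≠] 0) (𝓝 (κ / a)) :=
  tendsto_const_nhds.div (tendsto_affine a b) ha

lemma tendsto_id_punctured : Tendsto (fun t : ℂ => t) (𝓝[≠] 0) (𝓝 0) :=
  (continuous_id.tendsto (0 : ℂ)).mono_left nhdsWithin_le_nhds

lemma tendsto_mul_of_tendsto {f : ℂ → ℂ} {c : ℂ} (h : Tendsto f (𝓝[≠] 0) (𝓝 c)) :
    Tendsto (fun t => t * f t) (𝓝[≠] 0) (𝓝 0) := by
  simpa using tendsto_id_punctured.mul h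

lemma tendsto_mul_div_affine {b : ℂ} (hb : b ≠ 0) (κ : ℂ) :
    Tendsto (fun t : ℂ => t * (κ / (0 + t * b))) (𝓝[≠] 0) (𝓝 (κ / b)) := by
  refine tendsto_const_nhds.congr' ?_
  filter_upwards [self_mem_nhdsWithin] with t ht
  have ht : t ≠ 0 := ht
  rw [zero_add]
  field_simp

lemma tendsto_comp_neg {f : ℂ → ℂ} {c : ℂ} (h : Tendsto f (𝓝[≠] 0) (𝓝 c)) :
    Tendsto (fun t => f (-t)) (𝓝[≠] 0) (𝓝 c) := by
  refine h.comp (tendsto_nhdsWithin_iff.2 ⟨?_, ?_⟩)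
  · have := (continuous_neg.tendsto (0 : ℂ)).mono_left (nhdsWithin_le_nhds (s := {0}ᶜ))
    simpa using this
  · filter_upwards [self_mem_nhdsWithin] with t ht
    simpa using ht

/-- Cancellation of residues in a sum equivariant under a reflection. -/
lemma tendsto_residue_sum (ρ : Root N) {f D : SIdx N → ℂ → ℂ} {R D0 : SIdx N → ℂ}
    (hf : ∀ u, Tendsto (fun t => t * f u t) (𝓝[≠] 0) (𝓝 (R u)))
    (hsym : ∀ u t, f (ρ.perm u) (-t) = f u t)
    (hD : ∀ u, Tendsto (D u) (𝓝[≠] 0) (𝓝 (D0 u)))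
    (h0 : ∀ u, R u * (D0 u - D0 (ρ.perm u)) = 0) :
    Tendsto (fun t => t * ∑ u, f u t * D u t) (𝓝[≠] 0) (𝓝 0) := by
  have hR : ∀ u, R (ρ.perm u) = -R u := by
    intro u
    have h1 := tendsto_comp_neg (hf (ρ.perm u))
    have h2 := (hf u).neg
    refine tendsto_nhds_unique h1 (h2.congr fun t => ?_)
    rw [hsym]
    ring
  have hsum : ∑ u, R u * D0 u = 0 := by
    have e1 : ∑ u, R (ρ.perm u) * D0 (ρ.perm u) = ∑ u, R u * D0 u :=
      ρ.sum_perm fun u => R u * D0 u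
    have e2 : ∑ u, (R u * D0 u + R (ρ.perm u) * D0 (ρ.perm u)) = 0 := by
      refine Finset.sum_eq_zero fun u _ => ?_
      rw [hR]
      linear_combination h0 u
    rw [Finset.sum_add_distrib, e1] at e2
    linear_combination e2 / 2
  have := tendsto_finsetSum (Finset.univ : Finset (SIdx N)) fun u _ => (hf u).mul (hD u)
  rw [hsum] at this
  refine this.congr fun t => ?_
  rw [Finset.mul_sum]
  exact Finset.sum_congr rfl fun u _ => by ring

/-- Derivative in the direction `η`. -/
def dD (η : Fin N → ℂ) : Derivation ℂ (MvPolynomial (Fin N) ℂ) (MvPolynomial (Fin N) ℂ) :=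
  mkDerivation ℂ fun i => C (η i)

@[simp] lemma dD_X (η : Fin N → ℂ) (i : Fin N) : dD η (X i) = C (η i) := by simp [dD]
@[simp] lemma dD_C (η : Fin N → ℂ) (c : ℂ) : dD η (C c) = 0 := by simp [dD]

lemma exists_taylor (q : MvPolynomial (Fin N) ℂ) (x η : Fin N → ℂ) :
    ∃ R : ℂ → ℂ, Continuous R ∧ R 0 = eval x (dD η (dD η q)) / 2 ∧
      ∀ t, eval (x + t • η) q = eval x q + t * eval x (dD η q) + t ^ 2 * R t := by
  induction q using MvPolynomial.induction_on with
  | C a => exact ⟨fun _ => 0, continuous_const, by simp, fun t => by simp⟩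
  | add p q hp hq =>
    obtain ⟨R, h1, h2, h3⟩ := hp
    obtain ⟨S, k1, k2, k3⟩ := hq
    refine ⟨fun t => R t + S t, h1.add k1, ?_, fun t => ?_⟩
    · simp only [h2, k2, map_add]; ring
    · simp only [map_add, h3, k3]; ring
  | mul_X p i hp =>
    obtain ⟨R, h1, h2, h3⟩ := hp
    refine ⟨fun t => eval x (dD η p) * η i + R t * (x i + t * η i), by fun_prop, ?_, fun t => ?_⟩
    · simp [h2, Derivation.leibniz]; ring
    · simp [h3, Derivation.leibniz]; ring

lemma tendsto_slope_line (q : MvPolynomial (Fin N) ℂ) (x η : Fin N → ℂ) :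
    Tendsto (fun t : ℂ => (eval (x + t • η) q - eval x q) / t) (𝓝[≠] 0)
      (𝓝 (eval x (dD η q))) := by
  obtain ⟨R, h1, -, h3⟩ := exists_taylor q x η
  have hc : Continuous fun t : ℂ => eval x (dD η q) + t * R t := by fun_prop
  have := (hc.tendsto 0).mono_left (nhdsWithin_le_nhds (s := {0}ᶜ))
  rw [zero_mul, add_zero] at this
  refine this.congr' ?_
  filter_upwards [self_mem_nhdsWithin] with t ht
  have ht : t ≠ 0 := ht
  rw [h3]
  field_simp
  ring

lemma tendsto_taylor_two (q : MvPolynomial (Fin N) ℂ) (x η : Fin N → ℂ) :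
    Tendsto (fun t : ℂ => (eval (x + t • η) q - eval x q - t * eval x (dD η q)) / t ^ 2) (𝓝[≠] 0)
      (𝓝 (eval x (dD η (dD η q)) / 2)) := by
  obtain ⟨R, h1, h2, h3⟩ := exists_taylor q x η
  have := (h1.tendsto 0).mono_left (nhdsWithin_le_nhds (s := {0}ᶜ))
  rw [h2] at this
  refine this.congr' ?_
  filter_upwards [self_mem_nhdsWithin] with t ht
  have ht : t ≠ 0 := ht
  rw [h3]
  field_simp
  ring

lemma eval_shiftPoly (v x : Fin N → ℂ) (p : MvPolynomial (Fin N) ℂ) :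
    eval x (shiftPoly v p) = eval (x + v) p := by
  rw [shiftPoly, aeval_def, eval_eval₂]
  have : (eval x).comp (algebraMap ℂ (MvPolynomial (Fin N) ℂ)) = RingHom.id ℂ := by
    ext; simp
  rw [this, eval₂_eq_eval_map, MvPolynomial.map_id]
  congr 2
  ext j
  simp

namespace Root

/-- The reflection acting on polynomials. -/
def actP (ρ : Root N) (p : MvPolynomial (Fin N) ℂ) : MvPolynomial (Fin N) ℂ :=
  aeval (fun i => Y (ρ.perm (i, true))) p

lemma eval_actP (ρ : Root N) (x : Fin N → ℂ) (p : MvPolynomial (Fin N) ℂ) :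
    eval x (ρ.actP p) = eval (ρ.act x) p := by
  rw [actP, aeval_def, eval_eval₂]
  have : (eval x).comp (algebraMap ℂ (MvPolynomial (Fin N) ℂ)) = RingHom.id ℂ := by
    ext; simp
  rw [this, eval₂_eq_eval_map, MvPolynomial.map_id]
  congr 2
  ext j
  simp [act]

lemma perm_inr_ne_opp (p : {p : SIdx N × SIdx N // p.1.1 ≠ p.2.1}) (u : SIdx N) :
    perm (.inr p) u ≠ opp u := by
  intro h
  have h1 := coord_perm (.inr p) u (vec u)
  rw [h, eval_lin_vec, coord_opp, coord_vec_self] at h1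
  rcases coord_dir_mem (.inr p) u with h2 | h2 | h2 <;> norm_num [h2, nrm] at h1

lemma perm_inl_fst (v u : SIdx N) : (perm (.inl v) u).1 = u.1 := by
  by_cases h : u.1 = v.1 <;> simp [perm, h]

end Root

/-- The three multiplicities. -/
structure Mult where
  m1 : ℕ
  m2 : ℕ
  m3 : ℕ

namespace Mult

/-- The multiplicity of integral type at a root. -/
def lvl (m : Mult) : Root N → ℕ
  | .inl _ => m.m1
  | .inr _ => m.m3

/-- The values of a root on which the trigonometric conditions are imposed. -/
def IsLevel (m : Mult) (ρ : Root N) (σ : ℝ) : Prop :=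
  match ρ with
  | .inl _ => (∃ s : ℕ, 1 ≤ s ∧ s ≤ m.m1 ∧ σ = s) ∨ ∃ s : ℕ, 1 ≤ s ∧ s ≤ m.m2 ∧ σ = s - 1 / 2
  | .inr _ => ∃ s : ℕ, 1 ≤ s ∧ s ≤ m.m3 ∧ σ = s

lemma isLevel_one {m : Mult} {ρ : Root N} (h : m.lvl ρ ≠ 0) : m.IsLevel ρ 1 := by
  rcases ρ with v | p
  · exact Or.inl ⟨1, le_rfl, Nat.one_le_iff_ne_zero.2 h, by simp⟩
  · exact ⟨1, le_rfl, Nat.one_le_iff_ne_zero.2 h, by simp⟩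

lemma isLevel_half {m : Mult} {v : SIdx N} (h : m.m2 ≠ 0) : m.IsLevel (.inl v) (1 / 2) :=
  Or.inr ⟨1, le_rfl, Nat.one_le_iff_ne_zero.2 h, by norm_num⟩

end Mult

/-- Trigonometric quasi-invariance: `p` agrees with its reflections on the shifted hyperplanes. -/
def Qtr (N : ℕ) (m : Mult) : Submodule ℂ (MvPolynomial (Fin N) ℂ) where
  carrier := {p | ∀ ρ σ, m.IsLevel ρ σ → ∀ x, eval x ρ.lin = σ → eval x p = eval (ρ.act x) p}
  zero_mem' := fun _ _ _ _ _ => by simp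
  add_mem' := fun {a b} ha hb ρ σ hσ x hx => by
    rw [map_add, map_add, ha ρ σ hσ x hx, hb ρ σ hσ x hx]
  smul_mem' := fun c p hp ρ σ hσ x hx => by
    rw [smul_eval, smul_eval, hp ρ σ hσ x hx]

variable (m : Mult)

/-- The contribution of the pair `u`, `w` of signed indices to `aCoef`. -/
def pairFactor (u w : SIdx N) (x : Fin N → ℂ) : ℂ :=
  if w.1 = u.1 then 1 else 1 - m.m3 / (coord u x - coord w x)

/-- Coefficients of the difference operator. -/
def aCoef (u : SIdx N) (x : Fin N → ℂ) : ℂ :=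
  (1 - m.m1 / coord u x) * (1 - m.m2 / (coord u x + 1 / 2)) * ∏ w, pairFactor m u w x

/-- The difference operator with shifts by the signed basis vectors. -/
def diffOp (p : MvPolynomial (Fin N) ℂ) (x : Fin N → ℂ) : ℂ :=
  ∑ u, aCoef m u x * (eval (x + vec u) p - eval x p)

variable {m}

lemma Root.prod_perm (ρ : Root N) {M : Type*} [CommMonoid M] (f : SIdx N → M) :
    ∏ u, f (ρ.perm u) = ∏ u, f u :=
  Equiv.prod_comp (Equiv.ofBijective ρ.perm ⟨ρ.perm_injective, fun u => ⟨_, ρ.perm_perm u⟩⟩) f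

lemma aCoef_act (ρ : Root N) (u : SIdx N) (x : Fin N → ℂ) :
    aCoef m (ρ.perm u) (ρ.act x) = aCoef m u x := by
  unfold aCoef
  rw [Root.coord_act, Root.perm_perm, ← ρ.prod_perm]
  congr 1
  refine Finset.prod_congr rfl fun w _ => ?_
  simp only [pairFactor, Root.coord_act, Root.perm_perm, Root.perm_fst_eq_iff]

lemma aCoef_opp (u : SIdx N) (x : Fin N → ℂ) : aCoef m (opp u) x = aCoef m u (-x) := by
  have hp : ∏ w, pairFactor m (opp u) w x = ∏ w, pairFactor m (opp u) (opp w) x :=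
    (Equiv.prod_comp (Function.Involutive.toPerm opp (fun u : SIdx N => opp_opp u))
      fun w => pairFactor m (opp u) w x).symm
  unfold aCoef
  rw [hp]
  simp only [pairFactor, coord_opp, coord_neg, opp_fst]

lemma diffOp_sub_act (ρ : Root N) (p : MvPolynomial (Fin N) ℂ) (x : Fin N → ℂ) :
    diffOp m p x - diffOp m p (ρ.act x)
      = ∑ u, aCoef m u x * (eval (x + vec u) (p - ρ.actP p) - eval x (p - ρ.actP p)) := by
  unfold diffOp
  rw [← ρ.sum_perm fun u => aCoef m u (ρ.act x) * (eval (ρ.act x + vec u) p - eval (ρ.act x) p),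
    ← Finset.sum_sub_distrib]
  refine Finset.sum_congr rfl fun u _ => ?_
  rw [aCoef_act, map_sub, map_sub, Root.eval_actP, Root.eval_actP, Root.act_add_vec]
  ring

lemma isRat_aCoef (u : SIdx N) : IsRat (den N) (aCoef m u) := by
  unfold aCoef
  refine ((((IsRat.const 1).sub ?_).mul ((IsRat.const 1).sub ?_)).mul
    (IsRat.prod _ fun w _ => ?_))
  · simpa [Form.poly, Root.lin] using
      IsRat.div_of_dvd (dvd_den (.inl (.inl u))) (m.m1 : ℂ)
  · simpa [Form.poly] using IsRat.div_of_dvd (dvd_den (.inr u)) (m.m2 : ℂ)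
  · unfold pairFactor
    by_cases h : w.1 = u.1
    · simpa [h] using IsRat.const 1
    · simp only [h, if_false]
      refine (IsRat.const 1).sub ?_
      simpa [Form.poly, Root.lin] using
        IsRat.div_of_dvd (dvd_den (.inl (.inr ⟨(u, w), Ne.symm h⟩))) (m.m3 : ℂ)

lemma isRat_diffOp (p : MvPolynomial (Fin N) ℂ) : IsRat (den N) (diffOp m p) := by
  unfold diffOp
  refine IsRat.sum _ fun u _ => (isRat_aCoef u).mul (IsRat.sub ?_ (IsRat.of_poly p))
  simpa [eval_shiftPoly] using IsRat.of_poly (den := den N) (shiftPoly (vec u) p)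

/-- None of the denominators of `aCoef m u` vanishes at `x`. -/
structure NonSing (u : SIdx N) (x : Fin N → ℂ) : Prop where
  zero : coord u x ≠ 0
  half : coord u x + 1 / 2 ≠ 0
  diff : ∀ w : SIdx N, w.1 ≠ u.1 → coord u x - coord w x ≠ 0

lemma tendsto_pairFactor {u w : SIdx N} {x : Fin N → ℂ} (η : Fin N → ℂ)
    (h : w.1 ≠ u.1 → coord u x - coord w x ≠ 0) :
    Tendsto (fun t : ℂ => pairFactor m u w (x + t • η)) (𝓝[≠] 0) (𝓝 (pairFactor m u w x)) := by
  by_cases hw : w.1 = u.1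
  · simp [pairFactor, hw]
  · simp only [pairFactor, hw, if_false]
    refine tendsto_const_nhds.sub
      ((tendsto_div_affine (h hw) (coord u η - coord w η) _).congr fun t => ?_)
    simp only [coord_add, coord_smul]
    congr 1
    ring

lemma tendsto_fac_zero {u : SIdx N} {x : Fin N → ℂ} (η : Fin N → ℂ) (h : coord u x ≠ 0) (κ : ℂ) :
    Tendsto (fun t : ℂ => 1 - κ / coord u (x + t • η)) (𝓝[≠] 0) (𝓝 (1 - κ / coord u x)) := by
  refine tendsto_const_nhds.sub ((tendsto_div_affine h (coord u η) κ).congr fun t => ?_)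
  simp

lemma tendsto_fac_half {u : SIdx N} {x : Fin N → ℂ} (η : Fin N → ℂ) (h : coord u x + 1 / 2 ≠ 0)
    (κ : ℂ) : Tendsto (fun t : ℂ => 1 - κ / (coord u (x + t • η) + 1 / 2)) (𝓝[≠] 0)
      (𝓝 (1 - κ / (coord u x + 1 / 2))) := by
  refine tendsto_const_nhds.sub ((tendsto_div_affine h (coord u η) κ).congr fun t => ?_)
  simp only [coord_add, coord_smul]
  congr 1
  ring

lemma NonSing.tendsto_aCoef {u : SIdx N} {x : Fin N → ℂ} (h : NonSing u x) (η : Fin N → ℂ) :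
    Tendsto (fun t : ℂ => aCoef m u (x + t • η)) (𝓝[≠] 0) (𝓝 (aCoef m u x)) :=
  ((tendsto_fac_zero η h.zero _).mul (tendsto_fac_half η h.half _)).mul
    (tendsto_finsetProd _ fun w _ => tendsto_pairFactor η (h.diff w))

lemma tendsto_mul_one_sub {b : ℂ} (hb : b ≠ 0) (κ : ℂ) :
    Tendsto (fun t : ℂ => t * (1 - κ / (0 + t * b))) (𝓝[≠] 0) (𝓝 (-(κ / b))) := by
  have := (tendsto_id_punctured).sub (tendsto_mul_div_affine hb κ)
  simpa [mul_sub] using this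

/-- `aCoef` has at most a simple pole at a generic point. -/
lemma Gen.exists_residue {ρ : Root N} {σ : ℂ} {x : Fin N → ℂ} (h : Gen ρ σ x) (u : SIdx N) :
    ∃ R, Tendsto (fun t : ℂ => t * aCoef m u (x + t • ρ.dir)) (𝓝[≠] 0) (𝓝 R) ∧
      (R ≠ 0 → (coord u x + 1 / 2 = 0 ∧ m.m2 ≠ 0) ∨ (σ = 0 ∧ m.lvl ρ ≠ 0)) := by
  by_cases hA : coord u x = 0
  · obtain ⟨hσ, hπ⟩ := h.zero u hA
    have hdir := h.coord_dir_ne_zero_of_zero hA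
    have hd : ∀ w : SIdx N, w.1 ≠ u.1 → coord u x - coord w x ≠ 0 := by
      intro w hw h0
      have := (h.diff u w (Ne.symm hw) h0).2
      rw [hπ] at this
      exact hw (by rw [this, opp_fst])
    have hh : coord u x + 1 / 2 ≠ 0 := by rw [hA]; norm_num
    have h1 := (((tendsto_mul_one_sub hdir (m.m1 : ℂ)).mul
      (tendsto_fac_half (u := u) ρ.dir hh (m.m2 : ℂ))).mul
      (tendsto_finsetProd Finset.univ
        fun w _ => tendsto_pairFactor (m := m) (u := u) ρ.dir (hd w)))
    refine ⟨_, h1.congr fun t => ?_, fun hR => Or.inr ⟨hσ, ?_⟩⟩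
    · simp only [aCoef, coord_add, coord_smul, hA]
      ring
    · rcases ρ with v | p
      · intro h0
        apply hR
        have : m.m1 = 0 := h0
        simp [this]
      · exact absurd hπ (Root.perm_inr_ne_opp p u)
  by_cases hB : coord u x + 1 / 2 = 0
  · obtain ⟨v, rfl, hv⟩ := h.half u hB
    have hdir : coord u (Root.dir (.inl v)) ≠ 0 := by
      rcases (fst_eq_iff u v).1 hv with rfl | rfl <;> simp [Root.dir]
    have hd : ∀ w : SIdx N, w.1 ≠ u.1 → coord u x - coord w x ≠ 0 := by
      intro w hw h0
      have := (h.diff u w (Ne.symm hw) h0).2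
      exact hw (by rw [this, Root.perm_inl_fst])
    have h1 := (((tendsto_mul_one_sub hdir (m.m2 : ℂ)).mul
      (tendsto_fac_zero (u := u) (Root.dir (.inl v)) hA (m.m1 : ℂ))).mul
      (tendsto_finsetProd Finset.univ
        fun w _ => tendsto_pairFactor (m := m) (u := u) (Root.dir (.inl v)) (hd w)))
    refine ⟨_, h1.congr fun t => ?_, fun hR => Or.inl ⟨hB, ?_⟩⟩
    · simp only [aCoef, coord_add, coord_smul]
      have : coord u x + t * coord u (Root.dir (.inl v)) + 1 / 2
        = 0 + t * coord u (Root.dir (.inl v)) := by linear_combination hB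
      rw [this]
      ring
    · intro h0
      apply hR
      simp [h0]
  by_cases hC : ∃ w : SIdx N, w.1 ≠ u.1 ∧ coord u x - coord w x = 0
  · obtain ⟨w, hw, h0⟩ := hC
    obtain ⟨hσ, hπ⟩ := h.diff u w (Ne.symm hw) h0
    obtain ⟨hdir, hdir'⟩ := h.coord_dir_ne_zero_of_diff (Ne.symm hw) h0
    have hb : 2 * coord u ρ.dir ≠ 0 := mul_ne_zero two_ne_zero hdir
    have hd : ∀ w' ∈ Finset.univ.erase w, w'.1 ≠ u.1 → coord u x - coord w' x ≠ 0 := by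
      intro w' hw' hne h0'
      exact (Finset.mem_erase.1 hw').1 (((h.diff u w' (Ne.symm hne) h0').2).trans hπ.symm)
    have h1 := (((tendsto_mul_one_sub hb (m.m3 : ℂ)).mul
      (tendsto_fac_zero (u := u) ρ.dir hA (m.m1 : ℂ))).mul
      (tendsto_fac_half (u := u) ρ.dir hB (m.m2 : ℂ))).mul
      (tendsto_finsetProd (Finset.univ.erase w)
        fun w' hw' => tendsto_pairFactor (m := m) (u := u) ρ.dir (hd w' hw'))
    refine ⟨_, h1.congr fun t => ?_, fun hR => Or.inr ⟨hσ, ?_⟩⟩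
    · simp only [aCoef]
      rw [← Finset.mul_prod_erase Finset.univ _ (Finset.mem_univ w)]
      have : pairFactor m u w (x + t • ρ.dir) = 1 - m.m3 / (0 + t * (2 * coord u ρ.dir)) := by
        simp only [pairFactor, hw, if_false, coord_add, coord_smul, hdir']
        congr 2
        linear_combination h0
      rw [this]
      ring
    · rcases ρ with v | p
      · exfalso
        exact hw (by rw [hπ, Root.perm_inl_fst])
      · intro h0
        apply hR
        have : m.m3 = 0 := h0
        simp [this]
  · push Not at hC
    have : NonSing u x := ⟨hA, hB, hC⟩
    exact ⟨0, tendsto_mul_of_tendsto (this.tendsto_aCoef ρ.dir), fun h => absurd rfl h⟩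

lemma tendsto_shift_line (p : MvPolynomial (Fin N) ℂ) (x η w : Fin N → ℂ) :
    Tendsto (fun t : ℂ => eval (x + t • η + w) p - eval (x + t • η) p) (𝓝[≠] 0)
      (𝓝 (eval (x + w) p - eval x p)) := by
  have := (tendsto_eval_line (shiftPoly w p) x η).sub (tendsto_eval_line p x η)
  simpa [eval_shiftPoly] using this

/-- The difference operator maps trigonometric quasi-invariants to polynomials. -/
lemma exists_poly_diffOp {p : MvPolynomial (Fin N) ℂ} (hp : p ∈ Qtr N m) :
    ∃ r : MvPolynomial (Fin N) ℂ, ∀ x, Reg x → eval x r = diffOp m p x := by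
  refine exists_poly_of_gen (isRat_diffOp p) (fun ρ x hx => ?_) (fun v x hx => ?_)
  · choose R hR hR0 using hx.exists_residue (m := m)
    refine tendsto_residue_sum ρ hR (fun u t => ?_)
      (fun u => tendsto_shift_line p x ρ.dir (vec u)) (fun u => ?_)
    · rw [← Root.act_line ρ hx.lin, aCoef_act]
    · by_cases h : R u = 0
      · rw [h, zero_mul]
      rcases hR0 u h with ⟨h1, -⟩ | ⟨-, h1⟩
      · exact absurd h1 (hx.half_ne u)
      have e : x + vec (ρ.perm u) = ρ.act (x + vec u) := by
        rw [Root.act_add_vec, Root.act_of_lin_eq_zero ρ hx.lin]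
      have hl : eval (x + vec u) ρ.lin = coord u ρ.dir := by
        rw [Root.eval_lin_add, hx.lin, Root.eval_lin_vec, zero_add]
      have : eval (x + vec u) p = eval (x + vec (ρ.perm u)) p := by
        rw [e]
        rcases ρ.coord_dir_mem u with h2 | h2 | h2
        · rw [Root.act_of_lin_eq_zero ρ (hl.trans h2)]
        · exact hp ρ 1 (Mult.isLevel_one h1) _ (by rw [hl, h2]; simp)
        · have := hp ρ 1 (Mult.isLevel_one h1) (ρ.act (x + vec u))
            (by rw [Root.eval_lin_act, hl, h2]; simp)
          rw [Root.act_act] at this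
          exact this.symm
      rw [this]
      ring
  · have hv : coord v x = -(1 / 2) := by simpa [Root.lin] using hx.lin
    have : ∀ u, Tendsto (fun t : ℂ => t * (aCoef m u (x + t • vec v) *
        (eval (x + t • vec v + vec u) p - eval (x + t • vec v) p))) (𝓝[≠] 0) (𝓝 0) := by
      intro u
      obtain ⟨R, hR, hR0⟩ := hx.exists_residue (m := m) u
      have h1 := hR.mul (tendsto_shift_line p x (vec v) (vec u))
      have : R * (eval (x + vec u) p - eval x p) = 0 := by
        by_cases h : R = 0
        · rw [h, zero_mul]
        rcases hR0 h with ⟨h1, h2⟩ | ⟨h1, -⟩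
        · obtain ⟨w, hw, huw⟩ := hx.half u h1
          obtain rfl : v = w := by simpa using hw
          have : u = v := by
            rcases (fst_eq_iff u v).1 huw with e | e
            · exact e
            · rw [e, coord_opp, hv] at h1; norm_num at h1
          subst this
          have e := hp (.inl u) (1 / 2) (Mult.isLevel_half h2) (x + vec u) (by
            simp [Root.lin, hv]; norm_num)
          have e2 : Root.act (.inl u) (x + vec u) = x := by
            rw [Root.act_eq]
            simp [Root.lin, Root.nrm, Root.dir, hv]
            norm_num
          rw [e, e2, sub_self, mul_zero]
        · norm_num at h1
      rw [this] at h1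
      exact h1.congr fun t => by simp only [Root.dir]; ring
    have := tendsto_finsetSum Finset.univ fun u _ => this u
    simp only [Finset.sum_const_zero] at this
    exact this.congr fun t => by rw [diffOp, Finset.mul_sum]

lemma Mult.IsLevel.pos {ρ : Root N} {σ : ℝ} (h : m.IsLevel ρ σ) : 0 < σ := by
  rcases ρ with v | p
  · rcases h with ⟨s, h1, -, rfl⟩ | ⟨s, h1, -, rfl⟩
    · exact_mod_cast h1
    · have : (1 : ℝ) ≤ s := by exact_mod_cast h1
      linarith
  · obtain ⟨s, h1, -, rfl⟩ := h
    exact_mod_cast h1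

lemma Mult.IsLevel.sub_one {ρ : Root N} {σ : ℝ} (h : m.IsLevel ρ σ) :
    m.IsLevel ρ (σ - 1) ∨ σ = 1 ∨ ((∃ v, ρ = .inl v) ∧ σ = 1 / 2) := by
  rcases ρ with v | p
  · rcases h with ⟨s, h1, h2, rfl⟩ | ⟨s, h1, h2, rfl⟩
    · rcases h1.eq_or_lt with rfl | h3
      · exact Or.inr (Or.inl (by simp))
      · exact Or.inl (Or.inl ⟨s - 1, by omega, by omega, by push_cast [h1]; ring⟩)
    · rcases h1.eq_or_lt with rfl | h3
      · exact Or.inr (Or.inr ⟨⟨v, rfl⟩, by norm_num⟩)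
      · exact Or.inl (Or.inr ⟨s - 1, by omega, by omega, by push_cast [h1]; ring⟩)
  · obtain ⟨s, h1, h2, rfl⟩ := h
    rcases h1.eq_or_lt with rfl | h3
    · exact Or.inr (Or.inl (by simp))
    · exact Or.inl ⟨s - 1, by omega, by omega, by push_cast [h1]; ring⟩

lemma Mult.IsLevel.add_one {ρ : Root N} {σ : ℝ} (h : m.IsLevel ρ σ) {u : SIdx N}
    {x : Fin N → ℂ} (hx : eval x ρ.lin = σ) (hu : coord u ρ.dir = 1) :
    m.IsLevel ρ (σ + 1) ∨ aCoef m u x = 0 := by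
  rcases ρ with v | p
  · have huv : u = v := by
      by_cases h1 : u.1 = v.1
      · rcases (fst_eq_iff u v).1 h1 with rfl | rfl
        · rfl
        · simp [Root.dir] at hu; norm_num at hu
      · simp [Root.dir, coord_vec_of_ne h1] at hu
    subst huv
    have hx : coord u x = σ := by simpa [Root.lin] using hx
    rcases h with ⟨s, h1, h2, rfl⟩ | ⟨s, h1, h2, rfl⟩
    · rcases h2.eq_or_lt with rfl | h3
      · right
        have : (m.m1 : ℂ) ≠ 0 := by exact_mod_cast (by omega : m.m1 ≠ 0)
        simp [aCoef, hx, this]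
      · exact Or.inl (Or.inl ⟨s + 1, by omega, by omega, by push_cast; ring⟩)
    · rcases h2.eq_or_lt with rfl | h3
      · right
        have : (m.m2 : ℂ) ≠ 0 := by exact_mod_cast (by omega : m.m2 ≠ 0)
        simp [aCoef, hx, this]
      · exact Or.inl (Or.inr ⟨s + 1, by omega, by omega, by push_cast; ring⟩)
  · obtain ⟨s, h1, h2, rfl⟩ := h
    rcases h2.eq_or_lt with rfl | h3
    · right
      have h0 : (m.m3 : ℂ) ≠ 0 := by exact_mod_cast (by omega : m.m3 ≠ 0)
      unfold aCoef
      rw [Finset.prod_eq_zero (Finset.mem_univ (Root.perm (.inr p) u)), mul_zero]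
      have h4 : (Root.perm (.inr p) u).1 ≠ u.1 := by
        intro e
        rcases (fst_eq_iff _ _).1 e with e | e
        · rw [Root.perm_eq_self_iff, hu] at e
          exact one_ne_zero e
        · exact Root.perm_inr_ne_opp p u e
      rw [pairFactor, if_neg h4, Root.coord_perm, hx, hu, Root.nrm]
      push_cast
      have : coord u x - (coord u x - 2 * (m.m3 : ℂ) / 2 * 1) = m.m3 := by ring
      rw [this, div_self h0, sub_self]
    · exact Or.inl ⟨s + 1, by omega, by omega, by push_cast; ring⟩

lemma eval_sub_actP (ρ : Root N) (p : MvPolynomial (Fin N) ℂ) (x : Fin N → ℂ) :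
    eval x (p - ρ.actP p) = eval x p - eval (ρ.act x) p := by
  rw [map_sub, Root.eval_actP]

lemma aCoef_mul_eq_zero {p : MvPolynomial (Fin N) ℂ} (hp : p ∈ Qtr N m) {ρ : Root N} {σ : ℝ}
    (hσ : m.IsLevel ρ σ) {x : Fin N → ℂ} (hx : eval x ρ.lin = σ) (u : SIdx N)
    (hu : ((∃ v, ρ = .inl v) ∧ σ = 1 / 2) → coord u ρ.dir ≠ -1) :
    aCoef m u x * (eval (x + vec u) (p - ρ.actP p) - eval x (p - ρ.actP p)) = 0 := by
  have h0 : ∀ τ y, m.IsLevel ρ τ → eval y ρ.lin = τ → eval y (p - ρ.actP p) = 0 := by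
    intro τ y hτ hy
    rw [eval_sub_actP, hp ρ τ hτ y hy, sub_self]
  have hl : eval (x + vec u) ρ.lin = σ + coord u ρ.dir := by
    rw [Root.eval_lin_add, hx, Root.eval_lin_vec]
  rw [h0 σ x hσ hx, sub_zero]
  rcases ρ.coord_dir_mem u with h2 | h2 | h2
  · rw [h0 σ _ hσ (by rw [hl, h2, add_zero]), mul_zero]
  · rcases hσ.add_one hx h2 with h3 | h3
    · rw [h0 (σ + 1) _ h3 (by rw [hl, h2]; push_cast; ring), mul_zero]
    · rw [h3, zero_mul]
  · rcases hσ.sub_one with h3 | h3 | h3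
    · rw [h0 (σ - 1) _ h3 (by rw [hl, h2]; push_cast; ring), mul_zero]
    · have : eval (x + vec u) ρ.lin = 0 := by rw [hl, h2, h3]; simp
      rw [eval_sub_actP, Root.act_of_lin_eq_zero ρ this, sub_self, mul_zero]
    · exact absurd h2 (hu h3)

/-- The difference operator preserves trigonometric quasi-invariance. -/
lemma diffOp_mem_Qtr {p r : MvPolynomial (Fin N) ℂ} (hp : p ∈ Qtr N m)
    (hr : ∀ x, Reg x → eval x r = diffOp m p x) : r ∈ Qtr N m := by
  intro ρ σ hσ x hx
  suffices H : ρ.lin - C (σ : ℂ) ∣ r - ρ.actP r by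
    obtain ⟨c, hc⟩ := H
    have := congrArg (eval x) hc
    rw [eval_sub_actP, map_mul, map_sub, eval_C, hx, sub_self, zero_mul] at this
    exact sub_eq_zero.1 this
  clear x hx
  refine dvd_of_gen ρ σ fun x hx => ?_
  have hreg : ∀ y, Reg y → eval y (r - ρ.actP r)
      = ∑ u, aCoef m u y * (eval (y + vec u) (p - ρ.actP p) - eval y (p - ρ.actP p)) := by
    intro y hy
    rw [eval_sub_actP, hr y hy, hr _ (hy.act ρ), diffOp_sub_act]
  by_cases hs : (∃ v, ρ = .inl v) ∧ σ = 1 / 2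
  · obtain ⟨⟨v, rfl⟩, rfl⟩ := hs
    have hv : coord v x = 1 / 2 := by simpa [Root.lin] using hx.lin
    have hterm : ∀ u, Tendsto (fun t : ℂ => aCoef m u (x + t • Root.dir (.inl v)) *
        (eval (x + t • Root.dir (.inl v) + vec u) (p - Root.actP (.inl v) p)
          - eval (x + t • Root.dir (.inl v)) (p - Root.actP (.inl v) p))) (𝓝[≠] 0) (𝓝 0) := by
      intro u
      by_cases hu : u = opp v
      · subst hu
        obtain ⟨R, hR, -⟩ := hx.exists_residue (m := m) (opp v)
        have h1 := tendsto_slope_line (p - Root.actP (.inl v) p) x (Root.dir (.inl v))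
        have h2 := (tendsto_comp_neg h1).sub h1
        rw [sub_self] at h2
        have h3 := hR.mul h2
        rw [mul_zero] at h3
        have hx0 : eval x (p - Root.actP (.inl v) p) = 0 := by
          rw [eval_sub_actP, hp _ _ hσ x hx.lin, sub_self]
        refine h3.congr' ?_
        filter_upwards [self_mem_nhdsWithin] with t ht
        have ht : t ≠ 0 := ht
        have e : x + t • Root.dir (.inl v) + vec (opp v)
            = Root.act (.inl v) (x + (-t) • Root.dir (.inl v)) := by
          rw [Root.act_eq, vec_opp]
          have : eval (x + (-t) • Root.dir (.inl v)) (Root.lin (.inl v)) = 1 / 2 - t := by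
            simp [Root.lin, Root.dir, hv]; ring
          rw [this]
          ext i
          simp [Root.dir, Root.nrm]
          ring
        have e2 : eval (x + t • Root.dir (.inl v) + vec (opp v)) (p - Root.actP (.inl v) p)
            = -eval (x + (-t) • Root.dir (.inl v)) (p - Root.actP (.inl v) p) := by
          rw [eval_sub_actP, eval_sub_actP, e, Root.act_act]
          ring
        rw [e2, hx0]
        field_simp
        ring
      · have hns : NonSing u x := by
          refine ⟨fun h0 => ?_, fun h0 => ?_, fun w hw h0 => ?_⟩
          · have := (hx.zero u h0).1
            norm_num at this
          · obtain ⟨w, hw, huw⟩ := hx.half u h0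
            obtain rfl : v = w := by simpa using hw
            rcases (fst_eq_iff u v).1 huw with rfl | e
            · rw [hv] at h0; norm_num at h0
            · exact hu e
          · have := (hx.diff u w (Ne.symm hw) h0).1
            norm_num at this
        have h1 := (hns.tendsto_aCoef (m := m) (Root.dir (.inl v))).mul
          (tendsto_shift_line (p - Root.actP (.inl v) p) x (Root.dir (.inl v)) (vec u))
        rwa [aCoef_mul_eq_zero hp hσ hx.lin u] at h1
        intro _ h2
        by_cases h3 : u.1 = v.1
        · rcases (fst_eq_iff u v).1 h3 with rfl | e
          · simp [Root.dir] at h2; norm_num at h2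
          · exact hu e
        · simp [Root.dir, coord_vec_of_ne h3] at h2
    have hsum := tendsto_finsetSum Finset.univ fun u _ => hterm u
    simp only [Finset.sum_const_zero] at hsum
    refine tendsto_nhds_unique (tendsto_eval_line _ x (Root.dir (.inl v))) (hsum.congr' ?_)
    filter_upwards [hx.eventually_reg] with t ht
    rw [hreg _ ht]
  · have hx' : Reg x := by
      refine hx.reg (by exact_mod_cast hσ.pos.ne') fun v hv => ⟨fun h => hs ⟨⟨v, hv⟩, ?_⟩,
        fun h => ?_⟩
      · apply Complex.ofReal_injective; rw [h]; norm_num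
      · have : σ = -(1 / 2) := by apply Complex.ofReal_injective; rw [h]; norm_num
        have := hσ.pos
        linarith
    rw [hreg x hx']
    exact Finset.sum_eq_zero fun u _ =>
      aCoef_mul_eq_zero hp hσ hx.lin u fun h => absurd h hs

section Leading

/-- Coefficients of the first-order part of the differential operator. -/
def cCoef (m : Mult) (u : SIdx N) (x : Fin N → ℂ) : ℂ :=
  (m.m1 + m.m2) / coord u x + ∑ w, if w.1 = u.1 then 0 else m.m3 / (coord u x - coord w x)

/-- The rational (Calogero-Moser) differential operator. -/
def calOp (m : Mult) (q : MvPolynomial (Fin N) ℂ) (x : Fin N → ℂ) : ℂ :=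
  ∑ u, (eval x (dD (vec u) (dD (vec u) q)) / 2 - cCoef m u x * eval x (dD (vec u) q))

/-- `f = 1 + c h + o(h)` at `0`. -/
def OneExp (f : ℂ → ℂ) (c : ℂ) : Prop := Tendsto (fun h => (f h - 1) / h) (𝓝[≠] 0) (𝓝 c)

lemma OneExp.tendsto {f : ℂ → ℂ} {c : ℂ} (h : OneExp f c) : Tendsto f (𝓝[≠] 0) (𝓝 1) := by
  have h1 := (tendsto_mul_of_tendsto h).const_add 1
  rw [add_zero] at h1
  refine h1.congr' ?_
  filter_upwards [self_mem_nhdsWithin] with t ht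
  have ht : t ≠ 0 := ht
  field_simp
  ring

lemma OneExp.one : OneExp (fun _ => 1) 0 := by simp [OneExp]

lemma OneExp.mul {f g : ℂ → ℂ} {c d : ℂ} (hf : OneExp f c) (hg : OneExp g d) :
    OneExp (fun h => f h * g h) (c + d) := by
  have := hf.add (hf.tendsto.mul hg)
  rw [one_mul] at this
  exact this.congr fun t => by ring

lemma OneExp.prod {ι : Type*} (s : Finset ι) {f : ι → ℂ → ℂ} {c : ι → ℂ}
    (hf : ∀ i ∈ s, OneExp (f i) (c i)) : OneExp (fun h => ∏ i ∈ s, f i h) (∑ i ∈ s, c i) := by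
  classical
  induction s using Finset.induction_on with
  | empty => simpa using OneExp.one
  | insert a s ha ih =>
    simp only [Finset.prod_insert ha, Finset.sum_insert ha]
    exact (hf a (Finset.mem_insert_self _ _)).mul
      (ih fun i hi => hf i (Finset.mem_insert_of_mem hi))

lemma oneExp_fac {a : ℂ} (ha : a ≠ 0) (b κ : ℂ) :
    OneExp (fun h => 1 - κ / (h⁻¹ * a + b)) (-(κ / a)) := by
  refine (tendsto_div_affine ha b κ).neg.congr' ?_
  filter_upwards [self_mem_nhdsWithin, (tendsto_affine a b).eventually_ne ha] with t ht h1
  have ht : t ≠ 0 := ht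
  have : t⁻¹ * a + b = (a + t * b) / t := by field_simp
  rw [this]
  field_simp
  ring

lemma oneExp_aCoef {x : Fin N → ℂ} (hx : Reg x) (u : SIdx N) :
    OneExp (fun h => aCoef m u (h⁻¹ • x)) (-cCoef m u x) := by
  obtain ⟨h1, -, h3⟩ := reg_iff.1 hx
  have e1 := oneExp_fac (h1 u) 0 m.m1
  have e2 := oneExp_fac (h1 u) (1 / 2) m.m2
  have e3 : ∀ w, OneExp (fun h => pairFactor m u w (h⁻¹ • x))
      (-(if w.1 = u.1 then 0 else m.m3 / (coord u x - coord w x))) := by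
    intro w
    by_cases hw : w.1 = u.1
    · simpa [pairFactor, hw] using OneExp.one
    · have := oneExp_fac (h3 u w (Ne.symm hw)) 0 m.m3
      simpa [pairFactor, hw, mul_sub] using this
  have := (e1.mul e2).mul (OneExp.prod Finset.univ fun w _ => e3 w)
  unfold OneExp at this ⊢
  convert this using 2 with t
  · simp [aCoef]
  · simp [cCoef]; ring

lemma tendsto_diffOp_scaled (q : MvPolynomial (Fin N) ℂ) {x : Fin N → ℂ} (hx : Reg x) :
    Tendsto (fun h : ℂ => (∑ u, aCoef m u (h⁻¹ • x) * (eval (x + h • vec u) q - eval x q)) / h ^ 2)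
      (𝓝[≠] 0) (𝓝 (calOp m q x)) := by
  obtain ⟨A, hA⟩ : ∃ A : SIdx N → ℂ → ℂ, ∀ u h,
    A u h = aCoef m u (h⁻¹ • x) * (eval (x + h • vec u) q - eval x q) := ⟨_, fun _ _ => rfl⟩
  simp only [← hA]
  have h1 : ∀ u, Tendsto (fun h => (A u h - h * eval x (dD (vec u) q)) / h ^ 2) (𝓝[≠] 0)
      (𝓝 (eval x (dD (vec u) (dD (vec u) q)) / 2 - cCoef m u x * eval x (dD (vec u) q))) := by
    intro u
    have e1 := tendsto_taylor_two q x (vec u)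
    have e2 : Tendsto (fun h : ℂ => (aCoef m u (h⁻¹ • x) - 1) / h) (𝓝[≠] 0)
      (𝓝 (-cCoef m u x)) := oneExp_aCoef hx u
    have e3 := e1.add (e2.mul (tendsto_slope_line q x (vec u)))
    rw [neg_mul, ← sub_eq_add_neg] at e3
    refine e3.congr' ?_
    filter_upwards [self_mem_nhdsWithin] with t ht
    have ht : t ≠ 0 := ht
    simp only [hA]
    generalize aCoef m u (t⁻¹ • x) = a
    generalize eval (x + t • vec u) q = b
    field_simp
    ring
  have h2 : ∀ u h, A (opp u) h = A u (-h) := by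
    intro u h
    simp only [hA, aCoef_opp, vec_opp, smul_neg, neg_smul, inv_neg]
  have h3 : ∀ h, ∑ u, A u (-h) = ∑ u, A u h := by
    intro h
    simp only [← h2]
    exact Equiv.sum_comp (Function.Involutive.toPerm opp (fun u : SIdx N => opp_opp u))
      fun u => A u h
  have h4 := tendsto_finsetSum Finset.univ fun u _ => ((h1 u).add (tendsto_comp_neg (h1 u)))
  have h5 := h4.const_mul (1 / 2)
  have e : 1 / 2 * ∑ u : SIdx N, (eval x (dD (vec u) (dD (vec u) q)) / 2
      - cCoef m u x * eval x (dD (vec u) q) + (eval x (dD (vec u) (dD (vec u) q)) / 2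
      - cCoef m u x * eval x (dD (vec u) q))) = calOp m q x := by
    rw [Finset.sum_add_distrib, calOp]
    ring
  rw [e] at h5
  refine h5.congr fun t => ?_
  have e2 : ∀ u, (A u t - t * eval x (dD (vec u) q)) / t ^ 2
      + (A u (-t) - -t * eval x (dD (vec u) q)) / (-t) ^ 2 = (A u t + A u (-t)) / t ^ 2 := by
    intro u
    rw [neg_sq]
    ring
  simp only [e2]
  rw [← Finset.sum_div, Finset.sum_add_distrib, h3]
  ring

lemma diffOp_smul_scaled {p : MvPolynomial (Fin N) ℂ} {n : ℕ} (hp : p.totalDegree ≤ n)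
    (x : Fin N → ℂ) {h : ℂ} (hh : h ≠ 0) :
    h ^ n * diffOp m p (h⁻¹ • x) = ∑ k ∈ Finset.range (n + 1), h ^ (n - k) *
      ∑ u, aCoef m u (h⁻¹ • x) * (eval (x + h • vec u) (homogeneousComponent k p)
        - eval x (homogeneousComponent k p)) := by
  have e : ∀ u : SIdx N, h⁻¹ • x + vec u = h⁻¹ • (x + h • vec u) := by
    intro u
    rw [smul_add, smul_smul, inv_mul_cancel₀ hh, one_smul]
  calc h ^ n * diffOp m p (h⁻¹ • x)
      = ∑ u, aCoef m u (h⁻¹ • x) * (h ^ n * eval (h⁻¹ • (x + h • vec u)) p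
          - h ^ n * eval (h⁻¹ • x) p) := by
        rw [diffOp, Finset.mul_sum]
        exact Finset.sum_congr rfl fun u _ => by rw [e]; ring
    _ = _ := by
        simp only [pow_mul_eval_inv_smul hp _ hh, ← Finset.sum_sub_distrib, Finset.mul_sum]
        rw [Finset.sum_comm]
        exact Finset.sum_congr rfl fun k _ => Finset.sum_congr rfl fun u _ => by ring

/-- The leading part of the difference operator is the differential operator. -/
lemma tendsto_diffOp_leading {p : MvPolynomial (Fin N) ℂ} {n : ℕ} (hp : p.totalDegree ≤ n)
    {x : Fin N → ℂ} (hx : Reg x) :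
    Tendsto (fun h : ℂ => h ^ n * diffOp m p (h⁻¹ • x) / h ^ 2) (𝓝[≠] 0)
      (𝓝 (calOp m (homogeneousComponent n p) x)) := by
  have h1 := tendsto_finsetSum (Finset.range (n + 1)) fun k _ =>
    ((((continuous_pow (n - k)).tendsto (0 : ℂ)).mono_left
      (nhdsWithin_le_nhds (s := {0}ᶜ))).mul
      (tendsto_diffOp_scaled (m := m) (homogeneousComponent k p) hx))
  rw [Finset.sum_range_succ, Finset.sum_eq_zero] at h1
  · simp only [zero_add, Nat.sub_self, pow_zero, one_mul] at h1
    refine h1.congr' ?_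
    filter_upwards [self_mem_nhdsWithin] with h hh
    rw [diffOp_smul_scaled hp x hh, Finset.sum_div]
    exact Finset.sum_congr rfl fun k _ => by ring
  · intro k hk
    have : n - k ≠ 0 := by have := Finset.mem_range.1 hk; omega
    simp [this]

end Leading

/-- The multiplicity function of the rational quasi-invariants. -/
def Mult.mult (m : Mult) : Root N → ℕ
  | .inl _ => m.m1 + m.m2
  | .inr _ => m.m3

lemma Root.actP_mul (ρ : Root N) (p q : MvPolynomial (Fin N) ℂ) :
    ρ.actP (p * q) = ρ.actP p * ρ.actP q := by simp [actP]
lemma Root.actP_pow (ρ : Root N) (p : MvPolynomial (Fin N) ℂ) (n : ℕ) :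
    ρ.actP (p ^ n) = ρ.actP p ^ n := by simp [actP]
lemma Root.actP_add (ρ : Root N) (p q : MvPolynomial (Fin N) ℂ) :
    ρ.actP (p + q) = ρ.actP p + ρ.actP q := by simp [actP]
lemma Root.actP_sub (ρ : Root N) (p q : MvPolynomial (Fin N) ℂ) :
    ρ.actP (p - q) = ρ.actP p - ρ.actP q := by simp [actP]
lemma Root.actP_smul (ρ : Root N) (c : ℂ) (p : MvPolynomial (Fin N) ℂ) :
    ρ.actP (c • p) = c • ρ.actP p := by simp [actP]
lemma Root.actP_actP (ρ : Root N) (p : MvPolynomial (Fin N) ℂ) : ρ.actP (ρ.actP p) = p := by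
  apply MvPolynomial.funext
  intro x
  rw [eval_actP, eval_actP, act_act]
lemma Root.actP_lin (ρ : Root N) : ρ.actP ρ.lin = -ρ.lin := by
  apply MvPolynomial.funext
  intro x
  rw [eval_actP, eval_lin_act, map_neg]

/-- Rational quasi-invariants. -/
def Qinv (N : ℕ) (m : Mult) : Submodule ℂ (MvPolynomial (Fin N) ℂ) where
  carrier := {q | ∀ ρ : Root N, ρ.lin ^ (2 * m.mult ρ) ∣ q - ρ.actP q}
  zero_mem' := fun ρ => by simp [Root.actP]
  add_mem' := fun {a b} ha hb ρ => by
    rw [Root.actP_add, add_sub_add_comm]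
    exact dvd_add (ha ρ) (hb ρ)
  smul_mem' := fun c p hp ρ => by
    rw [Root.actP_smul, ← smul_sub]
    exact (hp ρ).trans (Dvd.intro (C c) (by rw [mul_comm, C_mul']))

lemma eval_dD_actP (ρ : Root N) (u : SIdx N) (q : MvPolynomial (Fin N) ℂ) (x : Fin N → ℂ) :
    eval x (dD (vec u) (ρ.actP q)) = eval (ρ.act x) (dD (vec (ρ.perm u)) q) := by
  refine tendsto_nhds_unique (tendsto_slope_line (ρ.actP q) x (vec u))
    ((tendsto_slope_line q (ρ.act x) (vec (ρ.perm u))).congr fun t => ?_)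
  rw [Root.eval_actP, Root.eval_actP, Root.act_add_smul, Root.act_vec]

lemma cCoef_act (ρ : Root N) (u : SIdx N) (x : Fin N → ℂ) :
    cCoef m (ρ.perm u) (ρ.act x) = cCoef m u x := by
  unfold cCoef
  rw [Root.coord_act, Root.perm_perm, ← ρ.sum_perm]
  congr 1
  refine Finset.sum_congr rfl fun w _ => ?_
  simp only [Root.coord_act, Root.perm_perm, Root.perm_fst_eq_iff]

lemma dD_actP (ρ : Root N) (u : SIdx N) (q : MvPolynomial (Fin N) ℂ) :
    dD (vec u) (ρ.actP q) = ρ.actP (dD (vec (ρ.perm u)) q) := by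
  apply MvPolynomial.funext
  intro x
  rw [eval_dD_actP, Root.eval_actP]

lemma calOp_actP (ρ : Root N) (q : MvPolynomial (Fin N) ℂ) (x : Fin N → ℂ) :
    calOp m (ρ.actP q) x = calOp m q (ρ.act x) := by
  unfold calOp
  conv_rhs => rw [← ρ.sum_perm]
  refine Finset.sum_congr rfl fun u _ => ?_
  rw [dD_actP, dD_actP, Root.eval_actP, Root.eval_actP, cCoef_act]

lemma calOp_sub (p q : MvPolynomial (Fin N) ℂ) (x : Fin N → ℂ) :
    calOp m (p - q) x = calOp m p x - calOp m q x := by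
  unfold calOp
  rw [← Finset.sum_sub_distrib]
  refine Finset.sum_congr rfl fun u _ => ?_
  simp only [map_sub]
  ring

lemma calOp_add (p q : MvPolynomial (Fin N) ℂ) (x : Fin N → ℂ) :
    calOp m (p + q) x = calOp m p x + calOp m q x := by
  unfold calOp
  rw [← Finset.sum_add_distrib]
  refine Finset.sum_congr rfl fun u _ => ?_
  simp only [map_add]
  ring

lemma calOp_smul (c : ℂ) (q : MvPolynomial (Fin N) ℂ) (x : Fin N → ℂ) :
    calOp m (c • q) x = c * calOp m q x := by
  unfold calOp
  rw [Finset.mul_sum]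
  refine Finset.sum_congr rfl fun u _ => ?_
  simp only [Derivation.map_smul, smul_eval]
  ring

lemma isRat_calOp (q : MvPolynomial (Fin N) ℂ) : IsRat (den N) (calOp m q) := by
  unfold calOp
  refine IsRat.sum _ fun u _ => IsRat.sub ?_ (IsRat.mul ?_ (IsRat.of_poly _))
  · simpa [div_eq_mul_inv] using
      (IsRat.of_poly (den := den N) (dD (vec u) (dD (vec u) q))).mul (IsRat.const 2⁻¹)
  · unfold cCoef
    refine IsRat.add ?_ (IsRat.sum _ fun w _ => ?_)
    · simpa [Form.poly, Root.lin] using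
        IsRat.div_of_dvd (dvd_den (.inl (.inl u))) ((m.m1 : ℂ) + m.m2)
    · by_cases h : w.1 = u.1
      · simpa [h] using IsRat.const 0
      · simp only [h, if_false]
        simpa [Form.poly, Root.lin] using
          IsRat.div_of_dvd (dvd_den (.inl (.inr ⟨(u, w), Ne.symm h⟩))) (m.m3 : ℂ)

lemma tendsto_pair_residue {ρ : Root N} {x : Fin N → ℂ} (h : Gen ρ 0 x) (u w : SIdx N) :
    Tendsto (fun t : ℂ => t * (if w.1 = u.1 then (0 : ℂ) else
      m.m3 / (coord u (x + t • ρ.dir) - coord w (x + t • ρ.dir)))) (𝓝[≠] 0)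
      (𝓝 (if w = ρ.perm u ∧ w.1 ≠ u.1 then m.m3 / (2 * coord u ρ.dir) else 0)) := by
  by_cases hw : w.1 = u.1
  · simp [hw]
  simp only [hw, if_false, not_false_eq_true, and_true, ne_eq]
  by_cases h0 : coord u x - coord w x = 0
  · obtain ⟨h1, h2⟩ := h.coord_dir_ne_zero_of_diff (Ne.symm hw) h0
    rw [if_pos (h.diff u w (Ne.symm hw) h0).2]
    refine (tendsto_mul_div_affine (mul_ne_zero two_ne_zero h1) _).congr fun t => ?_
    simp only [coord_add, coord_smul, h2]
    congr 2
    linear_combination -h0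
  · rw [if_neg]
    · refine tendsto_mul_of_tendsto
        ((tendsto_div_affine h0 (coord u ρ.dir - coord w ρ.dir) (m.m3 : ℂ)).congr fun t => ?_)
      simp only [coord_add, coord_smul]
      congr 1
      ring
    · rintro rfl
      rw [← Root.coord_act, Root.act_of_lin_eq_zero ρ h.lin, sub_self] at h0
      exact h0 rfl

lemma tendsto_cCoef_residue {ρ : Root N} {x : Fin N → ℂ} (h : Gen ρ 0 x) (u : SIdx N) :
    Tendsto (fun t : ℂ => t * cCoef m u (x + t • ρ.dir)) (𝓝[≠] 0)
      (𝓝 (m.mult ρ * coord u ρ.dir / ρ.nrm)) := by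
  have h1 := tendsto_finsetSum Finset.univ fun w _ => tendsto_pair_residue (m := m) h u w
  have h2 : ∀ κ : ℂ, Tendsto (fun t : ℂ => t * (κ / coord u (x + t • ρ.dir))) (𝓝[≠] 0)
      (𝓝 (if coord u x = 0 then κ / coord u ρ.dir else 0)) := by
    intro κ
    by_cases h0 : coord u x = 0
    · rw [if_pos h0]
      refine (tendsto_mul_div_affine (h.coord_dir_ne_zero_of_zero h0) κ).congr fun t => ?_
      simp [h0]
    · rw [if_neg h0]
      refine tendsto_mul_of_tendsto
        ((tendsto_div_affine h0 (coord u ρ.dir) κ).congr fun t => ?_)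
      simp
  have h3 := (h2 (m.m1 + m.m2)).add h1
  have e : (if coord u x = 0 then ((m.m1 : ℂ) + m.m2) / coord u ρ.dir else 0)
      + ∑ w, (if w = ρ.perm u ∧ w.1 ≠ u.1 then (m.m3 : ℂ) / (2 * coord u ρ.dir) else 0)
      = m.mult ρ * coord u ρ.dir / ρ.nrm := by
    have hinv : coord u ρ.dir ≠ 0 → 1 / coord u ρ.dir = coord u ρ.dir := by
      intro h0
      rcases ρ.coord_dir_mem u with h4 | h4 | h4
      · exact absurd h4 h0
      · rw [h4]; norm_num
      · rw [h4]; norm_num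
    rcases ρ with v | p
    · rw [Finset.sum_eq_zero]
      · by_cases hu : u.1 = v.1
        · have hv : coord v x = 0 := by simpa [Root.lin] using h.lin
          have h0 : coord u x = 0 := by
            rcases (fst_eq_iff u v).1 hu with rfl | rfl <;> simp [hv]
          have h5 := hinv (h.coord_dir_ne_zero_of_zero h0)
          rw [if_pos h0, add_zero, div_eq_mul_one_div, h5]
          simp [Mult.mult, Root.nrm]
        · have hd : coord u (Root.dir (.inl v)) = 0 := by
            simpa [Root.dir] using coord_vec_of_ne hu
          rw [hd]
          simp
      · intro w _
        rw [if_neg]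
        rintro ⟨rfl, h0⟩
        exact h0 (Root.perm_inl_fst v u)
    · have h0 : coord u x ≠ 0 := fun h0 => Root.perm_inr_ne_opp p u (h.zero u h0).2
      rw [if_neg h0, zero_add]
      by_cases hd : coord u (Root.dir (.inr p)) = 0
      · simp [hd]
      · rw [Finset.sum_eq_single (Root.perm (.inr p) u)]
        · rw [if_pos]
          · rw [mul_comm (2 : ℂ), ← div_div, div_eq_mul_one_div (m.m3 : ℂ), hinv hd]
            simp [Mult.mult, Root.nrm]
          · refine ⟨rfl, fun e => ?_⟩
            rcases (fst_eq_iff _ _).1 e with e | e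
            · exact hd ((Root.perm_eq_self_iff _ u).1 e)
            · exact Root.perm_inr_ne_opp p u e
        · intro w _ hw
          rw [if_neg fun h => hw h.1]
        · simp
  rw [e] at h3
  refine h3.congr fun t => ?_
  rw [cCoef, mul_add, Finset.mul_sum]

lemma tendsto_cCoef {u : SIdx N} {x : Fin N → ℂ} (η : Fin N → ℂ) (h0 : coord u x ≠ 0)
    (hd : ∀ w : SIdx N, w.1 ≠ u.1 → coord u x - coord w x ≠ 0) :
    Tendsto (fun t : ℂ => cCoef m u (x + t • η)) (𝓝[≠] 0) (𝓝 (cCoef m u x)) := by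
  unfold cCoef
  refine Tendsto.add ((tendsto_div_affine h0 (coord u η) _).congr fun t => by simp)
    (tendsto_finsetSum _ fun w _ => ?_)
  by_cases hw : w.1 = u.1
  · simp [hw]
  · simp only [hw, if_false]
    refine (tendsto_div_affine (hd w hw) (coord u η - coord w η) _).congr fun t => ?_
    simp only [coord_add, coord_smul]
    congr 1
    ring

lemma eval_dD_sub_actP_eq_zero {q : MvPolynomial (Fin N) ℂ} (hq : q ∈ Qinv N m) {ρ : Root N}
    (h : m.mult ρ ≠ 0) {x : Fin N → ℂ} (hx : eval x ρ.lin = 0) (u : SIdx N) :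
    eval x (dD (vec u) q) - eval x (dD (vec (ρ.perm u)) q) = 0 := by
  have h1 : eval x (dD (vec u) (q - ρ.actP q)) = 0 := by
    obtain ⟨c, hc⟩ := (pow_dvd_pow ρ.lin (by omega : 2 ≤ 2 * m.mult ρ)).trans (hq ρ)
    rw [hc, Derivation.leibniz, sq, Derivation.leibniz]
    simp [hx]
  rw [map_sub, map_sub, eval_dD_actP, Root.act_of_lin_eq_zero ρ hx] at h1
  exact h1

/-- The differential operator maps quasi-invariants to polynomials. -/
lemma exists_poly_calOp {q : MvPolynomial (Fin N) ℂ} (hq : q ∈ Qinv N m) :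
    ∃ r : MvPolynomial (Fin N) ℂ, ∀ x, Reg x → eval x r = calOp m q x := by
  have split : ∀ y, calOp m q y = ∑ u, eval y (dD (vec u) (dD (vec u) q)) / 2
      - ∑ u, cCoef m u y * eval y (dD (vec u) q) := fun y => by
    rw [calOp, Finset.sum_sub_distrib]
  have lap : ∀ x η : Fin N → ℂ, Tendsto (fun t : ℂ =>
      t * ∑ u, eval (x + t • η) (dD (vec u) (dD (vec u) q)) / 2) (𝓝[≠] 0) (𝓝 0) :=
    fun x η => tendsto_mul_of_tendsto
      (tendsto_finsetSum _ fun u _ => (tendsto_eval_line _ x η).div_const 2)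
  refine exists_poly_of_gen (isRat_calOp q) (fun ρ x hx => ?_) (fun v x hx => ?_)
  · have h1 := tendsto_residue_sum ρ (fun u => tendsto_cCoef_residue (m := m) hx u)
      (fun u t => by rw [← Root.act_line ρ hx.lin, cCoef_act])
      (fun u => tendsto_eval_line (dD (vec u) q) x ρ.dir) (fun u => by
        by_cases h : m.mult ρ = 0
        · simp [h]
        · rw [eval_dD_sub_actP_eq_zero hq h hx.lin, mul_zero])
    have h2 := (lap x ρ.dir).sub h1
    rw [sub_zero] at h2
    exact h2.congr fun t => by rw [split, mul_sub]
  · have h1 : ∀ u, Tendsto (fun t : ℂ => cCoef m u (x + t • vec v)) (𝓝[≠] 0)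
        (𝓝 (cCoef m u x)) := by
      intro u
      refine tendsto_cCoef (vec v) (fun h0 => ?_) (fun w hw h0 => ?_)
      · have := (hx.zero u h0).1; norm_num at this
      · have := (hx.diff u w (Ne.symm hw) h0).1; norm_num at this
    have h2 := (lap x (vec v)).sub (tendsto_mul_of_tendsto (tendsto_finsetSum Finset.univ
      fun u _ => (h1 u).mul (tendsto_eval_line (dD (vec u) q) x (vec v))))
    rw [sub_zero] at h2
    exact h2.congr fun t => by rw [split, mul_sub]

lemma dD_lin (ρ : Root N) (u : SIdx N) : dD (vec u) ρ.lin = C (coord u ρ.dir) := by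
  have hY : ∀ v : SIdx N, dD (vec u) (Y v) = C (coord v (vec u)) := by
    intro v
    simp [Y, Derivation.leibniz, coord]
  rcases ρ with v | p
  · simp [Root.lin, Root.dir, hY, coord_vec_comm]
  · simp [Root.lin, Root.dir, hY, coord_vec_comm u]

/-- An odd polynomial divisible by an even power of a root is divisible by one more power. -/
lemma exists_odd_factor {ρ : Root N} {g : MvPolynomial (Fin N) ℂ} {k : ℕ}
    (hodd : ρ.actP g = -g) (hdvd : ρ.lin ^ (2 * k) ∣ g) : ∃ f, g = ρ.lin ^ (2 * k + 1) * f := by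
  obtain ⟨h, rfl⟩ := hdvd
  have h1 : ρ.actP h = -h := by
    rw [Root.actP_mul, Root.actP_pow, Root.actP_lin, Even.neg_pow (by simp)] at hodd
    refine mul_left_cancel₀ (pow_ne_zero (2 * k) ρ.affineAlong.ne_zero) ?_
    rw [hodd]
    ring
  obtain ⟨f, rfl⟩ : ρ.lin ∣ h := by
    refine ρ.affineAlong.dvd_of_vanish fun x hx => ?_
    have h2 := congrArg (eval x) h1
    rw [Root.eval_actP, Root.act_of_lin_eq_zero ρ hx, map_neg] at h2
    linear_combination h2 / 2
  exact ⟨f, by ring⟩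

/-- The differential operator preserves quasi-invariance. -/
lemma calOp_mem_Qinv {q r : MvPolynomial (Fin N) ℂ} (hq : q ∈ Qinv N m)
    (hr : ∀ x, Reg x → eval x r = calOp m q x) : r ∈ Qinv N m := by
  intro ρ
  rcases Nat.eq_zero_or_pos (m.mult ρ) with h0 | hpos
  · simp [h0]
  obtain ⟨k, hk⟩ : ∃ k, m.mult ρ = k + 1 := ⟨m.mult ρ - 1, by omega⟩
  obtain ⟨f, hf⟩ := exists_odd_factor (ρ := ρ) (g := q - ρ.actP q)
    (by rw [Root.actP_sub, Root.actP_actP, neg_sub]) (hq ρ)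
  refine pow_dvd_of_gen ρ _ fun x hx j hj => ?_
  have hν := ρ.nrm_ne_zero
  have hlin : ∀ t : ℂ, eval (x + t • ρ.dir) ρ.lin = t * ρ.nrm := fun t => by
    rw [Root.eval_lin_line, hx.lin, zero_add]
  have hreg : ∀ y, Reg y → eval y (r - ρ.actP r) = calOp m (ρ.lin ^ (2 * k + 3) * f) y := by
    intro y hy
    rw [eval_sub_actP, hr y hy, hr _ (hy.act ρ), ← calOp_actP, ← calOp_sub, hf, hk, show 2 * (k + 1) + 1 = 2 * k + 3 by ring]
  set n : ℂ := 2 * k + 3 with hn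
  let B : SIdx N → ℂ → ℂ := fun u t =>
    n * (n - 1) / 2 * coord u ρ.dir ^ 2 * eval (x + t • ρ.dir) f
    + (t * (n * ρ.nrm * coord u ρ.dir * eval (x + t • ρ.dir) (dD (vec u) f))
    + t ^ 2 * (ρ.nrm ^ 2 / 2 * eval (x + t • ρ.dir) (dD (vec u) (dD (vec u) f))))
    - ((t * cCoef m u (x + t • ρ.dir)) * (n * ρ.nrm * coord u ρ.dir * eval (x + t • ρ.dir) f)
    + (t * cCoef m u (x + t • ρ.dir)) * (t * (ρ.nrm ^ 2 * eval (x + t • ρ.dir) (dD (vec u) f))))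
  have hcal : ∀ t : ℂ, calOp m (ρ.lin ^ (2 * k + 3) * f) (x + t • ρ.dir)
      = (t * ρ.nrm) ^ (2 * k + 1) * ∑ u, B u t := by
    intro t
    rw [calOp, Finset.mul_sum]
    refine Finset.sum_congr rfl fun u _ => ?_
    simp only [B, Derivation.leibniz, Derivation.leibniz_pow, dD_lin, map_add, map_mul, map_pow,
      smul_eq_mul, nsmul_eq_mul, dD_C, hlin, eval_C, map_natCast, Derivation.map_natCast]
    have e1 : 2 * k + 3 - 1 = 2 * k + 2 := by omega
    have e2 : 2 * k + 2 - 1 = 2 * k + 1 := by omega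
    simp only [e1, e2, hn, map_zero]
    push_cast
    ring
  have hc : ∀ (η : Fin N → ℂ) (p : MvPolynomial (Fin N) ℂ),
      Tendsto (fun t : ℂ => eval (x + t • η) p) (𝓝[≠] 0) (𝓝 (eval x p)) :=
    fun η p => tendsto_eval_line p x η
  have hB : ∀ u, Tendsto (B u) (𝓝[≠] 0) (𝓝 (n * (n - 1) / 2 * coord u ρ.dir ^ 2 * eval x f
      + (0 + 0) - (m.mult ρ * coord u ρ.dir / ρ.nrm * (n * ρ.nrm * coord u ρ.dir * eval x f)
        + m.mult ρ * coord u ρ.dir / ρ.nrm * 0))) := by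
    intro u
    have hR := tendsto_cCoef_residue (m := m) hx u
    refine (((hc ρ.dir f).const_mul _).add ((tendsto_mul_of_tendsto
      ((hc ρ.dir _).const_mul _)).add ?_)).sub ((hR.mul ((hc ρ.dir f).const_mul _)).add
        (hR.mul (tendsto_mul_of_tendsto ((hc ρ.dir _).const_mul _))))
    have := tendsto_mul_of_tendsto (tendsto_mul_of_tendsto
      ((hc ρ.dir (dD (vec u) (dD (vec u) f))).const_mul (ρ.nrm ^ 2 / 2)))
    exact this.congr fun t => by ring
  have hsum := tendsto_finsetSum Finset.univ fun u _ => hB u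
  have hzero : ∑ u : SIdx N, (n * (n - 1) / 2 * coord u ρ.dir ^ 2 * eval x f
      + (0 + 0) - (m.mult ρ * coord u ρ.dir / ρ.nrm * (n * ρ.nrm * coord u ρ.dir * eval x f)
        + m.mult ρ * coord u ρ.dir / ρ.nrm * 0)) = 0 := by
    refine Finset.sum_eq_zero fun u _ => ?_
    rw [hk, hn]
    push_cast
    field_simp
    ring
  rw [hzero] at hsum
  have h1 : Tendsto (fun t : ℂ => t ^ (2 * k + 1 - j) * (ρ.nrm ^ (2 * k + 1) * ∑ u, B u t))
      (𝓝[≠] 0) (𝓝 (0 ^ (2 * k + 1 - j) * (ρ.nrm ^ (2 * k + 1) * 0))) :=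
    (((continuous_pow _).tendsto 0).mono_left nhdsWithin_le_nhds).mul (hsum.const_mul _)
  rw [mul_zero, mul_zero] at h1
  refine h1.congr' ?_
  filter_upwards [self_mem_nhdsWithin, hx.eventually_reg] with t ht hreg'
  have ht : t ≠ 0 := ht
  rw [hreg _ hreg', hcal, mul_pow, pow_sub₀ _ ht (by omega)]
  field_simp

lemma Reg.eventually_inv_smul {x : Fin N → ℂ} (hx : Reg x) :
    ∀ᶠ h : ℂ in 𝓝[≠] 0, Reg (h⁻¹ • x) := by
  rw [reg_iff] at hx
  have h1 : ∀ᶠ h : ℂ in 𝓝[≠] 0, ∀ u : SIdx N, h ≠ -2 * coord u x := by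
    rw [eventually_all]
    intro u
    refine nhdsWithin_le_nhds (isOpen_ne.mem_nhds ?_)
    exact (mul_ne_zero (by norm_num) (hx.1 u)).symm
  filter_upwards [h1, self_mem_nhdsWithin] with h hh h0
  have h0 : h ≠ 0 := h0
  rw [reg_iff]
  simp only [coord_smul, ← mul_sub]
  refine ⟨fun u => mul_ne_zero (inv_ne_zero h0) (hx.1 u), fun u hu => hh u ?_,
    fun u w huw => mul_ne_zero (inv_ne_zero h0) (hx.2.2 u w huw)⟩
  field_simp at hu
  linear_combination hu

lemma scale_dD {q : MvPolynomial (Fin N) ℂ} {a n : ℕ} {c : ℂ} (hc : c ≠ 0)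
    (hq : ∀ x, c ^ a * eval (c • x) q = c ^ n * eval x q) (η x : Fin N → ℂ) :
    c ^ (a + 1) * eval (c • x) (dD η q) = c ^ n * eval x (dD η q) := by
  have hmul : Tendsto (fun t : ℂ => c * t) (𝓝[≠] 0) (𝓝[≠] 0) := by
    refine tendsto_nhdsWithin_iff.2 ⟨?_, ?_⟩
    · have : Continuous fun t : ℂ => c * t := by fun_prop
      simpa using (this.tendsto 0).mono_left (nhdsWithin_le_nhds (s := {0}ᶜ))
    · filter_upwards [self_mem_nhdsWithin] with t ht using mul_ne_zero hc ht
  refine tendsto_nhds_unique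
    (((tendsto_slope_line q (c • x) η).comp hmul).const_mul (c ^ (a + 1)))
    (((tendsto_slope_line q x η).const_mul (c ^ n)).congr fun t => ?_)
  have e : c • x + (c * t) • η = c • (x + t • η) := by rw [smul_add, smul_smul]
  rw [Function.comp_apply, e, ← mul_div_assoc, mul_sub, ← hq, ← hq, ← mul_sub, pow_succ]
  field_simp

lemma cCoef_inv_smul (u : SIdx N) (x : Fin N → ℂ) (h : ℂ) :
    cCoef m u (h⁻¹ • x) = h * cCoef m u x := by
  have key : ∀ a b : ℂ, a / (h⁻¹ * b) = h * (a / b) := fun a b => by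
    rw [div_mul_eq_div_div, div_inv_eq_mul]; ring
  simp only [cCoef, coord_smul, ← mul_sub, key, mul_add, Finset.mul_sum, mul_ite, mul_zero]

lemma calOp_inv_smul {q : MvPolynomial (Fin N) ℂ} {n : ℕ} (hq : q.IsHomogeneous n)
    (x : Fin N → ℂ) {h : ℂ} (hh : h ≠ 0) :
    h ^ n * calOp m q (h⁻¹ • x) / h ^ 2 = calOp m q x := by
  have h0 : ∀ x, h⁻¹ ^ 0 * eval (h⁻¹ • x) q = h⁻¹ ^ n * eval x q := fun x => by
    rw [eval_smul_of_isHomogeneous hq, pow_zero, one_mul]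
  have h1 := fun η => scale_dD (inv_ne_zero hh) h0 η
  have h2 := fun η => scale_dD (inv_ne_zero hh) (h1 η) η
  rw [calOp, calOp, Finset.mul_sum, Finset.sum_div]
  refine Finset.sum_congr rfl fun u _ => ?_
  have e1 := h1 (vec u) x
  have e2 := h2 (vec u) x
  simp only [inv_pow, zero_add, pow_one] at e1 e2
  norm_num at e2
  rw [cCoef_inv_smul]
  field_simp at e1 e2 ⊢
  linear_combination e2 - 2 * cCoef m u x * h * e1

/-- The operator `calOp` on quasi-invariants. -/
def calLin (N : ℕ) (m : Mult) : Qinv N m →ₗ[ℂ] Qinv N m where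
  toFun q := ⟨(exists_poly_calOp q.2).choose, calOp_mem_Qinv q.2 (exists_poly_calOp q.2).choose_spec⟩
  map_add' p q := by
    refine Subtype.ext (eq_of_eval_eq_off den_ne_zero fun x hx => ?_)
    have h1 := (exists_poly_calOp (p + q).2).choose_spec x hx
    have h2 := (exists_poly_calOp p.2).choose_spec x hx
    have h3 := (exists_poly_calOp q.2).choose_spec x hx
    simp only [Submodule.coe_add, map_add] at h1 h2 h3 ⊢
    rw [h1, h2, h3, calOp_add]
  map_smul' c q := by
    refine Subtype.ext (eq_of_eval_eq_off den_ne_zero fun x hx => ?_)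
    have h1 := (exists_poly_calOp (c • q).2).choose_spec x hx
    have h2 := (exists_poly_calOp q.2).choose_spec x hx
    simp only [Submodule.coe_smul, smul_eval, RingHom.id_apply] at h1 h2 ⊢
    rw [h1, h2, calOp_smul]

lemma eval_calLin (q : Qinv N m) {x : Fin N → ℂ} (hx : Reg x) :
    eval x (calLin N m q : MvPolynomial (Fin N) ℂ) = calOp m q x :=
  (exists_poly_calOp q.2).choose_spec x hx

lemma tendsto_calLin {q : Qinv N m} {n : ℕ} (hq : (q : MvPolynomial (Fin N) ℂ).IsHomogeneous n)
    {x : Fin N → ℂ} (hx : Reg x) :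
    Tendsto (fun h : ℂ => h ^ n * eval (h⁻¹ • x) (calLin N m q : MvPolynomial (Fin N) ℂ) / h ^ 2)
      (𝓝[≠] 0) (𝓝 (calOp m q x)) := by
  refine tendsto_const_nhds.congr' ?_
  filter_upwards [hx.eventually_inv_smul, self_mem_nhdsWithin] with h h1 h2
  rw [eval_calLin q h1, calOp_inv_smul hq x h2]

lemma calLin_eq_zero {q : Qinv N m} {n : ℕ} (hn : n < 2)
    (hq : (q : MvPolynomial (Fin N) ℂ).IsHomogeneous n) : calLin N m q = 0 :=
  Subtype.ext (eq_zero_of_scale_sq den_ne_zero hn fun _ hx => tendsto_calLin hq hx)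

lemma eq_homogeneousComponent_of_scale {r P : MvPolynomial (Fin N) ℂ} {n : ℕ}
    (h : ∀ x, Reg x → Tendsto (fun h : ℂ => h ^ (n + 2) * eval (h⁻¹ • x) r / h ^ 2) (𝓝[≠] 0)
      (𝓝 (eval x P))) : r.totalDegree ≤ n ∧ homogeneousComponent n r = P := by
  obtain ⟨h1, h2⟩ := ScaleLim.eq_eval (F := fun x => eval x P) den_ne_zero
    fun x hx => scaleLim_of_scale_sq (h x hx)
  exact ⟨h1, eq_of_eval_eq_off den_ne_zero h2⟩

lemma calLin_isHomogeneous {q : Qinv N m} {n : ℕ}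
    (hq : (q : MvPolynomial (Fin N) ℂ).IsHomogeneous (n + 2)) :
    (calLin N m q : MvPolynomial (Fin N) ℂ).IsHomogeneous n := by
  have := (eq_homogeneousComponent_of_scale (r := (calLin N m q : MvPolynomial (Fin N) ℂ))
    (P := calLin N m q) (n := n) fun x hx => by
      rw [eval_calLin q hx]; exact tendsto_calLin hq hx).2
  rw [← this]
  exact homogeneousComponent_isHomogeneous n _

/-- Top-degree parts, in degree `n`, of trigonometric quasi-invariants. -/
def Gr (N : ℕ) (m : Mult) (n : ℕ) : Submodule ℂ (MvPolynomial (Fin N) ℂ) :=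
  (Qtr N m ⊓ restrictTotalDegree (Fin N) ℂ n).map (homogeneousComponent n)

lemma mem_Gr {n : ℕ} {P : MvPolynomial (Fin N) ℂ} : P ∈ Gr N m n ↔
    ∃ p ∈ Qtr N m, p.totalDegree ≤ n ∧ homogeneousComponent n p = P := by
  simp [Gr, Submodule.mem_map, mem_restrictTotalDegree, and_assoc]

lemma calLin_mem_Gr {q : Qinv N m} {n : ℕ} (hq : (q : MvPolynomial (Fin N) ℂ) ∈ Gr N m (n + 2)) :
    (calLin N m q : MvPolynomial (Fin N) ℂ) ∈ Gr N m n := by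
  rw [mem_Gr] at hq ⊢
  obtain ⟨p, hp, hd, hpq⟩ := hq
  obtain ⟨r, hr⟩ := exists_poly_diffOp hp
  refine ⟨r, diffOp_mem_Qtr hp hr, eq_homogeneousComponent_of_scale fun x hx => ?_⟩
  rw [eval_calLin q hx, ← hpq]
  refine (tendsto_diffOp_leading hd hx).congr' ?_
  filter_upwards [hx.eventually_inv_smul] with h h1
  rw [hr _ h1]

section Ideal

/-- The opposite root. -/
def Root.neg : Root N → Root N
  | .inl v => .inl (opp v)
  | .inr p => .inr ⟨(p.1.2, p.1.1), p.2.symm⟩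

lemma Root.lin_neg (ρ : Root N) : ρ.neg.lin = -ρ.lin := by
  rcases ρ with v | p
  · apply MvPolynomial.funext
    intro x
    simp [Root.neg, Root.lin]
  · simp [Root.neg, Root.lin]

lemma Root.neg_ne (ρ : Root N) : ρ.neg ≠ ρ := by
  intro h
  have h1 := ρ.lin_neg
  rw [h, eq_neg_iff_add_eq_zero, ← two_mul, mul_eq_zero] at h1
  exact ρ.affineAlong.ne_zero (h1.resolve_left two_ne_zero)

lemma Mult.mult_neg (ρ : Root N) : m.mult ρ.neg = m.mult ρ := by
  rcases ρ with v | p <;> rfl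

lemma Mult.IsLevel.neg {ρ : Root N} {σ : ℝ} (h : m.IsLevel ρ σ) : m.IsLevel ρ.neg σ := by
  rcases ρ with v | p <;> exact h

/-- Product of a root shifted by its levels. -/
def levelProd (m : Mult) (ρ : Root N) : MvPolynomial (Fin N) ℂ :=
  match ρ with
  | .inl _ => (∏ s ∈ Finset.range m.m1, (ρ.lin - C (s + 1 : ℂ))) *
      ∏ s ∈ Finset.range m.m2, (ρ.lin - C (s + 1 / 2 : ℂ))
  | .inr _ => ∏ s ∈ Finset.range m.m3, (ρ.lin - C (s + 1 : ℂ))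

lemma eval_levelProd {ρ : Root N} {σ : ℝ} (hσ : m.IsLevel ρ σ) {x : Fin N → ℂ}
    (hx : eval x ρ.lin = σ) : eval x (levelProd m ρ) = 0 := by
  have key : ∀ (M s : ℕ) (c : ℂ), 1 ≤ s → s ≤ M → (σ : ℂ) = (s - 1 : ℕ) + c →
      ∏ t ∈ Finset.range M, (eval x ρ.lin - (t + c)) = 0 := fun M s c h1 h2 h3 =>
    Finset.prod_eq_zero (Finset.mem_range.2 (show s - 1 < M by omega)) (by rw [hx, h3]; ring)
  rcases ρ with v | p
  · rcases hσ with ⟨s, h1, h2, h3⟩ | ⟨s, h1, h2, h3⟩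
    · have := key m.m1 s 1 h1 h2 (by rw [h3, Nat.cast_sub h1]; push_cast; ring)
      simp only [levelProd, map_mul, map_prod, map_sub, eval_C, this, zero_mul]
    · have := key m.m2 s (1 / 2) h1 h2 (by rw [h3, Nat.cast_sub h1]; push_cast; ring)
      simp only [levelProd, map_mul, map_prod, map_sub, eval_C, this, mul_zero]
  · obtain ⟨s, h1, h2, h3⟩ := hσ
    have := key m.m3 s 1 h1 h2 (by rw [h3, Nat.cast_sub h1]; push_cast; ring)
    simp only [levelProd, map_prod, map_sub, eval_C, this]

lemma ScaleLim.mul {k l : ℕ} {p q : MvPolynomial (Fin N) ℂ} {x : Fin N → ℂ} {c d : ℂ}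
    (hp : ScaleLim k p x c) (hq : ScaleLim l q x d) : ScaleLim (k + l) (p * q) x (c * d) :=
  (Tendsto.mul hp hq).congr fun h => by rw [map_mul]; ring

lemma ScaleLim.prod {ι : Type*} (s : Finset ι) {k : ι → ℕ} {p : ι → MvPolynomial (Fin N) ℂ}
    {x : Fin N → ℂ} {c : ι → ℂ} (h : ∀ i ∈ s, ScaleLim (k i) (p i) x (c i)) :
    ScaleLim (∑ i ∈ s, k i) (∏ i ∈ s, p i) x (∏ i ∈ s, c i) := by
  refine (tendsto_finsetProd s h).congr fun t => ?_
  rw [map_prod, Finset.prod_mul_distrib, Finset.prod_pow_eq_pow_sum]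

lemma scaleLim_lin_sub (ρ : Root N) (c : ℂ) (x : Fin N → ℂ) :
    ScaleLim 1 (ρ.lin - C c) x (eval x ρ.lin) := by
  have h1 : Continuous fun h : ℂ => eval x ρ.lin - h * c := by fun_prop
  have h2 := (h1.tendsto 0).mono_left (nhdsWithin_le_nhds (s := {0}ᶜ))
  rw [zero_mul, sub_zero] at h2
  refine h2.congr' ?_
  filter_upwards [self_mem_nhdsWithin] with h hh
  have hh : h ≠ 0 := hh
  rw [map_sub, eval_C, Root.eval_lin_smul]
  field_simp

lemma scaleLim_levelProd (ρ : Root N) (x : Fin N → ℂ) :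
    ScaleLim (m.mult ρ) (levelProd m ρ) x (eval x (ρ.lin ^ m.mult ρ)) := by
  have key : ∀ (M : ℕ) (c : ℂ), ScaleLim M (∏ s ∈ Finset.range M, (ρ.lin - C (s + c))) x
      (eval x ρ.lin ^ M) := fun M c => by
    simpa using ScaleLim.prod (Finset.range M) fun s _ => scaleLim_lin_sub ρ (s + c) x
  rcases ρ with v | p
  · simpa [pow_add, levelProd, Mult.mult] using (key m.m1 1).mul (key m.m2 (1 / 2))
  · simpa [levelProd, Mult.mult] using key m.m3 1

/-- Product of the roots with multiplicities. -/
def rootProd (N : ℕ) (m : Mult) : MvPolynomial (Fin N) ℂ := ∏ ρ : Root N, ρ.lin ^ m.mult ρ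

lemma rootProd_mul_mem_Gr {f : MvPolynomial (Fin N) ℂ} {k : ℕ} (hf : f.IsHomogeneous k) :
    rootProd N m * f ∈ Gr N m ((∑ ρ : Root N, m.mult ρ) + k) := by
  rw [mem_Gr]
  have hlim : ∀ x, ScaleLim ((∑ ρ : Root N, m.mult ρ) + k) ((∏ ρ, levelProd m ρ) * f) x
      (eval x (rootProd N m * f)) := by
    intro x
    rw [rootProd, map_mul, map_prod]
    refine (ScaleLim.prod _ fun ρ _ => scaleLim_levelProd ρ x).mul ?_
    have := scaleLim_homogeneousComponent hf.totalDegree_le x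
    rwa [homogeneousComponent_of_mem hf, if_pos rfl] at this
  obtain ⟨h1, h2⟩ := ScaleLim.eq_eval (g := 1) (F := fun x => eval x (rootProd N m * f))
    one_ne_zero fun x _ => hlim x
  refine ⟨_, ?_, h1, eq_of_eval_eq_off one_ne_zero h2⟩
  intro ρ σ hσ x hx
  have hz : ∀ (τ : Root N) (y : Fin N → ℂ), eval y (levelProd m τ) = 0 →
      eval y ((∏ ρ, levelProd m ρ) * f) = 0 := fun τ y hy => by
    rw [map_mul, map_prod, Finset.prod_eq_zero (Finset.mem_univ τ) hy, zero_mul]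
  rw [hz ρ x (eval_levelProd hσ hx), hz ρ.neg _ (eval_levelProd hσ.neg _)]
  rw [Root.lin_neg, map_neg, Root.eval_lin_act, neg_neg, hx]

lemma rootProd_mul_mem_Qinv (f : MvPolynomial (Fin N) ℂ) : rootProd N m * f ∈ Qinv N m := by
  intro ρ
  have h1 : ρ.lin ^ (2 * m.mult ρ) ∣ rootProd N m * f := by
    refine Dvd.dvd.mul_right ?_ f
    have := Finset.prod_dvd_prod_of_subset {ρ, ρ.neg} Finset.univ
      (fun τ : Root N => τ.lin ^ m.mult τ) (Finset.subset_univ _)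
    rw [Finset.prod_pair ρ.neg_ne.symm, Root.lin_neg, Mult.mult_neg] at this
    refine Dvd.dvd.trans ?_ this
    rw [← mul_pow, pow_mul]
    exact pow_dvd_pow_of_dvd ⟨-1, by ring⟩ _
  refine dvd_sub h1 ?_
  obtain ⟨g, hg⟩ := h1
  rw [hg, Root.actP_mul, Root.actP_pow, Root.actP_lin, Even.neg_pow (by simp)]
  exact Dvd.intro _ rfl

end Ideal

section Weight

/-- Exponents of the density: each long root direction is used half as often as in `rootProd`. -/
def Mult.half (m : Mult) : Root N → ℕ
  | .inl _ => m.m1 + m.m2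
  | .inr p => if p.1.1.2 then m.m3 else 0

/-- The denominator of the weight. -/
def weightPoly (N : ℕ) (m : Mult) : MvPolynomial (Fin N) ℂ := ∏ ρ : Root N, ρ.lin ^ m.half ρ

lemma weightPoly_dvd_rootProd : weightPoly N m ∣ rootProd N m := by
  refine Finset.prod_dvd_prod_of_dvd _ _ fun ρ _ => pow_dvd_pow _ ?_
  rcases ρ with v | p
  · exact le_rfl
  · simp only [Mult.half, Mult.mult]
    split_ifs <;> simp

lemma rootProd_ne_zero : rootProd N m ≠ 0 :=
  Finset.prod_ne_zero_iff.2 fun ρ _ => pow_ne_zero _ ρ.affineAlong.ne_zero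

lemma Reg.eval_lin_ne_zero {x : Fin N → ℂ} (hx : Reg x) (ρ : Root N) : eval x ρ.lin ≠ 0 := by
  rw [reg_iff] at hx
  rcases ρ with v | p
  · simpa [Root.lin] using hx.1 v
  · simpa [Root.lin] using hx.2.2 _ _ p.2

lemma eval_dD_prod_lin_pow {x : Fin N → ℂ} (hx : Reg x) (u : SIdx N) (e : Root N → ℕ)
    (s : Finset (Root N)) :
    eval x (dD (vec u) (∏ ρ ∈ s, ρ.lin ^ e ρ))
      = (∑ ρ ∈ s, e ρ * coord u ρ.dir / eval x ρ.lin) * eval x (∏ ρ ∈ s, ρ.lin ^ e ρ) := by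
  classical
  induction s using Finset.induction_on with
  | empty => simp
  | insert ρ s hρ ih =>
    have h0 := hx.eval_lin_ne_zero ρ
    rw [Finset.prod_insert hρ, Finset.sum_insert hρ, Derivation.leibniz, Derivation.leibniz_pow,
      dD_lin]
    simp only [smul_eq_mul, nsmul_eq_mul, map_add, map_mul, map_pow, eval_C, map_natCast, ih]
    rcases Nat.eq_zero_or_pos (e ρ) with h | h
    · simp [h]
    · have : eval x ρ.lin ^ e ρ = eval x ρ.lin ^ (e ρ - 1) * eval x ρ.lin := by
        rw [← pow_succ]; congr 1; omega
      rw [this]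
      field_simp
      ring

lemma sum_half (u : SIdx N) (x : Fin N → ℂ) :
    ∑ ρ : Root N, m.half ρ * coord u ρ.dir / eval x ρ.lin = 2 * cCoef m u x := by
  classical
  let a : SIdx N → ℂ := fun v => coord u (vec v)
  let t : SIdx N → SIdx N → ℂ := fun v w =>
    if w.1 = v.1 then 0 else m.m3 / (coord v x - coord w x)
  let D : SIdx N → ℂ := fun v => ∑ w, t v w
  have hopp : ∀ f : SIdx N → ℂ, ∑ w, f (opp w) = ∑ w, f w := fun f =>
    Equiv.sum_comp ⟨opp, opp, opp_opp, opp_opp⟩ f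
  have ha : ∀ v, a (opp v) = -a v := fun v => by
    simp only [a]; rw [coord_vec_comm, coord_opp, coord_vec_comm]
  have ht : ∀ v w, t (opp v) (opp w) = -t v w := fun v w => by
    by_cases h : w.1 = v.1
    · simp [t, h]
    · simp only [t, opp_fst, h, if_false, coord_opp]
      rw [← div_neg]; congr 1; ring
  have ht' : ∀ v w, t w v = -t v w := fun v w => by
    by_cases h : w.1 = v.1
    · simp [t, h]
    · simp only [t, h, Ne.symm h, if_false]
      rw [← div_neg]; congr 1; ring
  have hD : ∀ v, D (opp v) = -D v := fun v => by
    simp only [D]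
    rw [← hopp, ← Finset.sum_neg_distrib]
    exact Finset.sum_congr rfl fun w _ => ht v w
  have hval : ∀ f : SIdx N → ℂ, (∀ v, f (opp v) = f v) → ∑ v, a v * a v * f v = 2 * f u := by
    intro f hf
    rw [sum_sidx, Finset.sum_eq_single u.1]
    · have h1 : ∀ b, f (u.1, b) = f u := fun b => by
        rcases (fst_eq_iff (u.1, b) u).1 rfl with h | h
        · rw [h]
        · rw [h, hf]
      have h2 : ∀ b, a (u.1, b) * a (u.1, b) = 1 := fun b => by
        rcases (fst_eq_iff (u.1, b) u).1 rfl with h | h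
        · rw [h]; simp [a]
        · rw [h, ha]; simp [a]
      linear_combination f (u.1, true) * h2 true + f (u.1, false) * h2 false + h1 true + h1 false
    · intro i _ hi
      have h2 : ∀ b, a (i, b) = 0 := fun b => coord_vec_of_ne (Ne.symm hi)
      simp [h2]
    · simp
  have haa : ∀ v, a v * a v * a v = a v := fun v => by
    by_cases h : v.1 = u.1
    · rcases (fst_eq_iff v u).1 h with rfl | rfl
      · simp [a]
      · rw [ha]; simp [a]
    · have : a v = 0 := coord_vec_of_ne (Ne.symm h)
      simp [this]
  have hval' : ∀ f : SIdx N → ℂ, (∀ v, f (opp v) = -f v) → ∑ v, a v * f v = 2 * f u := by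
    intro f hf
    have := hval (fun v => a v * f v) fun v => by rw [ha, hf]; ring
    rw [show a u = 1 from coord_vec_self u, one_mul] at this
    rw [← this]
    exact Finset.sum_congr rfl fun v _ => by rw [← mul_assoc, haa]
  rw [Fintype.sum_sum_type]
  have e1 : ∑ v : SIdx N, (m.half (.inl v) : ℂ) * coord u (Root.dir (.inl v))
      / eval x (Root.lin (.inl v)) = 2 * ((m.m1 + m.m2) / coord u x) := by
    rw [← hval' (fun v => (m.m1 + m.m2) / coord v x) fun v => by rw [coord_opp, div_neg]]
    refine Finset.sum_congr rfl fun v _ => ?_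
    simp only [Mult.half, Root.dir, Root.lin, eval_Y, a]
    push_cast
    ring
  have e2 : ∑ p : {p : SIdx N × SIdx N // p.1.1 ≠ p.2.1},
      (m.half (.inr p) : ℂ) * coord u (Root.dir (.inr p)) / eval x (Root.lin (.inr p))
      = 2 * D u := by
    have h1 : ∑ p : {p : SIdx N × SIdx N // p.1.1 ≠ p.2.1},
        (m.half (.inr p) : ℂ) * coord u (Root.dir (.inr p)) / eval x (Root.lin (.inr p))
        = ∑ v : SIdx N, if v.2 then ∑ w, (a v - a w) * t v w else 0 := by
      have := Finset.sum_subtype (Finset.univ.filter fun p : SIdx N × SIdx N => p.1.1 ≠ p.2.1)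
        (F := inferInstance) (p := fun p => p.1.1 ≠ p.2.1) (by simp)
        (fun p => if p.1.2 then (a p.1 - a p.2) * t p.1 p.2 else 0)
      rw [Finset.sum_filter, Fintype.sum_prod_type] at this
      have h2 : ∀ p : {p : SIdx N × SIdx N // p.1.1 ≠ p.2.1},
          (m.half (.inr p) : ℂ) * coord u (Root.dir (.inr p)) / eval x (Root.lin (.inr p))
          = if p.1.1.2 then (a p.1.1 - a p.1.2) * t p.1.1 p.1.2 else 0 := fun p => by
        by_cases h : p.1.1.2 = true
        · simp [Mult.half, h, a, t, Root.dir, Root.lin, Ne.symm p.2]; ring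
        · simp [Mult.half, h]
      rw [Finset.sum_congr rfl fun p _ => h2 p, ← this]
      refine Finset.sum_congr rfl fun v _ => ?_
      by_cases h : v.2 = true
      · simp only [h, if_true]
        refine Finset.sum_congr rfl fun w _ => ?_
        by_cases hw : v.1 = w.1
        · simp [t, hw]
        · simp [hw]
      · simp [h]
    have h3 : ∑ v, ∑ w, (a v - a w) * t v w = 4 * D u := by
      have h4 : ∑ v, ∑ w, a v * t v w = 2 * D u := by
        rw [← hval' D hD]
        exact Finset.sum_congr rfl fun v _ => by rw [Finset.mul_sum]
      have h5 : ∑ v, ∑ w, a w * t v w = -(2 * D u) := by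
        rw [← h4, Finset.sum_comm, ← Finset.sum_neg_distrib]
        refine Finset.sum_congr rfl fun v _ => ?_
        rw [← Finset.sum_neg_distrib]
        exact Finset.sum_congr rfl fun w _ => by rw [ht' v w]; ring
      simp only [sub_mul, Finset.sum_sub_distrib, h4, h5]
      ring
    have h6 : ∀ i, ∑ w, (a (i, false) - a w) * t (i, false) w
        = ∑ w, (a (i, true) - a w) * t (i, true) w := fun i => by
      rw [← hopp]
      refine Finset.sum_congr rfl fun w _ => ?_
      rw [show ((i, false) : SIdx N) = opp (i, true) from rfl, ha, ha, ht]
      ring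
    rw [h1, sum_sidx]
    rw [sum_sidx] at h3
    simp only [h6, ← two_mul, ← Finset.mul_sum] at h3
    simp
    linear_combination h3 / 2
  rw [e1, e2, cCoef, mul_add]

lemma eval_dD_weightPoly {x : Fin N → ℂ} (hx : Reg x) (u : SIdx N) :
    eval x (dD (vec u) (weightPoly N m)) = 2 * cCoef m u x * eval x (weightPoly N m) := by
  rw [weightPoly, eval_dD_prod_lin_pow hx, sum_half]

end Weight

section Gaussian

open MeasureTheory Complex

/-- A shifted copy of the real space, which avoids all the hyperplanes. -/
def contour (x : Fin N → ℝ) : Fin N → ℂ := fun j => x j + (j + 1 : ℝ) * I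

/-- The Gaussian `exp (-z² / 2)` on the contour. -/
def gauss (x : Fin N → ℝ) : ℂ := cexp (-(∑ j, contour x j ^ 2) / 2)

lemma continuous_contour : Continuous (contour (N := N)) := by
  unfold contour; fun_prop

lemma continuous_eval_contour (g : MvPolynomial (Fin N) ℂ) :
    Continuous fun x => eval (contour x) g := (MvPolynomial.continuous_eval g).comp continuous_contour

lemma contour_add_smul (x : Fin N → ℝ) (t : ℝ) (j : Fin N) :
    contour (x + t • Pi.single j 1) = contour x + (t : ℂ) • vec (j, true) := by
  ext i
  by_cases h : i = j
  · subst h; simp [contour, vec]; ring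
  · simp [contour, vec, h]

lemma im_coord_contour (u : SIdx N) (x : Fin N → ℝ) :
    ∃ k : ℤ, k ≠ 0 ∧ (coord u (contour x)).im = k := by
  obtain ⟨i, b⟩ := u
  cases b
  · exact ⟨-(i + 1), by omega, by simp [coord, contour]⟩
  · exact ⟨i + 1, by omega, by simp [coord, contour]⟩

lemma im_coord_sub_contour {u w : SIdx N} (h : u.1 ≠ w.1) (x : Fin N → ℝ) :
    ∃ k : ℤ, k ≠ 0 ∧ (coord u (contour x) - coord w (contour x)).im = k := by
  obtain ⟨i, b⟩ := u
  obtain ⟨j, c⟩ := w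
  have h : (i : ℕ) ≠ j := fun e => h (Fin.ext e)
  cases b <;> cases c
  · exact ⟨j - i, by omega, by simp [coord, contour]; ring⟩
  · exact ⟨-(i + 1) - (j + 1), by omega, by simp [coord, contour]⟩
  · exact ⟨(i + 1) + (j + 1), by omega, by simp [coord, contour]; ring⟩
  · exact ⟨i - j, by omega, by simp [coord, contour]⟩

lemma one_le_norm_of_im {z : ℂ} (h : ∃ k : ℤ, k ≠ 0 ∧ z.im = k) : 1 ≤ ‖z‖ := by
  obtain ⟨k, hk, h⟩ := h
  refine le_trans ?_ (abs_im_le_norm z)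
  rw [h]
  exact_mod_cast Int.one_le_abs hk

lemma one_le_norm_coord (u : SIdx N) (x : Fin N → ℝ) : 1 ≤ ‖coord u (contour x)‖ :=
  one_le_norm_of_im (im_coord_contour u x)

lemma one_le_norm_coord_sub {u w : SIdx N} (h : u.1 ≠ w.1) (x : Fin N → ℝ) :
    1 ≤ ‖coord u (contour x) - coord w (contour x)‖ :=
  one_le_norm_of_im (im_coord_sub_contour h x)

lemma ne_zero_of_one_le_norm {z : ℂ} (h : 1 ≤ ‖z‖) : z ≠ 0 :=
  norm_pos_iff.1 (by linarith)

lemma reg_contour (x : Fin N → ℝ) : Reg (contour x) := by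
  refine reg_iff.2 ⟨fun u => ne_zero_of_one_le_norm (one_le_norm_coord u x), fun u => ?_,
    fun u w h => ne_zero_of_one_le_norm (one_le_norm_coord_sub h x)⟩
  obtain ⟨k, hk, h⟩ := im_coord_contour u x
  refine ne_zero_of_one_le_norm (one_le_norm_of_im ⟨k, hk, ?_⟩)
  rw [add_im, h]
  norm_num

lemma one_le_norm_lin (ρ : Root N) (x : Fin N → ℝ) : 1 ≤ ‖eval (contour x) ρ.lin‖ := by
  rcases ρ with v | p
  · simpa [Root.lin] using one_le_norm_coord v x
  · simpa [Root.lin] using one_le_norm_coord_sub p.2 x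

lemma one_le_norm_weightPoly (x : Fin N → ℝ) : 1 ≤ ‖eval (contour x) (weightPoly N m)‖ := by
  simp only [weightPoly, map_prod, map_pow, norm_prod, norm_pow]
  rw [← Finset.prod_const_one (s := (Finset.univ : Finset (Root N)))]
  exact Finset.prod_le_prod (fun _ _ => zero_le_one) fun ρ _ => one_le_pow₀ (one_le_norm_lin ρ x)

lemma eval_weightPoly_ne_zero (x : Fin N → ℝ) : eval (contour x) (weightPoly N m) ≠ 0 :=
  ne_zero_of_one_le_norm (one_le_norm_weightPoly x)

lemma continuous_cCoef_contour (u : SIdx N) : Continuous fun x => cCoef m u (contour x) := by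
  have hc : ∀ w : SIdx N, Continuous fun x : Fin N → ℝ => coord w (contour x) :=
    fun w => (continuous_coord w).comp continuous_contour
  refine Continuous.add (Continuous.div continuous_const (hc u) fun x =>
    ne_zero_of_one_le_norm (one_le_norm_coord u x)) (continuous_finsetSum _ fun w _ => ?_)
  by_cases h : w.1 = u.1
  · simpa only [h, if_true] using continuous_const
  · simp only [h, if_false]
    exact continuous_const.div ((hc u).sub (hc w)) fun x =>
      ne_zero_of_one_le_norm (one_le_norm_coord_sub (Ne.symm h) x)

lemma norm_div_le_of_one_le {a b : ℂ} (h : 1 ≤ ‖b‖) : ‖a / b‖ ≤ ‖a‖ := by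
  rw [norm_div]
  exact div_le_self (norm_nonneg _) h

lemma exists_norm_cCoef_le (u : SIdx N) : ∃ K, ∀ x, ‖cCoef m u (contour x)‖ ≤ K := by
  refine ⟨‖(m.m1 + m.m2 : ℂ)‖ + ∑ w : SIdx N, ‖(m.m3 : ℂ)‖, fun x => ?_⟩
  refine (norm_add_le _ _).trans (add_le_add (norm_div_le_of_one_le (one_le_norm_coord u x))
    ((norm_sum_le _ _).trans (Finset.sum_le_sum fun w _ => ?_)))
  split_ifs with h
  · simp
  · exact norm_div_le_of_one_le (one_le_norm_coord_sub (Ne.symm h) x)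

lemma integrable_pow_mul_cexp (a : ℝ) (d : ℕ) :
    Integrable fun x : ℝ => ((x : ℂ) + a * I) ^ d * cexp (-((x : ℂ) + a * I) ^ 2 / 2) := by
  have h1 : ∀ k : ℕ, Integrable fun x : ℝ => ((x ^ k * Real.exp (-(1 / 2) * x ^ 2) : ℝ) : ℂ) := by
    intro k
    have h := integrable_rpow_mul_exp_neg_mul_sq (b := 1 / 2) (by norm_num) (s := k)
      (by have : (0 : ℝ) ≤ k := k.cast_nonneg
          linarith)
    simp only [Real.rpow_natCast] at h
    exact h.ofReal
  have h2 : ∀ k : ℕ, Integrable fun x : ℝ => cexp ((-(a * x) : ℝ) * I)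
      * ((x ^ k * Real.exp (-(1 / 2) * x ^ 2) : ℝ) : ℂ) := fun k =>
    (h1 k).bdd_mul (c := 1) (Continuous.aestronglyMeasurable (by fun_prop))
      (ae_of_all _ fun x => (norm_exp_ofReal_mul_I _).le)
  have h3 : (fun x : ℝ => ((x : ℂ) + a * I) ^ d * cexp (-((x : ℂ) + a * I) ^ 2 / 2))
      = fun x : ℝ => ∑ k ∈ Finset.range (d + 1), (a * I) ^ (d - k) * (d.choose k)
        * cexp (a ^ 2 / 2) * (cexp ((-(a * x) : ℝ) * I)
          * ((x ^ k * Real.exp (-(1 / 2) * x ^ 2) : ℝ) : ℂ)) := by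
    ext x
    have h4 : cexp (-((x : ℂ) + a * I) ^ 2 / 2)
        = cexp (a ^ 2 / 2) * (cexp ((-(a * x) : ℝ) * I) * cexp (-(1 / 2) * x ^ 2)) := by
      rw [← Complex.exp_add, ← Complex.exp_add]
      congr 1
      push_cast
      linear_combination (-(a : ℂ) ^ 2 / 2) * I_sq
    rw [h4, add_pow, Finset.sum_mul]
    refine Finset.sum_congr rfl fun k _ => ?_
    push_cast
    ring
  rw [h3]
  exact integrable_finsetSum _ fun k _ => (h2 k).const_mul _

lemma integrable_eval_mul_gauss (g : MvPolynomial (Fin N) ℂ) :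
    Integrable fun x : Fin N → ℝ => eval (contour x) g * gauss x := by
  induction g using MvPolynomial.induction_on' with
  | add p q hp hq =>
    simp only [map_add, add_mul]
    exact hp.add hq
  | monomial d c =>
    have h := Integrable.fintype_prod (ι := Fin N) (E := ℝ) (μ := fun _ => volume)
      (f := fun (j : Fin N) (x : ℝ) => ((x : ℂ) + ((j + 1 : ℝ) : ℂ) * I) ^ d j
        * cexp (-((x : ℂ) + ((j + 1 : ℝ) : ℂ) * I) ^ 2 / 2))
      fun j => integrable_pow_mul_cexp ((j : ℝ) + 1) (d j)
    refine (h.const_mul c).congr (ae_of_all _ fun x => ?_)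
    simp only [eval_monomial, gauss, Finset.prod_mul_distrib, ← Complex.exp_sum, mul_assoc]
    rw [Finsupp.prod_fintype _ _ (by simp)]
    congr 3
    rw [← Finset.sum_neg_distrib, Finset.sum_div]
    simp [contour]

lemma integrable_bdd_mul_gauss {Φ : (Fin N → ℝ) → ℂ} (hΦ : Continuous Φ) {K : ℝ}
    (hK : ∀ x, ‖Φ x‖ ≤ K) (g : MvPolynomial (Fin N) ℂ) :
    Integrable fun x : Fin N → ℝ => Φ x * (eval (contour x) g * gauss x) :=
  (integrable_eval_mul_gauss g).bdd_mul hΦ.aestronglyMeasurable (ae_of_all _ hK)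

lemma continuous_inv_weight :
    Continuous fun x : Fin N → ℝ => (eval (contour x) (weightPoly N m))⁻¹ :=
  (continuous_eval_contour _).inv₀ eval_weightPoly_ne_zero

lemma norm_inv_weight_le (x : Fin N → ℝ) : ‖(eval (contour x) (weightPoly N m))⁻¹‖ ≤ 1 := by
  rw [norm_inv]
  exact inv_le_one_of_one_le₀ (one_le_norm_weightPoly x)

lemma integrable_weight (m : Mult) (g : MvPolynomial (Fin N) ℂ) :
    Integrable fun x : Fin N → ℝ =>
      (eval (contour x) (weightPoly N m))⁻¹ * (eval (contour x) g * gauss x) :=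
  integrable_bdd_mul_gauss continuous_inv_weight norm_inv_weight_le g

lemma dD_vec (j : Fin N) (q : MvPolynomial (Fin N) ℂ) : dD (vec (j, true)) q = pderiv j q := by
  have : dD (vec (j, true)) = pderiv (R := ℂ) j := by
    refine derivation_ext fun i => ?_
    by_cases h : i = j
    · subst h; simp [vec]
    · simp [vec, h, pderiv_X_of_ne h]
  rw [this]

lemma eval_pderiv_weightPoly (j : Fin N) (x : Fin N → ℝ) :
    eval (contour x) (pderiv j (weightPoly N m))
      = 2 * cCoef m (j, true) (contour x) * eval (contour x) (weightPoly N m) := by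
  rw [← dD_vec, eval_dD_weightPoly (reg_contour x)]

/-- Integration against the Gaussian weight. -/
def gaussI (N : ℕ) (m : Mult) : MvPolynomial (Fin N) ℂ →ₗ[ℂ] ℂ where
  toFun g := ∫ x : Fin N → ℝ, (eval (contour x) (weightPoly N m))⁻¹ * (eval (contour x) g * gauss x)
  map_add' p q := by
    rw [← integral_add (integrable_weight m p) (integrable_weight m q)]
    simp only [map_add, add_mul, mul_add]
  map_smul' c p := by
    rw [RingHom.id_apply, smul_eq_mul, ← integral_const_mul]
    refine integral_congr_ae (ae_of_all _ fun x => ?_)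
    simp only [smul_eval]
    ring

lemma gaussI_apply (g : MvPolynomial (Fin N) ℂ) : gaussI N m g = ∫ x : Fin N → ℝ,
    (eval (contour x) (weightPoly N m))⁻¹ * (eval (contour x) g * gauss x) := rfl

lemma hasDerivAt_eval_line (q : MvPolynomial (Fin N) ℂ) (x : Fin N → ℝ) (j : Fin N) :
    HasDerivAt (fun t : ℝ => eval (contour (x + t • Pi.single j 1)) q)
      (eval (contour x) (pderiv j q)) 0 := by
  rw [← dD_vec]
  have h : HasDerivAt (fun t : ℂ => eval (contour x + t • vec (j, true)) q)
      (eval (contour x) (dD (vec (j, true)) q)) ((0 : ℝ) : ℂ) := by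
    rw [hasDerivAt_iff_tendsto_slope_zero]
    refine (tendsto_slope_line q (contour x) (vec (j, true))).congr fun t => ?_
    simp [div_eq_inv_mul]
  simpa only [contour_add_smul] using h.comp_ofReal

lemma hasDerivAt_gauss_line (x : Fin N → ℝ) (j : Fin N) :
    HasDerivAt (fun t : ℝ => gauss (x + t • Pi.single j 1)) (-contour x j * gauss x) 0 := by
  have h := ((hasDerivAt_eval_line (C (-1 / 2) * ∑ i, X i ^ 2) x j).cexp)
  have e : ∀ y : Fin N → ℝ, gauss y = cexp (eval (contour y) (C (-1 / 2) * ∑ i, X i ^ 2)) := by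
    intro y
    simp only [gauss, map_mul, eval_C, map_sum, map_pow, eval_X]
    congr 1
    ring
  simp only [e]
  refine h.congr_deriv ?_
  rw [zero_smul, add_zero, mul_comm]
  congr 1
  rw [Derivation.leibniz, pderiv_C, smul_zero, add_zero, map_sum, Finset.sum_eq_single j]
  · simp [Derivation.leibniz_pow]
    ring
  · intro i _ hi
    simp [pderiv_X_of_ne hi, Derivation.leibniz_pow]
  · simp

lemma integrable_by_parts (j : Fin N) (P : MvPolynomial (Fin N) ℂ) :
    Integrable fun x : Fin N → ℝ => (eval (contour x) (weightPoly N m))⁻¹ *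
      ((eval (contour x) (pderiv j P)
        - 2 * cCoef m (j, true) (contour x) * eval (contour x) P) * gauss x) := by
  obtain ⟨K, hK⟩ := exists_norm_cCoef_le (N := N) (m := m) (j, true)
  have a1 := integrable_weight m (pderiv j P)
  have a2 := integrable_bdd_mul_gauss
    (Φ := fun x => cCoef m (j, true) (contour x) * (eval (contour x) (weightPoly N m))⁻¹)
    ((continuous_cCoef_contour (j, true)).mul continuous_inv_weight) (K := K * 1) (fun x => by
      rw [norm_mul]
      exact mul_le_mul (hK x) (norm_inv_weight_le x) (norm_nonneg _)
        ((norm_nonneg _).trans (hK x))) P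
  refine (a1.sub (a2.const_mul 2)).congr (ae_of_all _ fun x => ?_)
  simp only [Pi.sub_apply]
  ring

lemma integral_by_parts (j : Fin N) (P : MvPolynomial (Fin N) ℂ) :
    ∫ x : Fin N → ℝ, (eval (contour x) (weightPoly N m))⁻¹ *
      ((eval (contour x) (pderiv j P)
        - 2 * cCoef m (j, true) (contour x) * eval (contour x) P) * gauss x)
      = gaussI N m (X j * P) := by
  set A : (Fin N → ℝ) → ℂ := fun x => (eval (contour x) (weightPoly N m))⁻¹ with hA
  set f : (Fin N → ℝ) → ℂ := fun x => A x * eval (contour x) P with hf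
  set f' : (Fin N → ℝ) → ℂ := fun x => A x * (eval (contour x) (pderiv j P)
        - 2 * cCoef m (j, true) (contour x) * eval (contour x) P) with hf'
  have i1 : Integrable fun x => f' x * gauss x := by
    refine (integrable_by_parts (m := m) j P).congr (ae_of_all _ fun x => ?_)
    simp only [hf', hA, mul_assoc]
  have i2 : Integrable fun x => f x * (-contour x j * gauss x) := by
    refine (integrable_weight m (X j * P)).neg.congr (ae_of_all _ fun x => ?_)
    simp only [hf, hA, Pi.neg_apply, map_mul, eval_X]
    ring
  have i3 : Integrable fun x => f x * gauss x := by
    refine (integrable_weight m P).congr (ae_of_all _ fun x => ?_)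
    simp only [hf, hA]
    ring
  have key := integral_bilinear_hasLineDerivAt_right_eq_neg_left_of_integrable
    (μ := (volume : Measure (Fin N → ℝ))) (f := f) (f' := f') (g := gauss)
    (g' := fun x => -contour x j * gauss x) (v := Pi.single j 1)
    (B := ContinuousLinearMap.mul ℝ ℂ) i1 i2 i3
    (fun x _ => by
      have h := ((hasDerivAt_eval_line (weightPoly N m) x j).inv (by
        rw [zero_smul, add_zero]; exact eval_weightPoly_ne_zero x)).mul (hasDerivAt_eval_line P x j)
      refine HasDerivAt.congr_deriv h ?_
      have h0 := eval_weightPoly_ne_zero (m := m) x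
      simp only [hf', hA, zero_smul, add_zero, Pi.inv_apply, eval_pderiv_weightPoly]
      field_simp
      ring)
    (fun x _ => hasDerivAt_gauss_line x j)
  simp only [ContinuousLinearMap.mul_apply'] at key
  rw [gaussI_apply, ← neg_inj]
  calc _ = -∫ x, f' x * gauss x := by simp only [hf', hA, mul_assoc]
    _ = _ := by
      rw [← key, ← integral_neg]
      refine integral_congr_ae (ae_of_all _ fun x => ?_)
      simp only [hf, hA, map_mul, eval_X]
      ring

lemma dD_vec_false (j : Fin N) (q : MvPolynomial (Fin N) ℂ) :
    dD (vec (j, false)) q = -pderiv j q := by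
  have : dD (vec (j, false)) = -pderiv (R := ℂ) j := by
    refine derivation_ext fun i => ?_
    by_cases h : i = j
    · subst h; simp [vec]
    · simp [vec, h, pderiv_X_of_ne h]
  rw [this, Derivation.neg_apply]

lemma cCoef_false (j : Fin N) (x : Fin N → ℂ) :
    cCoef m (j, false) x = -cCoef m (j, true) x := by
  have hopp : ∀ f : SIdx N → ℂ, ∑ w, f (opp w) = ∑ w, f w := fun f =>
    Equiv.sum_comp ⟨opp, opp, opp_opp, opp_opp⟩ f
  have h : ((j, false) : SIdx N) = opp (j, true) := rfl
  rw [h, cCoef, cCoef, neg_add, coord_opp, div_neg, ← hopp, ← Finset.sum_neg_distrib]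
  congr 1
  refine Finset.sum_congr rfl fun w _ => ?_
  simp only [opp_fst, coord_opp]
  split_ifs with h
  · simp
  · rw [← div_neg]; congr 1; ring

lemma calOp_eq_sum_pderiv (q : MvPolynomial (Fin N) ℂ) (x : Fin N → ℂ) : calOp m q x
    = ∑ j, (eval x (pderiv j (pderiv j q)) - 2 * cCoef m (j, true) x * eval x (pderiv j q)) := by
  rw [calOp, sum_sidx]
  refine Finset.sum_congr rfl fun j _ => ?_
  simp only [dD_vec, dD_vec_false, cCoef_false, map_neg, neg_neg]
  ring

/-- The operator `calOp` is symmetric up to the Euler operator. -/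
lemma gaussI_symm {p q r s : MvPolynomial (Fin N) ℂ} (hr : ∀ x, Reg x → eval x r = calOp m p x)
    (hs : ∀ x, Reg x → eval x s = calOp m q x) :
    gaussI N m (p * (∑ j, X j * pderiv j q - s)) = gaussI N m (q * (∑ j, X j * pderiv j p - r)) := by
  have key : gaussI N m (∑ j, X j * (p * pderiv j q - q * pderiv j p))
      = gaussI N m (p * s - q * r) := by
    rw [map_sum]
    simp only [← integral_by_parts]
    rw [← integral_finsetSum _ fun j _ => integrable_by_parts j _, gaussI_apply]
    refine integral_congr_ae (ae_of_all _ fun x => ?_)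
    simp only [map_sub, map_mul, hr _ (reg_contour x), hs _ (reg_contour x), calOp_eq_sum_pderiv,
      Derivation.leibniz, smul_eq_mul, map_add]
    rw [← Finset.mul_sum, ← Finset.sum_mul, Finset.mul_sum, Finset.mul_sum,
      ← Finset.sum_sub_distrib]
    congr 3
    ext j
    ring
  have e : p * (∑ j, X j * pderiv j q - s) - q * (∑ j, X j * pderiv j p - r)
      = ∑ j, X j * (p * pderiv j q - q * pderiv j p) - (p * s - q * r) := by
    simp only [mul_sub, Finset.mul_sum, Finset.sum_sub_distrib]
    have e1 : ∀ a b : MvPolynomial (Fin N) ℂ, ∑ j, a * (X j * pderiv j b)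
      = ∑ j, X j * (a * pderiv j b) := fun a b => Finset.sum_congr rfl fun j _ => by ring
    rw [e1, e1]
    ring
  rw [← sub_eq_zero, ← map_sub, e, map_sub, key, sub_self]

/-- The case of trivial multiplicities. -/
def Mult.zero : Mult := ⟨0, 0, 0⟩

lemma weightPoly_zero : weightPoly N Mult.zero = 1 := by
  refine Finset.prod_eq_one fun ρ _ => ?_
  rcases ρ with v | p <;> simp [Mult.half, Mult.zero]

lemma gaussI_weightPoly_mul (g : MvPolynomial (Fin N) ℂ) :
    gaussI N m (weightPoly N m * g) = gaussI N Mult.zero g := by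
  rw [gaussI_apply, gaussI_apply]
  refine integral_congr_ae (ae_of_all _ fun x => ?_)
  have := eval_weightPoly_ne_zero (m := m) x
  simp only [map_mul, weightPoly_zero, map_one, inv_one, one_mul]
  field_simp

lemma gaussI_zero_pderiv (j : Fin N) (P : MvPolynomial (Fin N) ℂ) :
    gaussI N Mult.zero (pderiv j P) = gaussI N Mult.zero (X j * P) := by
  rw [← integral_by_parts, gaussI_apply]
  simp [cCoef, Mult.zero]

lemma gaussI_zero_one_ne_zero : gaussI N Mult.zero 1 ≠ 0 := by
  have h := integral_fintype_prod_volume_eq_prod (ι := Fin N) (𝕜 := ℂ) (E := fun _ => ℝ)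
    fun j x => cexp (-(1 / 2) * ((x : ℂ) + ((j + 1 : ℝ) : ℂ) * I) ^ 2)
  have h1 : gaussI N Mult.zero 1 = ∫ x : Fin N → ℝ,
      ∏ j, cexp (-(1 / 2) * ((x j : ℂ) + ((j + 1 : ℝ) : ℂ) * I) ^ 2) := by
    rw [gaussI_apply]
    refine integral_congr_ae (ae_of_all _ fun x => ?_)
    simp only [weightPoly_zero, map_one, inv_one, one_mul, gauss, ← Complex.exp_sum]
    congr 1
    rw [← Finset.mul_sum]
    simp only [contour]
    ring
  rw [h1, h]
  refine Finset.prod_ne_zero_iff.2 fun j _ => ?_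
  rw [GaussianFourier.integral_cexp_neg_mul_sq_add_real_mul_I (by norm_num)]
  simp [Complex.cpow_eq_zero_iff, Real.pi_ne_zero]

lemma eq_zero_of_gaussI_zero {q : MvPolynomial (Fin N) ℂ}
    (hq : ∀ f, gaussI N Mult.zero (q * f) = 0) : q = 0 := by
  induction h : q.totalDegree using Nat.strong_induction_on generalizing q with
  | _ n ih =>
  have hd : ∀ i f, gaussI N Mult.zero (pderiv i q * f) = 0 := by
    intro i f
    have h1 := gaussI_zero_pderiv i (q * f)
    rw [Derivation.leibniz, smul_eq_mul, smul_eq_mul, map_add, hq, zero_add,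
      show X i * (q * f) = q * (X i * f) by ring, hq, mul_comm] at h1
    exact h1
  by_cases h0 : q.totalDegree = 0
  · rw [totalDegree_eq_zero_iff_eq_C] at h0
    have h1 := hq 1
    rw [h0, mul_one, ← mul_one (C _), ← smul_eq_C_mul, map_smul, smul_eq_mul] at h1
    rw [h0, (mul_eq_zero.1 h1).resolve_right gaussI_zero_one_ne_zero, C_0]
  · exfalso
    have hz : ∀ i, pderiv i q = 0 := by
      intro i
      by_contra hne
      refine hne (ih _ ?_ (hd i) rfl)
      rw [← h]
      refine (Finset.sup_lt_iff (Nat.pos_of_ne_zero h0)).2 fun s hs => ?_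
      rw [mem_support_iff, coeff_pderiv] at hs
      have h2 := le_totalDegree (mem_support_iff.2 (left_ne_zero_of_mul hs))
      rw [Finsupp.sum_add_index' (by simp) (by simp), Finsupp.sum_single_index rfl] at h2
      exact h2
    refine h0 ((totalDegree_eq_zero_iff _ _).2 fun s hs i => ?_)
    by_contra hi
    have h3 := coeff_pderiv (i := i) q (s - Finsupp.single i 1)
    rw [hz i, coeff_zero, tsub_add_cancel_of_le (by
      rw [Finsupp.single_le_iff]; omega)] at h3
    exact mul_ne_zero (mem_support_iff.1 hs) (Nat.cast_add_one_ne_zero _) h3.symm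

end Gaussian

section Leading

/-- The Euler operator. -/
def euler (N : ℕ) : MvPolynomial (Fin N) ℂ →ₗ[ℂ] MvPolynomial (Fin N) ℂ :=
  ∑ j, LinearMap.mulLeft ℂ (X j) ∘ₗ (pderiv j : Derivation ℂ _ _).toLinearMap

lemma euler_apply (q : MvPolynomial (Fin N) ℂ) : euler N q = ∑ j, X j * pderiv j q := by
  simp [euler, LinearMap.sum_apply]

lemma euler_of_isHomogeneous {q : MvPolynomial (Fin N) ℂ} {n : ℕ} (hq : q.IsHomogeneous n) :
    euler N q = (n : ℂ) • q := by
  rw [euler_apply, hq.sum_X_mul_pderiv, Nat.cast_smul_eq_nsmul]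

lemma calLin_pow_isHomogeneous {q : Qinv N m} {n : ℕ}
    (hq : (q : MvPolynomial (Fin N) ℂ).IsHomogeneous n) (k : ℕ) :
    (∃ j, n = 2 * k + j ∧
      (((calLin N m ^ k) q : Qinv N m) : MvPolynomial (Fin N) ℂ).IsHomogeneous j) ∨
    (calLin N m ^ k) q = 0 := by
  induction k with
  | zero => exact Or.inl ⟨n, by omega, by simpa using hq⟩
  | succ k ih =>
    rw [pow_succ', Module.End.mul_apply]
    rcases ih with ⟨j, h1, h2⟩ | h
    · rcases lt_or_ge j 2 with hj | hj
      · exact Or.inr (calLin_eq_zero hj h2)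
      · obtain ⟨j, rfl⟩ := Nat.exists_eq_add_of_le' hj
        exact Or.inl ⟨j, by omega, calLin_isHomogeneous h2⟩
    · exact Or.inr (by rw [h, map_zero])

/-- The coefficients of `exp (-t/2)`. -/
def expCoef (k : ℕ) : ℂ := (-1 / 2) ^ k / k.factorial

lemma expCoef_succ (k : ℕ) : 2 * ((k + 1 : ℕ) : ℂ) * expCoef (k + 1) = -expCoef k := by
  have h1 : ((k + 1 : ℕ) : ℂ) ≠ 0 := Nat.cast_ne_zero.2 k.succ_ne_zero
  have h2 : (k.factorial : ℂ) ≠ 0 := Nat.cast_ne_zero.2 k.factorial_ne_zero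
  rw [expCoef, expCoef, Nat.factorial_succ, Nat.cast_mul, pow_succ]
  field_simp

/-- The truncated exponential of the operator `-calLin / 2`. -/
def calExp (N : ℕ) (m : Mult) (n : ℕ) : Qinv N m →ₗ[ℂ] Qinv N m :=
  ∑ k ∈ Finset.range (n + 1), expCoef k • calLin N m ^ k

lemma calExp_apply (n : ℕ) (q : Qinv N m) :
    calExp N m n q = ∑ k ∈ Finset.range (n + 1), expCoef k • (calLin N m ^ k) q := by
  simp [calExp, LinearMap.sum_apply]

lemma euler_sub_calLin_calExp {q : Qinv N m} {n : ℕ}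
    (hq : (q : MvPolynomial (Fin N) ℂ).IsHomogeneous n) :
    euler N (calExp N m n q : Qinv N m) - (calLin N m (calExp N m n q) : Qinv N m)
      = (n : ℂ) • ((calExp N m n q : Qinv N m) : MvPolynomial (Fin N) ℂ) := by
  have h1 : ∀ k : ℕ, euler N ((calLin N m ^ k) q : Qinv N m)
      = ((n : ℂ) - 2 * (k : ℂ)) • (((calLin N m ^ k) q : Qinv N m) : MvPolynomial (Fin N) ℂ) := by
    intro k
    rcases calLin_pow_isHomogeneous hq k with ⟨j, h1, h2⟩ | h
    · rw [euler_of_isHomogeneous h2, h1]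
      congr 1
      push_cast
      ring
    · simp [h]
  have h2 : (calLin N m ^ (n + 1)) q = 0 := by
    rcases calLin_pow_isHomogeneous hq (n + 1) with ⟨j, h1, -⟩ | h
    · omega
    · exact h
  let g : ℕ → MvPolynomial (Fin N) ℂ := fun k =>
    (2 * (k : ℂ) * expCoef k) • (((calLin N m ^ k) q : Qinv N m) : MvPolynomial (Fin N) ℂ)
  have h3 : ∑ k ∈ Finset.range (n + 1), (g (k + 1) - g k) = 0 := by
    rw [Finset.sum_range_sub]
    simp [g, h2]
  have h4 : ∀ k, g (k + 1)
      = -(expCoef k • ((calLin N m ((calLin N m ^ k) q) : Qinv N m) : MvPolynomial (Fin N) ℂ)) := by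
    intro k
    simp only [g]
    rw [expCoef_succ, neg_smul, pow_succ', Module.End.mul_apply]
  rw [calExp_apply, map_sum]
  simp only [map_smul, Submodule.coe_sum, Submodule.coe_smul, map_sum, h1]
  rw [← sub_eq_zero, ← h3, ← Finset.sum_sub_distrib, Finset.smul_sum, ← Finset.sum_sub_distrib]
  refine Finset.sum_congr rfl fun k _ => ?_
  rw [h4]
  simp only [g]
  module

lemma homogeneousComponent_calExp {q : Qinv N m} {n : ℕ}
    (hq : (q : MvPolynomial (Fin N) ℂ).IsHomogeneous n) :
    homogeneousComponent n ((calExp N m n q : Qinv N m) : MvPolynomial (Fin N) ℂ) = q := by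
  rw [calExp_apply, Submodule.coe_sum, map_sum, Finset.sum_eq_single 0]
  · simp [expCoef, homogeneousComponent_of_mem hq]
  · intro k _ hk
    rw [Submodule.coe_smul, map_smul]
    rcases calLin_pow_isHomogeneous hq k with ⟨j, h1, h2⟩ | h
    · rw [homogeneousComponent_of_mem h2, if_neg (by omega), smul_zero]
    · simp [h]
  · simp

lemma isHomogeneous_of_mem_Gr {P : MvPolynomial (Fin N) ℂ} {n : ℕ} (hP : P ∈ Gr N m n) :
    P.IsHomogeneous n := by
  obtain ⟨p, -, -, rfl⟩ := mem_Gr.1 hP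
  exact homogeneousComponent_isHomogeneous n p

lemma gaussI_calExp_mul {q w : Qinv N m} {n j : ℕ}
    (hq : (q : MvPolynomial (Fin N) ℂ).IsHomogeneous n)
    (hw : (w : MvPolynomial (Fin N) ℂ).IsHomogeneous j) :
    ((j : ℂ) - n) * gaussI N m ((calExp N m n q : Qinv N m) * w)
      = gaussI N m ((calExp N m n q : Qinv N m) * (calLin N m w : Qinv N m)) := by
  have h := gaussI_symm (fun x hx => eval_calLin (calExp N m n q) hx)
    (fun x hx => eval_calLin w hx)
  rw [← euler_apply, ← euler_apply, euler_sub_calLin_calExp hq, euler_of_isHomogeneous hw, mul_sub,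
    map_sub, mul_smul_comm, mul_smul_comm, map_smul, map_smul, smul_eq_mul, smul_eq_mul,
    mul_comm (w : MvPolynomial (Fin N) ℂ)] at h
  linear_combination h

lemma eq_zero_of_gaussI_calExp {q : Qinv N m} {n : ℕ}
    (hq : (q : MvPolynomial (Fin N) ℂ).IsHomogeneous n)
    (h : ∀ w : Qinv N m, (w : MvPolynomial (Fin N) ℂ) ∈ Gr N m n →
      gaussI N m ((calExp N m n q : Qinv N m) * w) = 0) : q = 0 := by
  have h1 : ∀ j, ∀ w : Qinv N m, (w : MvPolynomial (Fin N) ℂ) ∈ Gr N m j →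
      gaussI N m ((calExp N m n q : Qinv N m) * w) = 0 := by
    intro j
    induction j using Nat.strong_induction_on with
    | _ j ih =>
    intro w hw
    rcases eq_or_ne j n with rfl | hjn
    · exact h w hw
    have hw' := isHomogeneous_of_mem_Gr hw
    have h2 : gaussI N m ((calExp N m n q : Qinv N m) * (calLin N m w : Qinv N m)) = 0 := by
      rcases lt_or_ge j 2 with hj | hj
      · simp [calLin_eq_zero hj hw']
      · obtain ⟨j, rfl⟩ := Nat.exists_eq_add_of_le' hj
        exact ih j (by omega) _ (calLin_mem_Gr hw)
    rw [← gaussI_calExp_mul hq hw'] at h2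
    exact (mul_eq_zero.1 h2).resolve_left (sub_ne_zero.2 (by exact_mod_cast hjn))
  have h2 : ∀ f, gaussI N m ((calExp N m n q : Qinv N m) * (rootProd N m * f)) = 0 := by
    intro f
    rw [← sum_homogeneousComponent f, Finset.mul_sum, Finset.mul_sum, map_sum]
    exact Finset.sum_eq_zero fun k _ => h1 _ ⟨_, rootProd_mul_mem_Qinv _⟩
      (rootProd_mul_mem_Gr (homogeneousComponent_isHomogeneous k f))
  obtain ⟨B, hB⟩ := weightPoly_dvd_rootProd (N := N) (m := m)
  have hB0 : B ≠ 0 := by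
    rintro rfl
    exact rootProd_ne_zero (by rw [hB, mul_zero])
  have h3 : ((calExp N m n q : Qinv N m) : MvPolynomial (Fin N) ℂ) * B = 0 := by
    refine eq_zero_of_gaussI_zero fun f => ?_
    have e : ∀ P : MvPolynomial (Fin N) ℂ,
        weightPoly N m * (P * B * f) = P * (rootProd N m * f) := fun P => by rw [hB]; ring
    rw [← gaussI_weightPoly_mul (m := m), e, h2]
  have h4 := (mul_eq_zero.1 h3).resolve_right hB0
  apply Subtype.ext
  rw [← homogeneousComponent_calExp hq, h4, map_zero, Submodule.coe_zero]

lemma eq_of_le_of_pairing {E : Type*} [AddCommGroup E] [Module ℂ E] {V W : Submodule ℂ E}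
    [Module.Finite ℂ V] (hWV : W ≤ V) (T : V →ₗ[ℂ] Module.Dual ℂ E)
    (hT : ∀ v, (∀ w ∈ W, T v w = 0) → v = 0) : W = V := by
  have : Module.Finite ℂ W := Submodule.finiteDimensional_of_le hWV
  refine Submodule.eq_of_le_of_finrank_le hWV ?_
  rw [← Subspace.dual_finrank_eq (K := ℂ) (V := W)]
  refine LinearMap.finrank_le_finrank_of_injective (f := W.subtype.dualMap ∘ₗ T) ?_
  rw [← LinearMap.ker_eq_bot, LinearMap.ker_eq_bot']
  exact fun v hv => hT v fun w hw => LinearMap.congr_fun hv ⟨w, hw⟩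

/-- The pairing `(v, w) ↦ gaussI (calExp v * w)`. -/
def gaussPairing (N : ℕ) (m : Mult) (n : ℕ) :
    Qinv N m →ₗ[ℂ] Module.Dual ℂ (MvPolynomial (Fin N) ℂ) :=
  (LinearMap.mul ℂ (MvPolynomial (Fin N) ℂ)).compr₂ (gaussI N m) ∘ₗ
    (Qinv N m).subtype ∘ₗ calExp N m n

lemma gaussPairing_apply (n : ℕ) (v : Qinv N m) (w : MvPolynomial (Fin N) ℂ) :
    gaussPairing N m n v w = gaussI N m ((calExp N m n v : Qinv N m) * w) := by
  simp only [gaussPairing, LinearMap.comp_apply, LinearMap.compr₂_apply, LinearMap.mul_apply',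
    Submodule.subtype_apply]

lemma mem_Gr_of_mem_Qinv {q : MvPolynomial (Fin N) ℂ} {n : ℕ} (hq : q.IsHomogeneous n)
    (hq' : q ∈ Qinv N m) : q ∈ Gr N m n := by
  have : Module.Finite ℂ (homogeneousSubmodule (Fin N) ℂ n) :=
    Module.Finite.iff_fg.2 (homogeneousSubmodule_fg _ _ n)
  have : Module.Finite ℂ (homogeneousSubmodule (Fin N) ℂ n ⊓ Qinv N m : Submodule ℂ _) :=
    Submodule.finiteDimensional_of_le inf_le_left
  have heq := eq_of_le_of_pairing (W := Gr N m n ⊓ Qinv N m)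
    (V := homogeneousSubmodule (Fin N) ℂ n ⊓ Qinv N m)
    (inf_le_inf_right _ fun _ hP => isHomogeneous_of_mem_Gr hP)
    (gaussPairing N m n ∘ₗ Submodule.inclusion inf_le_right) (by
      rintro ⟨v, hv⟩ hw
      have h := eq_zero_of_gaussI_calExp (q := ⟨v, hv.2⟩) hv.1 fun w hw' => by
        rw [← gaussPairing_apply]
        exact hw w ⟨hw', w.2⟩
      exact Subtype.ext (by simpa using h))
  have hqV : q ∈ homogeneousSubmodule (Fin N) ℂ n ⊓ Qinv N m := ⟨hq, hq'⟩
  rw [← heq] at hqV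
  exact hqV.1

end Leading

section Bridge

lemma actP_inl (j : Fin N) (b : Bool) (q : MvPolynomial (Fin N) ℂ) :
    Root.actP (.inl (j, b)) q = sigmaP j q := by
  unfold Root.actP sigmaP
  congr 2
  ext1 k
  by_cases h : k = j <;> simp [Root.perm, h, opp, Y]

lemma actP_inr_same {i j : Fin N} (b : Bool) (h : i ≠ j) (q : MvPolynomial (Fin N) ℂ) :
    Root.actP (.inr ⟨((i, b), (j, b)), h⟩) q = swapP i j q := by
  unfold Root.actP swapP
  congr 2
  ext1 k
  by_cases h1 : k = i
  · subst h1; cases b <;> simp [Root.perm, opp, Y, h]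
  · by_cases h2 : k = j
    · subst h2; cases b <;> simp [Root.perm, opp, Y, h1]
    · cases b <;> simp [Root.perm, opp, Y, h1, h2]

lemma actP_inr_diff {i j : Fin N} (b : Bool) (h : i ≠ j) (q : MvPolynomial (Fin N) ℂ) :
    Root.actP (.inr ⟨((i, b), (j, !b)), h⟩) q = rhoP i j q := by
  unfold Root.actP rhoP
  congr 2
  ext1 k
  by_cases h1 : k = i
  · subst h1; cases b <;> simp [Root.perm, opp, Y, h]
  · by_cases h2 : k = j
    · subst h2; cases b <;> simp [Root.perm, opp, Y, h1]
    · cases b <;> simp [Root.perm, opp, Y, h1, h2]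

lemma C_sgn_mul_pow_two_mul (b : Bool) (ℓ : MvPolynomial (Fin N) ℂ) (k : ℕ) :
    (C (sgn b) * ℓ) ^ (2 * k) = ℓ ^ (2 * k) := by
  cases b
  · simp [Even.neg_pow]
  · simp

lemma QtildeBC_subset (m : Mult) {q : MvPolynomial (Fin N) ℂ}
    (hq : q ∈ QtildeBC N m.m1 m.m2 m.m3) : q ∈ Qinv N m := by
  rintro (⟨j, b⟩ | ⟨⟨⟨i, b⟩, ⟨j, c⟩⟩, h⟩)
  · rw [actP_inl, Root.lin, Y, C_sgn_mul_pow_two_mul]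
    exact hq.1 j
  · by_cases hbc : c = b
    · subst hbc
      have h1 : Root.lin (.inr ⟨((i, c), (j, c)), h⟩) = C (sgn c) * (X i - X j) := by
        simp [Root.lin, Y, mul_sub]
      rw [actP_inr_same, h1, C_sgn_mul_pow_two_mul]
      exact (hq.2 i j h).1
    · obtain rfl : c = !b := by cases b <;> cases c <;> simp_all
      have h1 : Root.lin (.inr ⟨((i, b), (j, !b)), h⟩) = C (sgn b) * (X i + X j) := by
        simp [Root.lin, Y, mul_add]
      rw [actP_inr_diff, h1, C_sgn_mul_pow_two_mul]
      exact (hq.2 i j h).2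

lemma dvd_shiftPoly_sub {m : Mult} {p : MvPolynomial (Fin N) ℂ} (hp : p ∈ Qtr N m) (ρ : Root N)
    {σ : ℝ} (hσ : m.IsLevel ρ σ) {v w : Fin N → ℂ} (hv : eval v ρ.lin = σ)
    (hvw : v - (σ : ℂ) • (2 / ρ.nrm) • ρ.dir = w) : ρ.lin ∣ shiftPoly v p - shiftPoly w p := by
  refine ρ.affineAlong.dvd_of_vanish fun x hx => ?_
  have h1 : eval (x + v) ρ.lin = σ := by rw [Root.eval_lin_add, hx, hv, zero_add]
  rw [map_sub, eval_shiftPoly, eval_shiftPoly, hp ρ σ hσ _ h1, Root.act_eq, h1, ← hvw, sub_eq_zero]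
  congr 2
  ext k
  simp
  ring

lemma Qtr_subset (m : Mult) {p : MvPolynomial (Fin N) ℂ} (hp : p ∈ Qtr N m) :
    p ∈ QtrBC N m.m1 m.m2 m.m3 := by
  have h1 : ∀ (j : Fin N) (σ : ℝ), m.IsLevel (.inl (j, true) : Root N) σ →
      X j ∣ shiftPoly (Pi.single j (σ : ℂ)) p - shiftPoly (Pi.single j (-(σ : ℂ))) p := by
    intro j σ hσ
    have := dvd_shiftPoly_sub hp (.inl (j, true)) hσ (v := Pi.single j (σ : ℂ))
      (w := Pi.single j (-(σ : ℂ))) (by simp [Root.lin, coord]) (by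
        ext k
        by_cases h : k = j
        · subst h; simp [Root.nrm, Root.dir, vec]; ring
        · simp [Root.dir, vec, h])
    simpa [Root.lin, Y] using this
  refine ⟨fun j s hs hs' => ?_, fun j s hs hs' => ?_, fun i j hij s hs hs' => ⟨?_, ?_⟩⟩
  · simpa using h1 j s (Or.inl ⟨s, hs, hs', rfl⟩)
  · simpa using h1 j (s - 1 / 2) (Or.inr ⟨s, hs, hs', rfl⟩)
  · have := dvd_shiftPoly_sub hp (.inr ⟨((i, true), (j, true)), hij⟩) (σ := s) ⟨s, hs, hs', rfl⟩
      (v := Pi.single i (s : ℂ)) (w := Pi.single j (s : ℂ)) (by simp [Root.lin, coord, hij]) (by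
        ext k
        by_cases h : k = i
        · subst h; simp [Root.nrm, Root.dir, vec, hij]
        · by_cases h' : k = j
          · subst h'; simp [Root.nrm, Root.dir, vec, h]
          · simp [Root.dir, vec, h, h'])
    simpa [Root.lin, Y] using this
  · have := dvd_shiftPoly_sub hp (.inr ⟨((i, false), (j, true)), hij⟩) (σ := s) ⟨s, hs, hs', rfl⟩
      (v := Pi.single i (-(s : ℂ))) (w := Pi.single j (s : ℂ)) (by simp [Root.lin, coord, hij]) (by
        ext k
        by_cases h : k = i
        · subst h; simp [Root.nrm, Root.dir, vec, hij]
        · by_cases h' : k = j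
          · subst h'; simp [Root.nrm, Root.dir, vec, h]
          · simp [Root.dir, vec, h, h'])
    have h2 : Root.lin (.inr ⟨((i, false), (j, true)), hij⟩) = -(X i + X j) := by
      simp [Root.lin, Y]; ring
    rwa [h2, neg_dvd] at this

end Bridge

end QuasiInv

/-- every nonzero homogeneous `B_N` quasi-invariant `q ∈ Q_{m̃}` is the
highest-degree homogeneous part of some trigonometric `BC_N` quasi-invariant
`p ∈ Q_m^{tr}(BC_N)`; equivalently `gr(Q_m^{tr}(BC_N)) = Q_{m̃}`. -/
theorem stmt_16 (N : ℕ) (hN : 2 ≤ N) (m1 m2 m3 : ℕ)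
    (d : ℕ) (q : MvPolynomial (Fin N) ℂ) (hq0 : q ≠ 0)
    (hqhom : q.IsHomogeneous d)
    (hq : q ∈ QtildeBC N m1 m2 m3) :
    ∃ p ∈ QtrBC N m1 m2 m3,
      MvPolynomial.homogeneousComponent p.totalDegree p = q := by
  have hq' : q ∈ QuasiInv.Gr N ⟨m1, m2, m3⟩ d :=
    QuasiInv.mem_Gr_of_mem_Qinv hqhom (QuasiInv.QtildeBC_subset ⟨m1, m2, m3⟩ hq)
  obtain ⟨p, hp, hd, hpq⟩ := QuasiInv.mem_Gr.1 hq'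
  have hdeg : p.totalDegree = d := by
    refine hd.antisymm (not_lt.1 fun hlt => hq0 ?_)
    rw [← hpq, homogeneousComponent_eq_zero _ _ hlt]
  exact ⟨p, QuasiInv.Qtr_subset ⟨m1, m2, m3⟩ hp, by rw [hdeg, hpq]⟩
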